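/- (Kalai) Let P be a polytope of dimension d ≥ 3 in ℝ^d with vertex set V(P), fix for each 2-dimensional face of P a triangulation using only its vertices, and let E be the set of edges of P together with the diagonals of these triangulations. Then the space of stresses of the framework (V(P), E) — the real vector space of all ω : E → ℝ such that for every vertex v, Σ_{u : {u,v} ∈ E} ω({u,v})·(v − u) = 0 in ℝ^d — has dimension equal to g_2(P). -/

import Mathlib

open Classical Polynomial

section PolytopeDefs

variable {V : Type*} [AddCommGroup V] [Module ℝ V]

/-- A polytope: the convex hull of finitely many points. -/
def IsPolytope (P : Set V) : Prop := ∃ S : Finset V, P = convexHull ℝ (S : Set V)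

/-- Faces of a polytope (or of a cone): the set itself, the empty face, and the
sets of maximizers of linear functionals (equivalently, intersections with
supporting hyperplanes). -/
def IsFace (P F : Set V) : Prop :=
  F = P ∨ F = ∅ ∨ ∃ l : V →ₗ[ℝ] ℝ, F = {x | x ∈ P ∧ ∀ y ∈ P, l y ≤ l x}

/-- Dimension of a polytope: the dimension of its affine span, with the
convention `pdim ∅ = -1`. -/
noncomputable def pdim (P : Set V) : ℤ :=
  if P = ∅ then -1 else (Module.finrank ℝ (affineSpan ℝ P).direction : ℤ)

/-- The `g`-truncation: from the toric `h`-polynomial of a `d`-dimensional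
polytope to its toric `g`-polynomial, via `g_k = h_k - h_{k-1}` for
`0 ≤ k ≤ d/2`, with `h_{-1} = 0`. -/
noncomputable def truncG (d : ℤ) (h : Polynomial ℚ) : Polynomial ℚ :=
  ∑ k ∈ Finset.range (d.toNat / 2 + 1),
    Polynomial.C (h.coeff k - if k = 0 then 0 else h.coeff (k - 1)) * Polynomial.X ^ k

/-- Fuelled recursion computing the toric `h`-polynomial of the interval `[F,G]`
of a face lattice (with `F` playing the role of the empty face):
`h([F,G],t) = ∑_{F ≤ G' < G} g([F,G'],t) · (t-1)^{dim G - dim G' - 1}`. -/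
noncomputable def relHAux : ℕ → Set V → Set V → Polynomial ℚ
  | 0, _, _ => 1
  | n + 1, F, G =>
      if G = F then 1
      else ∑ᶠ G' ∈ {G' : Set V | IsFace G G' ∧ F ⊆ G' ∧ G' ≠ G},
        truncG (pdim G' - pdim F - 1) (relHAux n F G') *
          (Polynomial.X - 1) ^ (pdim G - pdim G' - 1).toNat

/-- The toric `h`-polynomial of the interval `[F,G]` in a face lattice. -/
noncomputable def relH (F G : Set V) : Polynomial ℚ := relHAux (pdim G + 1).toNat F G

/-- The toric `g`-polynomial of the interval `[F,G]` in a face lattice;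
`relG F P` is the polynomial `g(P/F, t)`. -/
noncomputable def relG (F G : Set V) : Polynomial ℚ :=
  truncG (pdim G - pdim F - 1) (relH F G)

/-- The toric `h`-polynomial `h(P,t)` of a polytope `P`. -/
noncomputable def toricH (P : Set V) : Polynomial ℚ := relH ∅ P

/-- The toric `g`-polynomial `g(P,t)` of a polytope `P`. -/
noncomputable def toricG (P : Set V) : Polynomial ℚ := relG ∅ P

end PolytopeDefs
section FrameworkDefs

variable {d : ℕ}

/-- A triangulation of a 2-dimensional face `G` using only its vertices: a
finite collection of affinely independent triples of vertices of `G` whose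
triangles cover `G` and such that any two triangles meet in the convex hull of
their common vertices. -/
def IsTriangulation (G : Set (Fin d → ℝ)) (T : Finset (Finset (Fin d → ℝ))) : Prop :=
  (∀ t ∈ T, t.card = 3 ∧ (∀ v ∈ t, IsFace G {v}) ∧
    AffineIndependent ℝ (fun x : (t : Set (Fin d → ℝ)) => (x : Fin d → ℝ))) ∧
  (⋃ t ∈ T, convexHull ℝ (t : Set (Fin d → ℝ))) = G ∧
  (∀ t ∈ T, ∀ t' ∈ T,
    convexHull ℝ (t : Set (Fin d → ℝ)) ∩ convexHull ℝ (t' : Set (Fin d → ℝ)) =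
      convexHull ℝ ((t ∩ t' : Finset (Fin d → ℝ)) : Set (Fin d → ℝ)))

/-- `{u,v}` is an edge of the framework associated to the polytope `P` and the
chosen triangulations `T` of its 2-faces: an edge of `P`, or an edge/diagonal
of the triangulation of a 2-dimensional face of `P`. -/
def FrameEdge (P : Set (Fin d → ℝ)) (T : Set (Fin d → ℝ) → Finset (Finset (Fin d → ℝ)))
    (u v : Fin d → ℝ) : Prop :=
  u ≠ v ∧ (IsFace P (segment ℝ u v) ∨
    ∃ G : Set (Fin d → ℝ), IsFace P G ∧ pdim G = 2 ∧ ∃ t ∈ T G, u ∈ t ∧ v ∈ t)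

end FrameworkDefs

/-- A stress of the framework of a polytope `P` (with triangulated 2-faces):
a symmetric assignment of reals to the edges such that the forces at every
vertex balance. -/
def IsStress {d : ℕ} (P : Set (Fin d → ℝ))
    (T : Set (Fin d → ℝ) → Finset (Finset (Fin d → ℝ)))
    (ω : (Fin d → ℝ) → (Fin d → ℝ) → ℝ) : Prop :=
  (∀ u v : Fin d → ℝ, ω u v = ω v u) ∧
  (∀ u v : Fin d → ℝ, ω u v ≠ 0 → FrameEdge P T u v) ∧
  (∀ v : Fin d → ℝ, IsFace P {v} → ∑ᶠ u : Fin d → ℝ, ω u v • (v - u) = 0)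

section Aux
open Finset (sum_sub_distrib sum_mul sum_eq_zero_iff_of_nonneg sum_nonneg coe_subset
  mem_image_of_mem mk_mem_product nonempty_iff_ne_empty mem_coe sum_eq_single_of_mem
  sum_add_distrib sum_congr mem_erase mem_image mem_sdiff mul_sum add_sum_erase mem_union
  mem_filter sdiff_subset_sdiff mem_union_left mem_union_right sum_neg_distrib mem_singleton
  sum_filter mem_insert mem_univ univ_nonempty sum_eq_zero smul_sum sum_comm one_lt_card
  mem_powersetCard card_eq_two card_pair eq_of_subset_of_card_le mem_biUnion sum_pair)

section PartA
variable {V : Type*} [AddCommGroup V] [Module ℝ V]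

noncomputable def topS (S : Finset V) (l : V →ₗ[ℝ] ℝ) : Finset V :=
  S.filter (fun x => ∀ y ∈ S, l y ≤ l x)

noncomputable def fs (A : Finset V) : Finset (Finset V) :=
  A.powerset.filter (fun B => B = ∅ ∨ ∃ l, B = topS A l)

noncomputable def rk (A : Finset V) : ℕ :=
  if A = ∅ then 0 else Module.finrank ℝ (vectorSpan ℝ (A : Set V)) + 1

abbrev cv (A : Finset V) : Set V := convexHull ℝ (A : Set V)

lemma mem_topS {S : Finset V} {l : V →ₗ[ℝ] ℝ} {x : V} :
    x ∈ topS S l ↔ x ∈ S ∧ ∀ y ∈ S, l y ≤ l x := by simp [topS]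

lemma topS_subset (S : Finset V) (l : V →ₗ[ℝ] ℝ) : topS S l ⊆ S := Finset.filter_subset _ _

lemma topS_nonempty {S : Finset V} (hS : S.Nonempty) (l : V →ₗ[ℝ] ℝ) : (topS S l).Nonempty := by
  obtain ⟨x, hx, h⟩ := S.exists_max_image l hS
  exact ⟨x, mem_topS.2 ⟨hx, h⟩⟩

lemma topS_zero (S : Finset V) : topS S 0 = S := by ext x; simp [mem_topS]

lemma mem_fs {A B : Finset V} : B ∈ fs A ↔ B ⊆ A ∧ (B = ∅ ∨ ∃ l, B = topS A l) := by
  simp [fs]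

lemma empty_mem_fs (A : Finset V) : ∅ ∈ fs A := by simp [mem_fs]

lemma topS_mem_fs (A : Finset V) (l) : topS A l ∈ fs A :=
  mem_fs.2 ⟨topS_subset _ _, Or.inr ⟨l, rfl⟩⟩

lemma self_mem_fs (A : Finset V) : A ∈ fs A := by
  simpa [topS_zero] using topS_mem_fs A 0

lemma cv_le {A : Finset V} {l : V →ₗ[ℝ] ℝ} {c : ℝ} (h : ∀ y ∈ A, l y ≤ c) {x : V} (hx : x ∈ cv A) :
    l x ≤ c :=
  convexHull_min (s := (A : Set V)) (t := {x | l x ≤ c}) (fun y hy => h y hy)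
    (convex_halfSpace_le l.isLinear c) hx

lemma weight_top {A : Finset V} {l : V →ₗ[ℝ] ℝ} {w : V → ℝ} {c : ℝ} (h0 : ∀ v ∈ A, 0 ≤ w v)
    (h1 : ∑ v ∈ A, w v = 1) (hc : ∀ y ∈ A, l y ≤ c) (hx : c ≤ l (∑ v ∈ A, w v • v)) :
    ∀ v ∈ A, w v ≠ 0 → l v = c := by
  have hs : ∑ v ∈ A, w v * (c - l v) ≤ 0 := by
    have : ∑ v ∈ A, w v * (c - l v) = c - l (∑ v ∈ A, w v • v) := by
      simp only [mul_sub, sum_sub_distrib, ← sum_mul, h1, map_sum, map_smul,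
        smul_eq_mul, one_mul]
    linarith
  have hn : ∀ v ∈ A, 0 ≤ w v * (c - l v) := fun v hv => mul_nonneg (h0 v hv) (by linarith [hc v hv])
  have hz := (sum_eq_zero_iff_of_nonneg hn).1 (le_antisymm hs (sum_nonneg hn))
  intro v hv hw
  rcases mul_eq_zero.1 (hz v hv) with h | h
  · exact absurd h hw
  · linarith

lemma mem_cv_top {A : Finset V} {l : V →ₗ[ℝ] ℝ} {x : V} (hx : x ∈ cv A)
    (h : ∀ y ∈ A, l y ≤ l x) : x ∈ cv (topS A l) := by
  obtain ⟨w, h0, h1, rfl⟩ := Finset.mem_convexHull'.1 hx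
  have hk := weight_top h0 h1 h le_rfl
  have hsub : ∀ v ∈ A, v ∉ topS A l → w v = 0 := by
    intro v hv hn
    by_contra hw
    exact hn (mem_topS.2 ⟨hv, fun y hy => (hk v hv hw) ▸ h y hy⟩)
  refine Finset.mem_convexHull'.2 ⟨w, fun v hv => h0 v (topS_subset _ _ hv), ?_, ?_⟩
  · rw [← h1]; exact Finset.sum_subset (topS_subset _ _) hsub
  · exact Finset.sum_subset (topS_subset _ _) (fun v hv hn => by rw [hsub v hv hn, zero_smul])

lemma face_eq (A : Finset V) (l : V →ₗ[ℝ] ℝ) :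
    {x | x ∈ cv A ∧ ∀ y ∈ cv A, l y ≤ l x} = cv (topS A l) := by
  ext x
  constructor
  · rintro ⟨hx, h⟩
    exact mem_cv_top hx (fun y hy => h y (subset_convexHull ℝ _ hy))
  · intro hx
    have hxA : x ∈ cv A := convexHull_mono (coe_subset.2 (topS_subset A l)) hx
    refine ⟨hxA, fun y hy => ?_⟩
    have hne : (topS A l).Nonempty := by
      rw [← Finset.coe_nonempty, ← convexHull_nonempty_iff (𝕜 := ℝ)]; exact ⟨x, hx⟩
    obtain ⟨v, hv⟩ := hne
    have h1 : l y ≤ l v := cv_le (mem_topS.1 hv).2 hy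
    have h2 : (-l) x ≤ -(l v) := cv_le (l := -l) (fun z hz => by
      simpa using (mem_topS.1 hz).2 v (mem_topS.1 hv).1) hx
    simp at h2; linarith

lemma isFace_iff {A : Finset V} {F : Set V} : IsFace (cv A) F ↔ ∃ B ∈ fs A, F = cv B := by
  constructor
  · rintro (rfl | rfl | ⟨l, rfl⟩)
    · exact ⟨A, self_mem_fs A, rfl⟩
    · exact ⟨∅, empty_mem_fs A, by simp [cv]⟩
    · exact ⟨_, topS_mem_fs A l, face_eq A l⟩
  · rintro ⟨B, hB, rfl⟩
    rcases (mem_fs.1 hB).2 with rfl | ⟨l, rfl⟩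
    · right; left; simp [cv]
    · right; right; exact ⟨l, (face_eq A l).symm⟩

lemma mem_of_mem_cv {A B : Finset V} (hB : B ∈ fs A) {v : V} (hv : v ∈ A) (h : v ∈ cv B) : v ∈ B := by
  rcases (mem_fs.1 hB).2 with rfl | ⟨l, rfl⟩
  · simp [cv] at h
  · rw [← face_eq] at h
    exact mem_topS.2 ⟨hv, fun y hy => h.2 y (subset_convexHull ℝ _ hy)⟩

lemma cv_subset_iff {A B C : Finset V} (hB : B ∈ fs A) (hC : C ∈ fs A) : cv B ⊆ cv C ↔ B ⊆ C :=
  ⟨fun h v hv => mem_of_mem_cv hC ((mem_fs.1 hB).1 hv) (h (subset_convexHull ℝ _ hv)),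
    fun h => convexHull_mono (coe_subset.2 h)⟩

lemma cv_injOn (A : Finset V) : Set.InjOn (cv (V := V)) (fs A : Set (Finset V)) := by
  intro B hB C hC h
  exact Finset.Subset.antisymm ((cv_subset_iff hB hC).1 h.subset) ((cv_subset_iff hC hB).1 h.symm.subset)

lemma fs_trans {S B C : Finset V} (hB : B ∈ fs S) : C ∈ fs B ↔ C ∈ fs S ∧ C ⊆ B := by
  constructor
  · intro hC
    have hCB := (mem_fs.1 hC).1
    refine ⟨mem_fs.2 ⟨hCB.trans (mem_fs.1 hB).1, ?_⟩, hCB⟩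
    rcases (mem_fs.1 hC).2 with rfl | ⟨l', rfl⟩
    · exact Or.inl rfl
    rcases (mem_fs.1 hB).2 with rfl | ⟨l, hl⟩
    · left; simp [topS]
    right
    obtain ⟨N, hN⟩ := Finset.exists_le ((S ×ˢ S).image (fun q => (l' q.1 - l' q.2) / (l q.2 - l q.1)))
    have hB' : ∀ b, b ∈ B ↔ b ∈ S ∧ ∀ y ∈ S, l y ≤ l b := fun b => by rw [hl, mem_topS]
    have key : ∀ v ∈ S, v ∉ B → ∀ b ∈ B, (N + 1) * l v + l' v < (N + 1) * l b + l' b := by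
      intro v hv hvB b hb
      have hlt : l v < l b := by
        grind
      have := hN _ (mem_image_of_mem _ (mk_mem_product hv ((hB' b).1 hb).1))
      rw [div_le_iff₀ (by simpa using hlt)] at this
      simp only at this
      nlinarith
    have heq : ∀ v ∈ B, ∀ b ∈ B, l v = l b := fun v hv b hb =>
      le_antisymm (((hB' b).1 hb).2 v ((hB' v).1 hv).1) (((hB' v).1 hv).2 b ((hB' b).1 hb).1)
    refine ⟨(N + 1) • l + l', ?_⟩
    ext x
    simp only [mem_topS, LinearMap.add_apply, LinearMap.smul_apply, smul_eq_mul]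
    constructor
    · grind
    · rintro ⟨hx, h⟩
      have hxB : x ∈ B := by
        by_contra hxB
        obtain ⟨b, hb⟩ : B.Nonempty := hl ▸ topS_nonempty ⟨x, hx⟩ l
        exact absurd (h b ((hB' b).1 hb).1) (not_le.2 (key x hx hxB b hb))
      refine ⟨hxB, fun y hy => ?_⟩
      have := h y ((hB' y).1 hy).1
      rw [heq y hy x hxB] at this; linarith
  · rintro ⟨hC, hCB⟩
    refine mem_fs.2 ⟨hCB, ?_⟩
    rcases (mem_fs.1 hC).2 with rfl | ⟨l, hl⟩
    · exact Or.inl rfl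
    by_cases hne : C = ∅
    · exact Or.inl hne
    right
    refine ⟨l, ?_⟩
    obtain ⟨c, hc⟩ := nonempty_iff_ne_empty.2 hne
    have hBS := (mem_fs.1 hB).1
    ext x
    constructor
    · intro hx
      exact mem_topS.2 ⟨hCB hx, fun y hy => (mem_topS.1 (hl ▸ hx)).2 y (hBS hy)⟩
    · intro hx
      rw [hl]
      exact mem_topS.2 ⟨hBS (mem_topS.1 hx).1, fun y hy =>
        ((mem_topS.1 (hl ▸ hc)).2 y hy).trans ((mem_topS.1 hx).2 c (hCB hc))⟩

lemma vs_le_ker (A : Finset V) (l : V →ₗ[ℝ] ℝ) :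
    vectorSpan ℝ (topS A l : Set V) ≤ LinearMap.ker l := by
  rw [vectorSpan_def, Submodule.span_le]
  rintro _ ⟨a, ha, b, hb, rfl⟩
  have ha' := mem_topS.1 ha
  have hb' := mem_topS.1 hb
  simp only [SetLike.mem_coe, LinearMap.mem_ker, vsub_eq_sub, map_sub]
  linarith [ha'.2 b hb'.1, hb'.2 a ha'.1]

instance (A : Finset V) : FiniteDimensional ℝ (vectorSpan ℝ (A : Set V)) :=
  finiteDimensional_vectorSpan_of_finite ℝ A.finite_toSet

lemma rk_lt {A B : Finset V} (hB : B ∈ fs A) (hne : B ≠ A) : rk B < rk A := by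
  obtain ⟨hBA, h⟩ := mem_fs.1 hB
  have hA : A ≠ ∅ := by rintro rfl; exact hne (Finset.subset_empty.1 hBA)
  unfold rk
  rw [if_neg hA]
  split_ifs with h0
  · omega
  rcases h with rfl | ⟨l, rfl⟩
  · exact absurd rfl h0
  have : Module.finrank ℝ (vectorSpan ℝ (topS A l : Set V)) <
      Module.finrank ℝ (vectorSpan ℝ (A : Set V)) := by
    apply Submodule.finrank_lt_finrank_of_lt
    refine lt_of_le_of_ne (vectorSpan_mono ℝ (coe_subset.2 hBA)) ?_
    intro heq
    apply hne
    apply Finset.Subset.antisymm hBA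
    intro v hv
    obtain ⟨b, hb⟩ := nonempty_iff_ne_empty.2 h0
    have hb' := mem_topS.1 hb
    have : v - b ∈ vectorSpan ℝ (topS A l : Set V) := by
      rw [heq]; exact vsub_mem_vectorSpan ℝ (mem_coe.2 hv) (mem_coe.2 hb'.1)
    have := vs_le_ker A l this
    rw [LinearMap.mem_ker, map_sub] at this
    exact mem_topS.2 ⟨hv, fun y hy => (hb'.2 y hy).trans (by linarith)⟩
  omega

lemma rk_le {A B : Finset V} (hB : B ∈ fs A) : rk B ≤ rk A := by
  by_cases h : B = A
  · rw [h]
  · exact (rk_lt hB h).le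

lemma rk_empty : rk (∅ : Finset V) = 0 := by simp [rk]

lemma pdim_cv (A : Finset V) : pdim (cv A) = (rk A : ℤ) - 1 := by
  unfold pdim rk
  by_cases h : A = ∅
  · simp [h]
  · have : cv A ≠ ∅ := by
      rw [← Set.nonempty_iff_ne_empty, convexHull_nonempty_iff]
      exact nonempty_iff_ne_empty.2 h
    rw [if_neg this, if_neg h, affineSpan_convexHull, direction_affineSpan]
    push_cast; ring
end PartA

section PartB
open Filter Topology
variable {W : Type*} [AddCommGroup W] [Module ℝ W]

lemma perturb (G : Finset (W →ₗ[ℝ] ℝ)) (x y : W) (h : ∀ g ∈ G, 0 < g x) :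
    ∃ ε : ℝ, 0 < ε ∧ ∀ g ∈ G, 0 < g (x + ε • y) := by
  have h1 : ∀ᶠ ε : ℝ in 𝓝[>] 0, ∀ g ∈ G, 0 < g (x + ε • y) := by
    rw [Filter.eventually_all_finset]
    intro g hg
    have hc : Continuous (fun ε : ℝ => g (x + ε • y)) := by
      simp only [map_add, map_smul, smul_eq_mul]; fun_prop
    have := hc.tendsto 0
    simp only [zero_smul, add_zero] at this
    exact (this.eventually (lt_mem_nhds (h g hg))).filter_mono nhdsWithin_le_nhds
  obtain ⟨ε, h2, h3⟩ := (h1.and self_mem_nhdsWithin).exists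
  exact ⟨ε, h3, h2⟩

def cset (K : Submodule ℝ W) (G : Finset (W →ₗ[ℝ] ℝ)) : Set W := {x | x ∈ K ∧ ∀ g ∈ G, 0 < g x}

def IsC (U : Set W) : Prop := ∃ K G, U = cset (W := W) K G

noncomputable def chi (U : Set W) : ℤ :=
  if U = ∅ then 0 else (-1) ^ Module.finrank ℝ (Submodule.span ℝ U)

lemma span_cset {K : Submodule ℝ W} {G} (h : (cset K G).Nonempty) :
    Submodule.span ℝ (cset K G) = K := by
  apply le_antisymm
  · rw [Submodule.span_le]; exact fun x hx => hx.1
  · intro y hy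
    obtain ⟨x, hx⟩ := h
    obtain ⟨ε, he, h2⟩ := perturb G x y hx.2
    have h3 : x + ε • y ∈ cset K G := ⟨K.add_mem hx.1 (K.smul_mem _ hy), h2⟩
    have h4 := Submodule.smul_mem _ ε⁻¹ (Submodule.sub_mem _ (Submodule.subset_span h3)
      (Submodule.subset_span (R := ℝ) hx))
    rwa [add_sub_cancel_left, smul_smul, inv_mul_cancel₀ he.ne', one_smul] at h4

lemma chi_cset {K : Submodule ℝ W} {G} (h : (cset K G).Nonempty) :
    chi (cset K G) = (-1) ^ Module.finrank ℝ K := by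
  rw [chi, if_neg h.ne_empty, span_cset h]

lemma isC_pos {U : Set W} (h : IsC U) (f : W →ₗ[ℝ] ℝ) : IsC (U ∩ {x | 0 < f x}) := by
  obtain ⟨K, G, rfl⟩ := h
  refine ⟨K, insert f G, ?_⟩
  ext x; simp [cset]; tauto

lemma isC_neg {U : Set W} (h : IsC U) (f : W →ₗ[ℝ] ℝ) : IsC (U ∩ {x | f x < 0}) := by
  have := isC_pos h (-f)
  simpa using this

lemma isC_zero {U : Set W} (h : IsC U) (f : W →ₗ[ℝ] ℝ) : IsC (U ∩ {x | f x = 0}) := by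
  obtain ⟨K, G, rfl⟩ := h
  refine ⟨K ⊓ LinearMap.ker f, G, ?_⟩
  ext x; simp [cset]; tauto

variable [FiniteDimensional ℝ W]

lemma finrank_inf_ker {K : Submodule ℝ W} {f : W →ₗ[ℝ] ℝ} {y : W} (hy : y ∈ K) (hf : f y ≠ 0) :
    Module.finrank ℝ K = Module.finrank ℝ (K ⊓ LinearMap.ker f : Submodule ℝ W) + 1 := by
  have h1 := LinearMap.finrank_range_add_finrank_ker (f.domRestrict K)
  have h2 : LinearMap.range (f.domRestrict K) = ⊤ := by
    rw [LinearMap.range_eq_top]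
    intro c
    refine ⟨(c / f y) • ⟨y, hy⟩, ?_⟩
    simp [hf]
  have h3 : Module.finrank ℝ (LinearMap.ker (f.domRestrict K)) =
      Module.finrank ℝ (K ⊓ LinearMap.ker f : Submodule ℝ W) := by
    have : LinearMap.ker (f.domRestrict K) = (LinearMap.ker f).comap K.subtype := by
      ext x; simp
    rw [this]
    have h4 := LinearEquiv.finrank_eq
      (Submodule.equivMapOfInjective K.subtype K.injective_subtype ((LinearMap.ker f).comap K.subtype))
    rw [h4, Submodule.map_comap_subtype]
  rw [h2, finrank_top, Module.finrank_self, h3] at h1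
  omega

lemma chi_cut {U : Set W} (h : IsC U) (f : W →ₗ[ℝ] ℝ) :
    chi U = chi (U ∩ {x | 0 < f x}) + chi (U ∩ {x | f x = 0}) + chi (U ∩ {x | f x < 0}) := by
  have chi_e : chi (∅ : Set W) = 0 := by simp [chi]
  by_cases hz : (U ∩ {x | f x = 0}).Nonempty
  · obtain ⟨K1, G1, e1⟩ := isC_pos h f
    obtain ⟨K, G, rfl⟩ := h
    by_cases hK : ∀ y ∈ K, f y = 0
    · have e1 : cset K G ∩ {x | 0 < f x} = ∅ := by
        ext x; simp only [Set.mem_inter_iff, Set.mem_ofPred_eq, Set.mem_empty_iff_false, iff_false]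
        rintro ⟨h1, h2⟩; rw [hK x h1.1] at h2; exact lt_irrefl _ h2
      have e2 : cset K G ∩ {x | f x < 0} = ∅ := by
        ext x; simp only [Set.mem_inter_iff, Set.mem_ofPred_eq, Set.mem_empty_iff_false, iff_false]
        rintro ⟨h1, h2⟩; rw [hK x h1.1] at h2; exact lt_irrefl _ h2
      have e3 : cset K G ∩ {x | f x = 0} = cset K G :=
        Set.inter_eq_left.2 (fun x hx => hK x hx.1)
      rw [e1, e2, e3, chi_e]; ring
    · push Not at hK
      obtain ⟨y, hy, hfy⟩ := hK
      obtain ⟨x, hx, hfx⟩ := hz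
      have hne : (cset K G).Nonempty := ⟨x, hx⟩
      have hp : ∀ z ∈ K, ∀ (f' : W →ₗ[ℝ] ℝ), f' x = 0 → 0 < f' z →
          chi (cset K G ∩ {x | 0 < f' x}) = (-1) ^ Module.finrank ℝ K := by
        intro z hz f' hf' hz'
        have e : cset K G ∩ {x | 0 < f' x} = cset K (insert f' G) := by
          ext x; simp [cset]; tauto
        obtain ⟨ε, he, h2⟩ := perturb G x z hx.2
        rw [e]
        apply chi_cset
        rw [← e]
        refine ⟨x + ε • z, ⟨K.add_mem hx.1 (K.smul_mem _ hz), h2⟩, ?_⟩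
        simp [hf', he, hz']
      have h1 : chi (cset K G ∩ {x | f x = 0}) =
          (-1) ^ Module.finrank ℝ (K ⊓ LinearMap.ker f : Submodule ℝ W) := by
        have e : cset K G ∩ {x | f x = 0} = cset (K ⊓ LinearMap.ker f) G := by
          ext x; simp [cset]; tauto
        rw [e]; apply chi_cset; rw [← e]; exact ⟨x, hx, hfx⟩
      have hs : ∃ z ∈ K, 0 < f z := by
        rcases lt_or_gt_of_ne hfy with h | h
        · exact ⟨-y, K.neg_mem hy, by simpa using h⟩
        · exact ⟨y, hy, h⟩
      obtain ⟨z, hz, hfz⟩ := hs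
      have h2 := hp z hz f hfx hfz
      have h3 := hp (-z) (K.neg_mem hz) (-f) (by simpa using hfx) (by simpa using hfz)
      simp only [LinearMap.neg_apply, Left.neg_pos_iff] at h3
      rw [h1, h2, h3, chi_cset hne, finrank_inf_ker hy hfy]
      ring
  · rw [Set.not_nonempty_iff_eq_empty] at hz
    rw [hz, chi_e, add_zero]
    have key : ∀ x ∈ U, ∀ y ∈ U, 0 < f x → f y < 0 → False := by
      obtain ⟨K, G, rfl⟩ := h
      intro x hx y hy hfx hfy
      have : f x • y + (-(f y)) • x ∈ cset K G ∩ {x | f x = 0} := by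
        refine ⟨⟨K.add_mem (K.smul_mem _ hy.1) (K.smul_mem _ hx.1), fun g hg => ?_⟩, ?_⟩
        · simp only [map_add, map_smul, smul_eq_mul]
          nlinarith [mul_pos hfx (hy.2 g hg), mul_pos (neg_pos.2 hfy) (hx.2 g hg)]
        · simp; ring
      rw [hz] at this; exact this
    have key2 : ∀ x ∈ U, f x ≠ 0 := by
      intro x hx h0
      have : x ∈ U ∩ {x | f x = 0} := ⟨hx, h0⟩
      rw [hz] at this; exact this
    by_cases hp : ∃ x ∈ U, 0 < f x
    · obtain ⟨x, hx, hfx⟩ := hp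
      have e1 : U ∩ {x | 0 < f x} = U := Set.inter_eq_left.2 (fun y hy => by
        rcases lt_or_gt_of_ne (key2 y hy) with h | h
        · exact (key x hx y hy hfx h).elim
        · exact h)
      have e2 : U ∩ {x | f x < 0} = ∅ := by
        ext y; simp only [Set.mem_inter_iff, Set.mem_ofPred_eq, Set.mem_empty_iff_false, iff_false]
        rintro ⟨h1, h2⟩; exact key x hx y h1 hfx h2
      rw [e1, e2, chi_e, add_zero]
    · push Not at hp
      have e1 : U ∩ {x | f x < 0} = U := Set.inter_eq_left.2 (fun y hy =>
        lt_of_le_of_ne (hp y hy) (key2 y hy))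
      have e2 : U ∩ {x | 0 < f x} = ∅ := by
        ext y; simp only [Set.mem_inter_iff, Set.mem_ofPred_eq, Set.mem_empty_iff_false, iff_false]
        rintro ⟨h1, h2⟩; exact absurd (hp y h1) (not_le.2 h2)
      rw [e1, e2, chi_e, zero_add]

lemma chi_partition {α : Type*} (s : Finset α) (R : α → Set W) (Φ : List (W →ₗ[ℝ] ℝ)) :
    ∀ U : Set W, IsC U → (∀ a ∈ s, IsC (U ∩ R a)) → (∀ x ∈ U, ∃ a ∈ s, x ∈ R a) →
    (∀ x ∈ U, ∀ a ∈ s, ∀ b ∈ s, x ∈ R a → x ∈ R b → a = b) →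
    (∀ a ∈ s, ∀ x ∈ U, ∀ y ∈ U, (∀ f ∈ Φ, SignType.sign (f x) = SignType.sign (f y)) → x ∈ R a → y ∈ R a) →
    chi U = ∑ a ∈ s, chi (U ∩ R a) := by
  induction Φ with
  | nil =>
    intro U hU hR hex hun hs
    rcases U.eq_empty_or_nonempty with rfl | ⟨x, hx⟩
    · simp [chi]
    · obtain ⟨a, ha, hxa⟩ := hex x hx
      rw [sum_eq_single_of_mem a ha]
      · rw [Set.inter_eq_left.2 (fun y hy => hs a ha x hx y hy (by simp) hxa)]
      · intro b hb hne
        have : U ∩ R b = ∅ := by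
          grind
        simp [this, chi]
  | cons f Φ ih =>
    intro U hU hR hex hun hs
    rw [chi_cut hU f]
    have key : ∀ Z : Set W, (∀ x ∈ Z, ∀ y ∈ Z, SignType.sign (f x) = SignType.sign (f y)) →
        IsC (U ∩ Z) → (∀ a ∈ s, IsC (U ∩ R a ∩ Z)) →
        chi (U ∩ Z) = ∑ a ∈ s, chi (U ∩ R a ∩ Z) := by
      grind
    rw [key {x | 0 < f x} (fun x hx y hy => by rw [sign_pos hx, sign_pos hy]) (isC_pos hU f)
        (fun a ha => isC_pos (hR a ha) f),
      key {x | f x = 0} (fun x hx y hy => by rw [Set.mem_ofPred.1 hx, Set.mem_ofPred.1 hy]) (isC_zero hU f)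
        (fun a ha => isC_zero (hR a ha) f),
      key {x | f x < 0} (fun x hx y hy => by rw [sign_neg hx, sign_neg hy]) (isC_neg hU f)
        (fun a ha => isC_neg (hR a ha) f), ← sum_add_distrib, ← sum_add_distrib]
    exact sum_congr rfl (fun a ha => (chi_cut (hR a ha) f).symm)
end PartB

section PartB2
variable {V : Type*} [AddCommGroup V] [Module ℝ V]

abbrev evd (a b : V) : (V →ₗ[ℝ] ℝ) →ₗ[ℝ] ℝ := Module.Dual.eval ℝ V (a - b)

lemma evd_apply (a b : V) (l : V →ₗ[ℝ] ℝ) : evd a b l = l a - l b := by simp [evd]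

noncomputable def annS (A : Finset V) : Submodule ℝ (V →ₗ[ℝ] ℝ) :=
  Submodule.dualAnnihilator (vectorSpan ℝ (A : Set V))

lemma mem_annS {A : Finset V} {l : V →ₗ[ℝ] ℝ} : l ∈ annS A ↔ ∀ a ∈ A, ∀ b ∈ A, l a = l b := by
  rw [annS, Submodule.mem_dualAnnihilator]
  constructor
  · intro h a ha b hb
    have := h _ (vsub_mem_vectorSpan ℝ (mem_coe.2 ha) (mem_coe.2 hb))
    rw [vsub_eq_sub, map_sub] at this; linarith
  · intro h w hw
    have : vectorSpan ℝ (A : Set V) ≤ LinearMap.ker l := by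
      rw [vectorSpan_def, Submodule.span_le]
      rintro _ ⟨a, ha, b, hb, rfl⟩
      simp [h a ha b hb]
    exact this hw

variable [FiniteDimensional ℝ V]

lemma finrank_annS {A : Finset V} (hA : A ≠ ∅) :
    Module.finrank ℝ (annS A) + rk A = Module.finrank ℝ V + 1 := by
  have : Module.finrank ℝ (vectorSpan ℝ (A : Set V)) + Module.finrank ℝ (annS A) = Module.finrank ℝ V :=
    Subspace.finrank_add_finrank_dualAnnihilator_eq (vectorSpan ℝ (A : Set V))
  rw [rk, if_neg hA]; omega

lemma sgn_sub {a b : ℝ} {c d : ℝ} (h : SignType.sign (a - b) = SignType.sign (c - d)) :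
    (a ≤ b ↔ c ≤ d) := by
  rw [← sub_nonpos, ← sub_nonpos (a := c), ← not_lt, ← not_lt, ← sign_eq_one_iff, h, sign_eq_one_iff]

lemma neg_one_pow_par {a b c d : ℕ} (h : a + b = c + d) :
    (-1 : ℤ) ^ a = (-1) ^ c * ((-1) ^ d * (-1) ^ b) := by
  rw [← mul_assoc, ← pow_add, ← h, pow_add, mul_assoc, ← mul_pow]; simp

lemma euler_empty (S : Finset V) (hS : S ≠ ∅) : ∑ A ∈ fs S, (-1 : ℤ) ^ rk A = 0 := by
  have hne := nonempty_iff_ne_empty.2 hS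
  have h0 : IsC (Set.univ : Set (V →ₗ[ℝ] ℝ)) := ⟨⊤, ∅, by simp [cset]⟩
  have hN : ∀ A ∈ (fs S).erase ∅, Set.univ ∩ {l | topS S l = A} =
      cset (annS A) ((A ×ˢ (S \ A)).image (fun q => evd q.1 q.2)) := by
    intro A hA
    obtain ⟨hA0, hA⟩ := mem_erase.1 hA
    obtain ⟨a0, ha0⟩ := nonempty_iff_ne_empty.2 hA0
    have hAS := (mem_fs.1 hA).1
    ext l
    simp only [Set.univ_inter, cset, Set.mem_ofPred_eq, mem_annS]
    constructor
    · rintro rfl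
      refine ⟨fun a ha b hb => le_antisymm ((mem_topS.1 hb).2 _ (mem_topS.1 ha).1)
        ((mem_topS.1 ha).2 _ (mem_topS.1 hb).1), ?_⟩
      intro g hg
      obtain ⟨⟨a, v⟩, hq, rfl⟩ := mem_image.1 hg
      obtain ⟨ha, hv⟩ := Finset.mem_product.1 hq
      rw [evd_apply, sub_pos]
      by_contra hcon
      push Not at hcon
      obtain ⟨hv1, hv2⟩ := mem_sdiff.1 hv
      exact hv2 (mem_topS.2 ⟨hv1, fun y hy => ((mem_topS.1 ha).2 y hy).trans hcon⟩)
    · rintro ⟨h1, h2⟩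
      have h3 : ∀ a ∈ A, ∀ v ∈ S, v ∉ A → l v < l a := by
        intro a ha v hv hvA
        have := h2 _ (mem_image_of_mem (fun q : V × V => evd q.1 q.2)
          (mk_mem_product ha (mem_sdiff.2 ⟨hv, hvA⟩)))
        simp only [evd_apply] at this
        linarith
      ext x
      rw [mem_topS]
      constructor
      · rintro ⟨hx, h⟩
        by_contra hxA
        exact absurd (h a0 (hAS ha0)) (not_le.2 (h3 a0 ha0 x hx hxA))
      · intro hx
        refine ⟨hAS hx, fun y hy => ?_⟩
        by_cases hyA : y ∈ A
        · exact (h1 y hyA x hx).le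
        · exact (h3 x hx y hy hyA).le
  have key := chi_partition ((fs S).erase ∅) (fun A => {l | topS S l = A})
    ((S ×ˢ S).toList.map (fun q => evd q.1 q.2)) Set.univ h0
    (fun A hA => ⟨_, _, hN A hA⟩)
    (fun l _ => ⟨topS S l, mem_erase.2 ⟨(topS_nonempty hne l).ne_empty, topS_mem_fs S l⟩, rfl⟩)
    (fun l _ A _ B _ h1 h2 => h1.symm.trans h2) (by
      rintro A hA l - l' - h hl
      rw [Set.mem_ofPred_eq] at hl ⊢
      rw [← hl]
      ext x
      simp only [mem_topS]
      refine and_congr_right (fun hx => forall₂_congr (fun y hy => ?_))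
      have := h (evd y x) (List.mem_map.2 ⟨(y, x), by simp [hx, hy], rfl⟩)
      rw [evd_apply, evd_apply] at this
      exact (sgn_sub this).symm)
  have hu : chi (Set.univ : Set (V →ₗ[ℝ] ℝ)) = (-1) ^ Module.finrank ℝ V := by
    rw [chi, if_neg Set.univ_nonempty.ne_empty, Submodule.span_univ, finrank_top]
    congr 1; exact Subspace.dual_finrank_eq
  rw [hu] at key
  have hterm : ∀ A ∈ (fs S).erase ∅, chi (Set.univ ∩ {l | topS S l = A}) =
      (-1) ^ Module.finrank ℝ V * ((-1) ^ 1 * (-1) ^ rk A) := by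
    intro A hA
    rw [hN A hA, chi_cset]
    · exact neg_one_pow_par (finrank_annS (mem_erase.1 hA).1)
    · rw [← hN A hA]
      rcases (mem_fs.1 (mem_erase.1 hA).2).2 with h | ⟨l, h⟩
      · exact absurd h (mem_erase.1 hA).1
      · exact ⟨l, trivial, h.symm⟩
  rw [sum_congr rfl hterm, ← mul_sum, ← mul_sum] at key
  rw [← add_sum_erase _ _ (empty_mem_fs S), rk_empty]
  have h1 : ((-1 : ℤ) ^ Module.finrank ℝ V) ≠ 0 := pow_ne_zero _ (by norm_num)
  have h2 := mul_left_cancel₀ h1 ((mul_one _).trans key)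
  linarith

lemma euler_ne {S B : Finset V} (hB : B ∈ fs S) (hB0 : B ≠ ∅) (hBS : B ≠ S) :
    ∑ A ∈ (fs S).filter (fun A => B ⊆ A), (-1 : ℤ) ^ rk A = 0 := by
  obtain ⟨l0, hl0⟩ : ∃ l, B = topS S l := (mem_fs.1 hB).2.resolve_left hB0
  obtain ⟨b, hb⟩ := nonempty_iff_ne_empty.2 hB0
  have hsub := (mem_fs.1 hB).1
  have hSB : (S \ B).Nonempty := Finset.sdiff_nonempty.2 (fun h => hBS (Finset.Subset.antisymm hsub h))
  have hbt : ∀ y ∈ S, l0 y ≤ l0 b := (mem_topS.1 (hl0 ▸ hb)).2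
  have hBl : ∀ x, x ∈ B ↔ x ∈ S ∧ l0 x = l0 b := by
    intro x
    rw [hl0, mem_topS]
    refine and_congr_right (fun hx => ⟨fun h => le_antisymm (hbt x hx) (h b (hsub hb)), fun h y hy => ?_⟩)
    rw [h]; exact hbt y hy
  have hD : ∀ u ∈ S \ B, 0 < l0 b - l0 u := by
    intro u hu
    obtain ⟨h1, h2⟩ := mem_sdiff.1 hu
    exact sub_pos.2 (lt_of_le_of_ne (hbt u h1) (fun h => h2 ((hBl u).2 ⟨h1, h⟩)))
  set m : V → (V →ₗ[ℝ] ℝ) →ₗ[ℝ] ℝ := fun u => (l0 b - l0 u)⁻¹ • evd b u with hm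
  have hmul : ∀ u ∈ S \ B, ∀ l, l b - l u = m u l * (l0 b - l0 u) := by
    intro u hu l
    have := hD u hu
    simp only [hm, LinearMap.smul_apply, evd_apply, smul_eq_mul]
    field_simp
  have hm0 : ∀ u ∈ S \ B, m u l0 = 1 := by
    intro u hu
    have := hD u hu
    simp only [hm, LinearMap.smul_apply, evd_apply, smul_eq_mul]
    field_simp
  have hl0B : l0 ∈ annS B := mem_annS.2 (fun x hx y hy => by rw [((hBl x).1 hx).2, ((hBl y).1 hy).2])
  set R : Finset V → Set (V →ₗ[ℝ] ℝ) := fun A =>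
    {l | (S \ B).filter (fun u => ∀ v ∈ S \ B, m u l ≤ m v l) = A \ B} with hR
  have tr : ∀ l ∈ annS B, ∀ μ : ℝ, (∀ u ∈ S \ B, μ ≤ m u l) →
      topS S (l - μ • l0) = B ∪ (S \ B).filter (fun u => m u l = μ) := by
    intro l hl μ hμ
    have hle : ∀ y ∈ S, (l - μ • l0) y ≤ (l - μ • l0) b ∧
        ((l - μ • l0) y = (l - μ • l0) b ↔ y ∈ B ∨ m y l = μ) := by
      intro y hy
      simp only [LinearMap.sub_apply, LinearMap.smul_apply, smul_eq_mul]
      by_cases hyB : y ∈ B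
      · rw [((hBl y).1 hyB).2, mem_annS.1 hl y hyB b hb]; simp [hyB]
      · have hy' := mem_sdiff.2 ⟨hy, hyB⟩
        have h1 := hmul y hy' l
        have h2 := hD y hy'
        have h3 := hμ y hy'
        constructor
        · nlinarith
        · simp only [hyB, false_or]
          constructor
          · intro h
            have : (m y l - μ) * (l0 b - l0 y) = 0 := by rw [sub_mul, ← h1]; linarith
            rcases mul_eq_zero.1 this with h | h <;> linarith
          · intro h; rw [h] at h1; linarith
    ext x
    simp only [mem_topS, mem_union, mem_filter, mem_sdiff]
    constructor
    · rintro ⟨hx, h⟩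
      have := (hle x hx).2.1 (le_antisymm (hle x hx).1 (h b (hsub hb)))
      tauto
    · intro h
      have hx : x ∈ S := by rcases h with h | h; exacts [hsub h, h.1.1]
      refine ⟨hx, fun y hy => ?_⟩
      rw [(hle x hx).2.2 (by tauto)]; exact (hle y hy).1
  have h0 : IsC ((annS B : Submodule ℝ (V →ₗ[ℝ] ℝ)) : Set (V →ₗ[ℝ] ℝ)) := ⟨annS B, ∅, by simp [cset]⟩
  set s := ((fs S).filter (fun A => B ⊆ A)).erase B with hs
  have hmem : ∀ A ∈ s, A ∈ fs S ∧ B ⊆ A ∧ A ≠ B ∧ (A \ B).Nonempty := by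
    intro A hA
    simp only [hs, mem_erase, mem_filter] at hA
    exact ⟨hA.2.1, hA.2.2, hA.1, Finset.sdiff_nonempty.2 (fun h => hA.1 (Finset.Subset.antisymm h hA.2.2))⟩
  have hN : ∀ A ∈ s, (annS B : Set (V →ₗ[ℝ] ℝ)) ∩ R A =
      cset (annS A ⊔ Submodule.span ℝ {l0}) (((A \ B) ×ˢ (S \ A)).image (fun q => m q.2 - m q.1)) := by
    intro A hA
    obtain ⟨hA1, hA2, hA3, u0, hu0⟩ := hmem A hA
    have hAS := (mem_fs.1 hA1).1
    have hABS : ∀ u ∈ A \ B, u ∈ S \ B := fun u hu => sdiff_subset_sdiff hAS le_rfl hu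
    ext l
    simp only [cset, Set.mem_inter_iff, SetLike.mem_coe, Set.mem_ofPred_eq, hR]
    constructor
    · rintro ⟨h1, h2⟩
      have h3 : ∀ u ∈ A \ B, ∀ v ∈ S \ B, m u l ≤ m v l := fun u hu => by
        rw [← h2] at hu; exact (mem_filter.1 hu).2
      refine ⟨?_, ?_⟩
      · rw [← sub_add_cancel l (m u0 l • l0)]
        refine Submodule.add_mem_sup ?_ (Submodule.smul_mem _ _ (Submodule.mem_span_singleton_self _))
        have := tr l h1 (m u0 l) (h3 u0 hu0)
        have hAe : A ⊆ topS S (l - m u0 l • l0) := by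
          rw [this]
          intro a ha
          by_cases haB : a ∈ B
          · exact mem_union_left _ haB
          · have ha' := mem_sdiff.2 ⟨ha, haB⟩
            exact mem_union_right _ (mem_filter.2 ⟨hABS a ha',
              le_antisymm (h3 a ha' u0 (hABS u0 hu0)) (h3 u0 hu0 a (hABS a ha'))⟩)
        exact mem_annS.2 (fun a ha b hb =>
          le_antisymm ((mem_topS.1 (hAe hb)).2 a (hAS ha)) ((mem_topS.1 (hAe ha)).2 b (hAS hb)))
      · intro g hg
        obtain ⟨⟨u, v⟩, hq, rfl⟩ := mem_image.1 hg
        obtain ⟨hu, hv⟩ := Finset.mem_product.1 hq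
        simp only at hu hv
        obtain ⟨hv1, hv2⟩ := mem_sdiff.1 hv
        have hvB : v ∉ B := fun h => hv2 (hA2 h)
        simp only [LinearMap.sub_apply, sub_pos]
        by_contra hcon
        push Not at hcon
        have : v ∈ A \ B := by
          rw [← h2]
          exact mem_filter.2 ⟨mem_sdiff.2 ⟨hv1, hvB⟩, fun w hw => hcon.trans (h3 u hu w hw)⟩
        exact hv2 (mem_sdiff.1 this).1
    · rintro ⟨h1, h2⟩
      obtain ⟨l', hl', z, hz, rfl⟩ := Submodule.mem_sup.1 h1
      obtain ⟨c, rfl⟩ := Submodule.mem_span_singleton.1 hz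
      have h3 : ∀ u ∈ A \ B, m u (l' + c • l0) = c := by
        intro u hu
        have hu' := hABS u hu
        rw [map_add, map_smul, hm0 u hu', smul_eq_mul, mul_one]
        have : m u l' = 0 := by
          simp only [hm, LinearMap.smul_apply, evd_apply, smul_eq_mul]
          rw [mem_annS.1 hl' b (hA2 hb) u (mem_sdiff.1 hu).1, sub_self, mul_zero]
        rw [this, zero_add]
      have h4 : ∀ v ∈ S, v ∉ A → c < m v (l' + c • l0) := by
        intro v hv hvA
        have := h2 _ (mem_image_of_mem (fun q : V × V => m q.2 - m q.1)
          (mk_mem_product hu0 (mem_sdiff.2 ⟨hv, hvA⟩)))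
        rw [LinearMap.sub_apply, h3 u0 hu0] at this
        linarith
      refine ⟨Submodule.add_mem _ (mem_annS.2 fun a ha b hb => mem_annS.1 hl' a (hA2 ha) b (hA2 hb))
        (Submodule.smul_mem _ _ hl0B), ?_⟩
      ext x
      rw [mem_filter]
      constructor
      · rintro ⟨hx, h⟩
        obtain ⟨hx1, hx2⟩ := mem_sdiff.1 hx
        refine mem_sdiff.2 ⟨?_, hx2⟩
        by_contra hxA
        have := h u0 (hABS u0 hu0)
        rw [h3 u0 hu0] at this
        exact absurd this (not_le.2 (h4 x hx1 hxA))
      · intro hx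
        refine ⟨hABS x hx, fun v hv => ?_⟩
        rw [h3 x hx]
        obtain ⟨hv1, hv2⟩ := mem_sdiff.1 hv
        by_cases hvA : v ∈ A
        · rw [h3 v (mem_sdiff.2 ⟨hvA, hv2⟩)]
        · exact (h4 v hv1 hvA).le
  have key := chi_partition s R (((S \ B) ×ˢ (S \ B)).toList.map (fun q => m q.1 - m q.2))
    (annS B : Set (V →ₗ[ℝ] ℝ)) h0 (fun A hA => ⟨_, _, hN A hA⟩) ?_ ?_ ?_
  rotate_left
  · intro l hl
    obtain ⟨u0, hu0, hmin⟩ := (S \ B).exists_min_image (fun u => m u l) hSB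
    have h1 := tr l hl _ hmin
    refine ⟨topS S (l - m u0 l • l0), ?_, ?_⟩
    · rw [hs, mem_erase, mem_filter]
      refine ⟨?_, topS_mem_fs _ _, ?_⟩
      · intro h
        rw [h1] at h
        have : u0 ∈ B := h ▸ mem_union_right _ (mem_filter.2 ⟨hu0, rfl⟩)
        exact (mem_sdiff.1 hu0).2 this
      · rw [h1]; exact Finset.subset_union_left
    · rw [hR, Set.mem_ofPred_eq, h1]
      ext x
      simp only [mem_filter, mem_sdiff, mem_union]
      constructor
      · rintro ⟨hx, h⟩
        refine ⟨Or.inr ⟨hx, le_antisymm (h u0 (mem_sdiff.1 hu0)) (hmin x (mem_sdiff.2 hx))⟩, hx.2⟩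
      · rintro ⟨h | ⟨hx, h⟩, h2⟩
        · exact absurd h h2
        · exact ⟨hx, fun v hv => by rw [h]; exact hmin v (mem_sdiff.2 hv)⟩
  · intro l hl A hA A' hA' h1 h2
    rw [hR, Set.mem_ofPred_eq] at h1 h2
    rw [← Finset.sdiff_union_of_subset (hmem A hA).2.1, ← h1, h2, Finset.sdiff_union_of_subset (hmem A' hA').2.1]
  · intro A hA l hl l' hl' h hlA
    rw [hR, Set.mem_ofPred_eq] at hlA ⊢
    rw [← hlA]
    ext x
    simp only [mem_filter]
    refine and_congr_right (fun hx => forall₂_congr (fun y hy => ?_))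
    have := h (m x - m y) (List.mem_map.2 ⟨(x, y), by
      simp only [Finset.mem_toList]; exact mk_mem_product hx hy, rfl⟩)
    rw [LinearMap.sub_apply, LinearMap.sub_apply] at this
    exact (sgn_sub this).symm
  have hu : chi (annS B : Set (V →ₗ[ℝ] ℝ)) = (-1) ^ Module.finrank ℝ (annS B) := by
    rw [chi, if_neg (Submodule.nonempty _).ne_empty, Submodule.span_eq]
  rw [hu, neg_one_pow_par (finrank_annS hB0)] at key
  have hterm : ∀ A ∈ s, chi ((annS B : Set (V →ₗ[ℝ] ℝ)) ∩ R A) =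
      (-1) ^ Module.finrank ℝ V * (- ((-1) ^ 1 * (-1) ^ rk A)) := by
    intro A hA
    obtain ⟨hA1, hA2, hA3, u0, hu0⟩ := hmem A hA
    have hA0 : A ≠ ∅ := by rintro rfl; simp at hu0
    rw [hN A hA, chi_cset]
    · have h1 := neg_one_pow_par (finrank_annS hA0)
      have h2 : Module.finrank ℝ (annS A ⊔ Submodule.span ℝ {l0} : Submodule ℝ (V →ₗ[ℝ] ℝ)) =
          Module.finrank ℝ (annS A) + 1 := by
        have h3 := Submodule.finrank_sup_add_finrank_inf_eq (annS A) (Submodule.span ℝ {l0})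
        have hl00 : l0 ≠ 0 := by
          rintro rfl
          have := hD u0 (sdiff_subset_sdiff (mem_fs.1 hA1).1 le_rfl hu0)
          simp at this
        rw [finrank_span_singleton hl00] at h3
        have : annS A ⊓ Submodule.span ℝ {l0} = ⊥ := by
          rw [Submodule.eq_bot_iff]
          rintro x ⟨h4, h5⟩
          obtain ⟨c, rfl⟩ := Submodule.mem_span_singleton.1 h5
          have h6 := mem_annS.1 h4 b (hA2 hb) u0 (mem_sdiff.1 hu0).1
          have h7 := hD u0 (sdiff_subset_sdiff (mem_fs.1 hA1).1 le_rfl hu0)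
          simp only [LinearMap.smul_apply, smul_eq_mul] at h6
          have : c * (l0 b - l0 u0) = 0 := by linarith
          rcases mul_eq_zero.1 this with h | h
          · rw [h, zero_smul]
          · exact absurd h h7.ne'
        rw [this, finrank_bot] at h3
        omega
      rw [h2, pow_succ, h1]; ring
    · rw [← hN A hA]
      obtain ⟨l, hl⟩ := (mem_fs.1 hA1).2.resolve_left hA0
      have hl1 : ∀ a ∈ A, ∀ y ∈ S, l y ≤ l a := fun a ha => (mem_topS.1 (hl ▸ ha)).2
      have hAl : ∀ x ∈ S, l x = l b → x ∈ A := fun x hx h => by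
        rw [hl]; exact mem_topS.2 ⟨hx, fun y hy => h ▸ hl1 b (hA2 hb) y hy⟩
      have hann : l ∈ annS B := mem_annS.2 fun x hx y hy =>
        le_antisymm (hl1 y (hA2 hy) x (hsub hx)) (hl1 x (hA2 hx) y (hsub hy))
      have hnn : ∀ u ∈ S \ B, 0 ≤ m u l := by
        intro u hu
        by_contra hcon
        push Not at hcon
        have := hmul u hu l
        nlinarith [hD u hu, hl1 b (hA2 hb) u (mem_sdiff.1 hu).1]
      have hz : ∀ u ∈ S \ B, (m u l = 0 ↔ u ∈ A) := by
        intro u hu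
        have h1 := hmul u hu l
        obtain ⟨hu1, hu2⟩ := mem_sdiff.1 hu
        constructor
        · intro h; apply hAl u hu1; rw [h] at h1; linarith
        · intro h
          have h2 : l u = l b := le_antisymm (hl1 b (hA2 hb) u hu1) (hl1 u h b (hsub hb))
          have : m u l * (l0 b - l0 u) = 0 := by rw [← h1]; linarith
          exact (mul_eq_zero.1 this).resolve_right (hD u hu).ne'
      refine ⟨l, hann, ?_⟩
      rw [hR, Set.mem_ofPred_eq]
      have hu0' := sdiff_subset_sdiff (mem_fs.1 hA1).1 le_rfl hu0
      ext x
      rw [mem_filter]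
      constructor
      · rintro ⟨hx, h⟩
        refine mem_sdiff.2 ⟨(hz x hx).1 (le_antisymm ?_ (hnn x hx)), (mem_sdiff.1 hx).2⟩
        have := h u0 hu0'
        rwa [(hz u0 hu0').2 (mem_sdiff.1 hu0).1] at this
      · intro hx
        have hx' := sdiff_subset_sdiff (mem_fs.1 hA1).1 le_rfl hx
        refine ⟨hx', fun v hv => ?_⟩
        rw [(hz x hx').2 (mem_sdiff.1 hx).1]; exact hnn v hv
  rw [sum_congr rfl hterm, ← mul_sum, sum_neg_distrib, ← mul_sum] at key
  have hBm : B ∈ (fs S).filter (fun A => B ⊆ A) := mem_filter.2 ⟨hB, le_rfl⟩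
  rw [← add_sum_erase _ _ hBm]
  have h1 : ((-1 : ℤ) ^ Module.finrank ℝ V) ≠ 0 := pow_ne_zero _ (by norm_num)
  have h2 := mul_left_cancel₀ h1 key
  rw [← hs]
  linarith

lemma euler {S B : Finset V} (hB : B ∈ fs S) (hBS : B ≠ S) :
    ∑ A ∈ (fs S).filter (fun A => B ⊆ A), (-1 : ℤ) ^ rk A = 0 := by
  by_cases h : B = ∅
  · subst h
    simpa using euler_empty S hBS.symm
  · exact euler_ne hB h hBS
end PartB2

section PartC
variable {V : Type*} [AddCommGroup V] [Module ℝ V]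

lemma pdim_empty : pdim (∅ : Set V) = -1 := by simp [pdim]

lemma cv_eq_empty {A : Finset V} : cv A = ∅ ↔ A = ∅ := by simp [cv]

lemma relHAux_succ {A : Finset V} (hA : A ≠ ∅) (n : ℕ) :
    relHAux (n + 1) ∅ (cv A) = ∑ B ∈ (fs A).erase A,
      truncG ((rk B : ℤ) - 1) (relHAux n ∅ (cv B)) * (X - 1) ^ (rk A - rk B - 1) := by
  rw [relHAux, if_neg (mt cv_eq_empty.1 hA)]
  have hset : {G' : Set V | IsFace (cv A) G' ∧ ∅ ⊆ G' ∧ G' ≠ cv A} =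
      cv '' (((fs A).erase A : Finset (Finset V)) : Set (Finset V)) := by
    ext G
    simp only [Set.mem_ofPred_eq, isFace_iff, Set.empty_subset, true_and, Set.mem_image,
      mem_coe, mem_erase]
    constructor
    · grind
    · rintro ⟨B, ⟨h, hB⟩, rfl⟩
      exact ⟨⟨B, hB, rfl⟩, fun e => h (cv_injOn A hB (self_mem_fs A) e)⟩
  rw [hset, finsum_mem_image ((cv_injOn A).mono (by
    intro B hB; exact (mem_erase.1 hB).2)), finsum_mem_coe_finset]
  refine sum_congr rfl (fun B hB => ?_)
  rw [pdim_cv, pdim_cv, pdim_empty]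
  congr 2
  · congr 1; ring
  · grind

lemma relHAux_fuel (n : ℕ) : ∀ A : Finset V, ∀ m, rk A ≤ n → rk A ≤ m →
    relHAux n ∅ (cv A) = relHAux m ∅ (cv A) := by
  induction n with
  | zero =>
    intro A m h1 h2
    have hA : A = ∅ := by
      by_contra h; rw [rk, if_neg h] at h1; omega
    subst hA
    cases m <;> simp [relHAux, cv]
  | succ n ih =>
    intro A m h1 h2
    by_cases hA : A = ∅
    · subst hA
      cases m <;> simp [relHAux, cv]
    · have : 0 < rk A := by rw [rk, if_neg hA]; omega
      obtain ⟨m, rfl⟩ : ∃ k, m = k + 1 := ⟨m - 1, by omega⟩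
      rw [relHAux_succ hA, relHAux_succ hA]
      refine sum_congr rfl (fun B hB => ?_)
      have := rk_lt (mem_erase.1 hB).2 (mem_erase.1 hB).1
      rw [ih B m (by omega) (by omega)]

noncomputable def hA (A : Finset V) : ℚ[X] := relHAux (rk A) ∅ (cv A)
noncomputable def gA (A : Finset V) : ℚ[X] := truncG ((rk A : ℤ) - 1) (hA A)

lemma toricG_cv (A : Finset V) : toricG (cv A) = gA A := by
  rw [toricG, relG, relH, pdim_cv, pdim_empty, gA, hA]
  congr 2 <;> ring_nf; simp

lemma hA_eq {A : Finset V} (h : A ≠ ∅) :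
    hA A = ∑ B ∈ (fs A).erase A, gA B * (X - 1) ^ (rk A - rk B - 1) := by
  have h0 : 0 < rk A := by rw [rk, if_neg h]; omega
  rw [hA, show rk A = (rk A - 1) + 1 by omega, relHAux_succ h, ← show rk A = (rk A - 1) + 1 by omega]
  refine sum_congr rfl (fun B hB => ?_)
  have := rk_lt (mem_erase.1 hB).2 (mem_erase.1 hB).1
  rw [gA, hA, relHAux_fuel (rk A - 1) B (rk B) (by omega) le_rfl]

lemma coeff_truncG (d : ℤ) (h : ℚ[X]) (k : ℕ) : (truncG d h).coeff k =
    if k ≤ d.toNat / 2 then h.coeff k - (if k = 0 then 0 else h.coeff (k - 1)) else 0 := by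
  rw [truncG, finsetSum_coeff]
  simp only [coeff_C_mul, coeff_X_pow, mul_ite, mul_one, mul_zero, Finset.sum_ite_eq,
    Finset.mem_range, Nat.lt_succ_iff]

lemma coeff_gA (A : Finset V) (k : ℕ) : (gA A).coeff k =
    if k ≤ (rk A - 1) / 2 then (hA A).coeff k - (if k = 0 then 0 else (hA A).coeff (k - 1)) else 0 := by
  rw [gA, coeff_truncG]
  congr 3; omega

lemma natDegree_gA (A : Finset V) : (gA A).natDegree ≤ (rk A - 1) / 2 := by
  rw [natDegree_le_iff_coeff_eq_zero]
  intro k hk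
  rw [coeff_gA, if_neg (by omega)]

lemma natDegree_Xp (n : ℕ) : ((X - 1 : ℚ[X]) ^ n).natDegree ≤ n := by
  have := natDegree_pow_le_of_le n (natDegree_X_sub_C_le (1 : ℚ))
  simpa using this

lemma reflect_Xp (n : ℕ) : reflect n ((X - 1 : ℚ[X]) ^ n) = (-1) ^ n * (X - 1) ^ n := by
  induction n with
  | zero => ext k; simp [coeff_one]
  | succ n ih =>
    rw [pow_succ, reflect_mul _ _ (natDegree_Xp n) (by simpa using natDegree_Xp 1), ih,
      reflect_sub, reflect_one_X]
    have : reflect 1 (1 : ℚ[X]) = X := by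
      have := reflect_C (1 : ℚ) 1
      simpa using this
    rw [this]; ring

lemma gA_empty : gA (∅ : Finset V) = 1 := by
  ext k
  rw [coeff_gA, rk_empty, hA, rk_empty, relHAux]
  by_cases h : k = 0 <;> simp [h, coeff_one]

lemma natDegree_hA {A : Finset V} (h : A ≠ ∅) : (hA A).natDegree ≤ rk A - 1 := by
  rw [hA_eq h]
  apply natDegree_sum_le_of_forall_le
  intro B hB
  have := rk_lt (mem_erase.1 hB).2 (mem_erase.1 hB).1
  refine natDegree_mul_le.trans ?_
  have h1 := natDegree_gA B
  have h2 := natDegree_Xp (rk A - rk B - 1)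
  omega

lemma reflect_sum' {α : Type*} (s : Finset α) (f : α → ℚ[X]) (N : ℕ) :
    reflect N (∑ a ∈ s, f a) = ∑ a ∈ s, reflect N (f a) := by
  induction s using Finset.induction_on with
  | empty => simp
  | insert a s ha ih => rw [Finset.sum_insert ha, Finset.sum_insert ha, reflect_add, ih]

variable [FiniteDimensional ℝ V]

lemma kls_step {A : Finset V} (h : A ≠ ∅)
    (ih : ∀ B ∈ fs A, B ≠ A → reflect (rk B) (gA B) = ∑ C ∈ fs B, gA C * (X - 1) ^ (rk B - rk C)) :
    reflect (rk A - 1) (hA A) = hA A := by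
  have h0 : 0 < rk A := by rw [rk, if_neg h]; omega
  have hk : (X - 1) * hA A = ∑ B ∈ (fs A).erase A, gA B * (X - 1) ^ (rk A - rk B) := by
    rw [hA_eq h, mul_sum]
    refine sum_congr rfl (fun B hB => ?_)
    have := rk_lt (mem_erase.1 hB).2 (mem_erase.1 hB).1
    rw [show rk A - rk B = (rk A - rk B - 1) + 1 by omega, pow_succ]; simp; ring
  have hr : reflect (rk A) (∑ B ∈ (fs A).erase A, gA B * (X - 1) ^ (rk A - rk B)) =
      - ∑ B ∈ (fs A).erase A, gA B * (X - 1) ^ (rk A - rk B) := by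
    rw [reflect_sum']
    have h1 : ∀ B ∈ (fs A).erase A, reflect (rk A) (gA B * (X - 1) ^ (rk A - rk B)) =
        ∑ C ∈ fs B, (-1) ^ (rk A - rk B) * (gA C * (X - 1) ^ (rk A - rk C)) := by
      intro B hB
      obtain ⟨hne, hB⟩ := mem_erase.1 hB
      have hle := rk_le hB
      conv_lhs => rw [show rk A = rk B + (rk A - rk B) by omega]
      rw [show rk B + (rk A - rk B) - rk B = rk A - rk B by omega,
        reflect_mul _ _ ((natDegree_gA B).trans (by omega)) (natDegree_Xp _), ih B hB hne,
        reflect_Xp, sum_mul]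
      refine sum_congr rfl (fun C hC => ?_)
      have := rk_le hC
      rw [show rk A - rk C = (rk B - rk C) + (rk A - rk B) by omega, pow_add]; ring
    rw [sum_congr rfl h1,
      Finset.sum_comm' (t' := (fs A).erase A) (s' := fun C => ((fs A).filter (fun B => C ⊆ B)).erase A)]
    · rw [← sum_neg_distrib]
      refine sum_congr rfl (fun C hC => ?_)
      obtain ⟨hne, hC⟩ := mem_erase.1 hC
      rw [← sum_mul]
      have he := euler hC hne
      rw [← add_sum_erase _ _ (mem_filter.2 ⟨self_mem_fs A, (mem_fs.1 hC).1⟩)] at he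
      have : ∑ i ∈ ((fs A).filter (fun B => C ⊆ B)).erase A, (-1 : ℚ[X]) ^ (rk A - rk i) = -1 := by
        have h2 : ∀ i ∈ ((fs A).filter (fun B => C ⊆ B)).erase A, (-1 : ℚ[X]) ^ (rk A - rk i) =
            (-1) ^ rk A * (-1) ^ rk i := by
          intro i hi
          have := rk_le (mem_filter.1 (mem_erase.1 hi).2).1
          conv_rhs => rw [show rk A = (rk A - rk i) + rk i by omega]
          rw [pow_add, mul_assoc, ← mul_pow]; simp
        rw [sum_congr rfl h2, ← mul_sum]
        have he' := congrArg (fun z : ℤ => (z : ℚ[X])) he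
        push_cast at he'
        have h4 : (-1 : ℚ[X]) ^ rk A * (-1) ^ rk A = 1 := by rw [← mul_pow]; simp
        linear_combination (-1 : ℚ[X]) ^ rk A * he' - h4
      rw [this]; ring
    · intro B C
      simp only [mem_erase, mem_filter]
      constructor
      · rintro ⟨⟨h2, h3⟩, h4⟩
        have := (fs_trans h3).1 h4
        refine ⟨⟨h2, h3, this.2⟩, ?_, this.1⟩
        rintro rfl
        exact h2 (Finset.Subset.antisymm (mem_fs.1 h3).1 this.2)
      · rintro ⟨⟨h2, h3, h4⟩, h5, h6⟩
        exact ⟨⟨h2, h3⟩, (fs_trans h3).2 ⟨h6, h4⟩⟩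
  rw [← hk] at hr
  have h2 : reflect (rk A) ((X - 1) * hA A) = -((X - 1) * reflect (rk A - 1) (hA A)) := by
    conv_lhs => rw [show rk A = 1 + (rk A - 1) by omega]
    rw [reflect_mul _ _ (by simpa using natDegree_Xp 1) (natDegree_hA h)]
    have := reflect_Xp 1
    simp only [pow_one] at this
    rw [this]; ring
  rw [h2] at hr
  have hX : (X - 1 : ℚ[X]) ≠ 0 := by simpa using X_sub_C_ne_zero (1 : ℚ)
  exact mul_left_cancel₀ hX (neg_injective hr)

lemma kls (n : ℕ) : ∀ A : Finset V, rk A ≤ n →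
    reflect (rk A) (gA A) = ∑ C ∈ fs A, gA C * (X - 1) ^ (rk A - rk C) := by
  induction n with
  | zero =>
    intro A h
    have hA : A = ∅ := by by_contra h'; rw [rk, if_neg h'] at h; omega
    subst hA
    have : fs (∅ : Finset V) = {∅} := by
      ext B; simp only [mem_singleton]
      exact ⟨fun h => Finset.subset_empty.1 (mem_fs.1 h).1, fun h => by rw [h]; exact empty_mem_fs _⟩
    rw [this, Finset.sum_singleton, gA_empty, rk_empty]
    have := reflect_Xp 0
    simpa using this
  | succ n ih =>
    intro A hn
    by_cases h : A = ∅
    · exact ih A (by rw [h, rk_empty]; omega)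
    have h0 : 0 < rk A := by rw [rk, if_neg h]; omega
    have hp := kls_step h (fun B hB hne => ih B (by have := rk_lt hB hne; omega))
    have hk : (X - 1) * hA A = ∑ B ∈ (fs A).erase A, gA B * (X - 1) ^ (rk A - rk B) := by
      rw [hA_eq h, mul_sum]
      refine sum_congr rfl (fun B hB => ?_)
      have := rk_lt (mem_erase.1 hB).2 (mem_erase.1 hB).1
      rw [show rk A - rk B = (rk A - rk B - 1) + 1 by omega, pow_succ]; simp; ring
    rw [← add_sum_erase _ _ (self_mem_fs A), Nat.sub_self, pow_zero, mul_one, ← hk]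
    have hsym : ∀ k, k ≤ rk A - 1 → (hA A).coeff k = (hA A).coeff (rk A - 1 - k) := by
      intro k hk
      conv_lhs => rw [← hp]
      rw [coeff_reflect, revAt_le hk]
    have hz : ∀ k, rk A - 1 < k → (hA A).coeff k = 0 := fun k hk =>
      coeff_eq_zero_of_natDegree_lt (lt_of_le_of_lt (natDegree_hA h) hk)
    ext k
    rw [coeff_reflect, coeff_add, sub_mul, one_mul, coeff_sub]
    have hX : (X * hA A).coeff k = if k = 0 then 0 else (hA A).coeff (k - 1) := by
      cases k <;> simp [coeff_X_mul]
    rw [hX]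
    rcases lt_or_ge (rk A) k with hlt | hle
    · rw [revAt_eq_self_of_lt hlt, hz k (by omega), if_neg (by omega), hz (k - 1) (by omega)]; ring
    · rw [revAt_le hle, coeff_gA, coeff_gA]
      have hD : (hA A).coeff (rk A - k) - (if rk A - k = 0 then 0 else (hA A).coeff (rk A - k - 1)) =
          (if k = 0 then 0 else (hA A).coeff (k - 1)) - (hA A).coeff k := by
        by_cases hk0 : k = 0
        · subst hk0
          rw [if_pos rfl, if_neg (by omega), hz (rk A - 0) (by omega), hsym 0 (by omega)]
          simp
        · rw [if_neg hk0]
          by_cases hkr : k = rk A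
          · grind
          · grind
      rw [hD]
      by_cases h2 : 2 * k = rk A
      · rw [show rk A - k = k by omega] at hD
        rw [if_neg (by omega), if_neg (by omega)]
        linarith
      · grind

lemma hA_symm {A : Finset V} (h : A ≠ ∅) {k : ℕ} (hk : k ≤ rk A - 1) :
    (hA A).coeff k = (hA A).coeff (rk A - 1 - k) := by
  conv_lhs => rw [← kls_step h (fun B _ _ => kls (rk B) B le_rfl)]
  rw [coeff_reflect, revAt_le hk]

lemma coeff_Xp (n k : ℕ) : ((X - 1 : ℚ[X]) ^ n).coeff k = (-1) ^ (n - k) * (n.choose k : ℚ) := by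
  have := coeff_X_add_C_pow (-1 : ℚ) n k
  rw [map_neg, map_one, ← sub_eq_add_neg] at this
  exact this

lemma coeff_hA {A : Finset V} (h : A ≠ ∅) (k : ℕ) :
    (hA A).coeff k = ∑ B ∈ (fs A).erase A, (gA B * (X - 1) ^ (rk A - rk B - 1)).coeff k := by
  rw [hA_eq h, finsetSum_coeff]

lemma rk_eq_zero {A : Finset V} : rk A = 0 ↔ A = ∅ := by
  unfold rk; split_ifs <;> simp_all

noncomputable def fr (k : ℕ) (A : Finset V) : Finset (Finset V) := (fs A).filter (fun B => rk B = k)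

lemma fr_zero (A : Finset V) : fr 0 A = {∅} := by
  ext B; simp only [fr, mem_filter, rk_eq_zero, mem_singleton]
  exact ⟨fun h => h.2, fun h => ⟨h ▸ empty_mem_fs A, h⟩⟩

lemma fr_eq {A : Finset V} {k : ℕ} (h : k < rk A) : ((fs A).erase A).filter (fun B => rk B = k) = fr k A := by
  ext B; simp only [fr, mem_filter, mem_erase]
  constructor
  · rintro ⟨⟨_, h1⟩, h2⟩; exact ⟨h1, h2⟩
  · rintro ⟨h1, h2⟩; exact ⟨⟨by rintro rfl; omega, h1⟩, h2⟩

lemma hA_top {A : Finset V} (h : A ≠ ∅) : (hA A).coeff (rk A - 1) = 1 := by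
  have h0 : 0 < rk A := by rw [rk, if_neg h]; omega
  rw [coeff_hA h, sum_eq_single_of_mem ∅ (mem_erase.2 ⟨h.symm, empty_mem_fs A⟩)]
  · rw [gA_empty, rk_empty, one_mul, coeff_Xp]; simp
  · intro B hB hne
    have := rk_lt (mem_erase.1 hB).2 (mem_erase.1 hB).1
    have hB0 : rk B ≠ 0 := mt rk_eq_zero.1 hne
    apply coeff_eq_zero_of_natDegree_lt
    refine lt_of_le_of_lt natDegree_mul_le ?_
    have h1 := natDegree_gA B
    have h2 := natDegree_Xp (rk A - rk B - 1)
    omega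

lemma gA_coeff_zero (A : Finset V) : (gA A).coeff 0 = 1 := by
  by_cases h : A = ∅
  · rw [h, gA_empty]; simp
  · rw [coeff_gA, if_pos (by omega), if_pos rfl, sub_zero, hA_symm h (by omega), Nat.sub_zero, hA_top h]

lemma gA_low {A : Finset V} (h : rk A ≤ 2) : gA A = 1 := by
  ext k
  by_cases hk : k = 0
  · rw [hk, gA_coeff_zero]; simp
  · rw [coeff_eq_zero_of_natDegree_lt (lt_of_le_of_lt (natDegree_gA A) (by omega)), coeff_one, if_neg hk]

lemma hA_sub {A : Finset V} (h : 2 ≤ rk A) :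
    (hA A).coeff (rk A - 2) = (fr 1 A).card - ((rk A : ℚ) - 1) := by
  have hne : A ≠ ∅ := by rintro rfl; rw [rk_empty] at h; omega
  rw [coeff_hA hne]
  have ht : ∀ B ∈ (fs A).erase A, (gA B * (X - 1) ^ (rk A - rk B - 1)).coeff (rk A - 2) =
      (if rk B = 0 then -((rk A : ℚ) - 1) else 0) + (if rk B = 1 then 1 else 0) := by
    intro B hB
    have := rk_lt (mem_erase.1 hB).2 (mem_erase.1 hB).1
    by_cases h0 : rk B = 0
    · rw [gA_low (by omega), one_mul, coeff_Xp, h0, show rk A - 0 - 1 - (rk A - 2) = 1 by omega,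
        show rk A - 0 - 1 = (rk A - 2) + 1 by omega, Nat.choose_succ_self_right]
      push_cast [h]; simp; ring
    · by_cases h1 : rk B = 1
      · rw [gA_low (by omega), one_mul, coeff_Xp, h1, show rk A - 1 - 1 = rk A - 2 by omega]; simp
      · rw [if_neg h0, if_neg h1, add_zero]
        apply coeff_eq_zero_of_natDegree_lt
        refine lt_of_le_of_lt natDegree_mul_le ?_
        have h1 := natDegree_gA B
        have h2 := natDegree_Xp (rk A - rk B - 1)
        omega
  rw [sum_congr rfl ht, sum_add_distrib, ← sum_filter, ← sum_filter,
    fr_eq (by omega), fr_eq (by omega), fr_zero]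
  simp; ring

lemma gA_one {A : Finset V} (h : rk A = 3) : (gA A).coeff 1 = (fr 1 A).card - 3 := by
  have hne : A ≠ ∅ := by rintro rfl; rw [rk_empty] at h; omega
  have h0 := gA_coeff_zero A
  rw [coeff_gA, if_pos (by omega), if_pos rfl, sub_zero] at h0
  have h1 := hA_sub (A := A) (by omega)
  rw [h] at h1
  rw [coeff_gA, if_pos (by omega), if_neg (by omega), h0, h1]; push_cast; ring

lemma hA_sub2 {A : Finset V} (h : 4 ≤ rk A) :
    (hA A).coeff (rk A - 3) = ((rk A - 1).choose 2 : ℚ) - ((rk A : ℚ) - 2) * (fr 1 A).card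
      + (fr 2 A).card + ∑ B ∈ fr 3 A, (((fr 1 B).card : ℚ) - 3) := by
  have hne : A ≠ ∅ := by rintro rfl; rw [rk_empty] at h; omega
  rw [coeff_hA hne]
  have ht : ∀ B ∈ (fs A).erase A, (gA B * (X - 1) ^ (rk A - rk B - 1)).coeff (rk A - 3) =
      (if rk B = 0 then ((rk A - 1).choose 2 : ℚ) else 0) + (if rk B = 1 then -((rk A : ℚ) - 2) else 0)
      + (if rk B = 2 then 1 else 0) + (if rk B = 3 then (((fr 1 B).card : ℚ) - 3) else 0) := by
    intro B hB
    have := rk_lt (mem_erase.1 hB).2 (mem_erase.1 hB).1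
    by_cases h0 : rk B = 0
    · rw [gA_low (by omega), one_mul, coeff_Xp, h0, show rk A - 0 - 1 - (rk A - 3) = 2 by omega,
        ← Nat.choose_symm (by omega : rk A - 3 ≤ rk A - 0 - 1), show rk A - 0 - 1 - (rk A - 3) = 2 by omega]
      simp
    · by_cases h1 : rk B = 1
      · rw [gA_low (by omega), one_mul, coeff_Xp, h1, show rk A - 1 - 1 - (rk A - 3) = 1 by omega,
          show rk A - 1 - 1 = (rk A - 3) + 1 by omega, Nat.choose_succ_self_right]
        push_cast [show 3 ≤ rk A by omega]; simp; ring
      · by_cases h2 : rk B = 2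
        · rw [gA_low (by omega), one_mul, coeff_Xp, h2, show rk A - 2 - 1 = rk A - 3 by omega]; simp
        · by_cases h3 : rk B = 3
          · have hd : (gA B).natDegree ≤ 1 := (natDegree_gA B).trans (by omega)
            have hk : rk A - 3 = 1 + (rk A - rk B - 1) := by omega
            rw [hk, coeff_mul_add_eq_of_natDegree_le hd (natDegree_Xp _), gA_one h3, coeff_Xp]
            simp [h3]
          · rw [if_neg h0, if_neg h1, if_neg h2, if_neg h3, add_zero, add_zero, add_zero]
            apply coeff_eq_zero_of_natDegree_lt
            refine lt_of_le_of_lt natDegree_mul_le ?_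
            have h1 := natDegree_gA B
            have h2 := natDegree_Xp (rk A - rk B - 1)
            omega
  rw [sum_congr rfl ht, sum_add_distrib, sum_add_distrib, sum_add_distrib,
    ← sum_filter, ← sum_filter, ← sum_filter, ← sum_filter,
    fr_eq (by omega), fr_eq (by omega), fr_eq (by omega), fr_eq (by omega), fr_zero]
  simp; ring

lemma g2_formula {A : Finset V} {d : ℕ} (hd : 3 ≤ d) (h : rk A = d + 1) :
    (toricG (cv A)).coeff 2 = ((d + 1).choose 2 : ℚ) - d * (fr 1 A).card + (fr 2 A).card
      + ∑ B ∈ fr 3 A, (((fr 1 B).card : ℚ) - 3) := by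
  have hne : A ≠ ∅ := by rintro rfl; rw [rk_empty] at h; omega
  have h1 := hA_sub (A := A) (by omega)
  have h2 := hA_sub2 (A := A) (by omega)
  have h3 : (toricG (cv A)).coeff 2 = (hA A).coeff (rk A - 3) - (hA A).coeff (rk A - 2) := by
    rw [toricG_cv, coeff_gA]
    by_cases h4 : 2 ≤ (rk A - 1) / 2
    · rw [if_pos h4, if_neg (by omega), hA_symm hne (by omega), hA_symm hne (by omega : 2 - 1 ≤ rk A - 1)]
      congr 2
    · rw [if_neg h4, hA_symm hne (by omega : rk A - 3 ≤ rk A - 1)]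
      rw [show rk A - 1 - (rk A - 3) = rk A - 2 by omega, sub_self]
  rw [h3, h1, h2, h]
  have : ((d + 1).choose 2 : ℚ) = (d.choose 2 : ℚ) + d := by
    rw [Nat.choose_succ_succ' d 1]; push_cast; simp; ring
  rw [this]; push_cast; simp; ring
end PartC

section PartD1

lemma generic_pt {W : Type*} [AddCommGroup W] [Module ℝ W] (F G : Finset (W →ₗ[ℝ] ℝ))
    (hF : ∀ f ∈ F, f ≠ 0) (x0 : W) (hG : ∀ g ∈ G, 0 < g x0) :
    ∃ x, (∀ f ∈ F, f x ≠ 0) ∧ ∀ g ∈ G, 0 < g x := by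
  induction F using Finset.induction_on with
  | empty => exact ⟨x0, by simp, hG⟩
  | insert f F hf ih =>
    obtain ⟨x, h1, h2⟩ := ih (fun f' hf' => hF f' (Finset.mem_insert_of_mem hf'))
    by_cases h : f x = 0
    · obtain ⟨y, hy⟩ : ∃ y, f y ≠ 0 := by
        by_contra hcon; push Not at hcon
        exact hF f (Finset.mem_insert_self _ _) (LinearMap.ext hcon)
      obtain ⟨ε, he, h3⟩ := perturb (G ∪ F.image (fun f' => (f' x) • f')) x y (by
        intro g hg
        rcases mem_union.1 hg with hg | hg
        · exact h2 g hg
        · obtain ⟨f', hf', rfl⟩ := mem_image.1 hg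
          exact mul_self_pos.2 (h1 f' hf'))
      refine ⟨x + ε • y, ?_, fun g hg => h3 g (mem_union_left _ hg)⟩
      intro f' hf'
      rcases mem_insert.1 hf' with rfl | hf'
      · rw [map_add, map_smul, h, zero_add, smul_eq_mul]; exact mul_ne_zero he.ne' hy
      · intro h0
        have h4 := h3 ((f' x) • f') (mem_union_right _ (mem_image.2 ⟨f', hf', rfl⟩))
        rw [LinearMap.smul_apply, h0, smul_zero] at h4
        exact lt_irrefl _ h4
    · refine ⟨x, ?_, h2⟩
      intro f' hf'
      rcases mem_insert.1 hf' with rfl | hf'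
      · exact h
      · exact h1 f' hf'

abbrev E3 := Fin 3 → ℝ

def D3 (x y z : E3) : ℝ :=
  x 0 * (y 1 * z 2 - y 2 * z 1) - x 1 * (y 0 * z 2 - y 2 * z 0) + x 2 * (y 0 * z 1 - y 1 * z 0)

def Dl (a b : E3) : E3 →ₗ[ℝ] ℝ where
  toFun x := D3 a b x
  map_add' x y := by simp only [D3, Pi.add_apply]; ring
  map_smul' c x := by simp only [D3, Pi.smul_apply, smul_eq_mul, RingHom.id_apply]; ring

lemma Dl_apply (a b x : E3) : Dl a b x = D3 a b x := rfl

lemma D3_rot (a b c : E3) : D3 b c a = D3 a b c := by simp only [D3]; ring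
lemma D3_swap (a b c : E3) : D3 b a c = - D3 a b c := by simp only [D3]; ring
lemma D3_self (a c : E3) : D3 a a c = 0 := by simp only [D3]; ring
lemma D3_self' (a c : E3) : D3 c a a = 0 := by simp only [D3]; ring
lemma D3_self'' (a c : E3) : D3 a c a = 0 := by simp only [D3]; ring
lemma D3_add (a b x y : E3) : D3 a b (x + y) = D3 a b x + D3 a b y := (Dl a b).map_add x y
lemma D3_smul (a b x : E3) (c : ℝ) : D3 a b (c • x) = c * D3 a b x := (Dl a b).map_smul c x

lemma cramer (a b c x : E3) :
    D3 a b c • x = D3 b c x • a + D3 c a x • b + D3 a b x • c := by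
  ext i; fin_cases i <;> simp [D3] <;> ring

lemma lin_cramer (a b c x : E3) (l : E3 →ₗ[ℝ] ℝ) :
    D3 a b c * l x = D3 b c x * l a + D3 c a x * l b + D3 a b x * l c := by
  have := congrArg l (cramer a b c x)
  simpa only [map_add, map_smul, smul_eq_mul] using this

variable {ι : Type*} (p : ι → E3)

noncomputable def nuX (η : ι → ℝ) (a b c : ι) : E3 →ₗ[ℝ] ℝ :=
  (D3 (p a) (p b) (p c))⁻¹ • (η a • Dl (p b) (p c) + η b • Dl (p c) (p a) + η c • Dl (p a) (p b))

noncomputable def nuE (a b c : ι) (x : E3) : (ι → ℝ) →ₗ[ℝ] ℝ :=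
  (D3 (p a) (p b) (p c))⁻¹ • (D3 (p b) (p c) x • LinearMap.proj a + D3 (p c) (p a) x • LinearMap.proj b
    + D3 (p a) (p b) x • LinearMap.proj c)

lemma nuE_apply (η : ι → ℝ) (a b c : ι) (x : E3) : nuE p a b c x η = nuX p η a b c x := by
  simp [nuE, nuX, Dl_apply]; ring

variable {p}

lemma nuX_a {η : ι → ℝ} {a b c : ι} (h : D3 (p a) (p b) (p c) ≠ 0) : nuX p η a b c (p a) = η a := by
  simp only [nuX, LinearMap.smul_apply, LinearMap.add_apply, Dl_apply, smul_eq_mul, D3_self', D3_self'',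
    D3_rot]
  field_simp; ring

lemma nuX_rot {η : ι → ℝ} {a b c : ι} : nuX p η b c a = nuX p η a b c := by
  refine LinearMap.ext (fun x => ?_)
  simp only [nuX, LinearMap.smul_apply, LinearMap.add_apply, smul_eq_mul, D3_rot]
  ring

lemma nuX_b {η : ι → ℝ} {a b c : ι} (h : D3 (p a) (p b) (p c) ≠ 0) : nuX p η a b c (p b) = η b := by
  rw [← nuX_rot]; exact nuX_a (by rwa [D3_rot])

lemma nuX_c {η : ι → ℝ} {a b c : ι} (h : D3 (p a) (p b) (p c) ≠ 0) : nuX p η a b c (p c) = η c := by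
  rw [← nuX_rot]; exact nuX_b (by rwa [D3_rot])

lemma nu_unique {η : ι → ℝ} {a b c : ι} (h : D3 (p a) (p b) (p c) ≠ 0) {l : E3 →ₗ[ℝ] ℝ}
    (ha : l (p a) = η a) (hb : l (p b) = η b) (hc : l (p c) = η c) : l = nuX p η a b c := by
  refine LinearMap.ext (fun x => ?_)
  apply mul_left_cancel₀ h
  rw [lin_cramer (p a) (p b) (p c) x l, lin_cramer (p a) (p b) (p c) x (nuX p η a b c), nuX_a h, nuX_b h, nuX_c h, ha, hb, hc]

def TT (p : ι → E3) (η : ι → ℝ) (a b c : ι) : Prop :=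
  0 < D3 (p a) (p b) (p c) ∧ ∀ i, i ≠ a → i ≠ b → i ≠ c → nuX p η a b c (p i) < η i

lemma TT_rot {η : ι → ℝ} {a b c : ι} (h : TT p η a b c) : TT p η b c a := by
  refine ⟨by rw [D3_rot]; exact h.1, fun i h1 h2 h3 => ?_⟩
  rw [nuX_rot]; exact h.2 i h3 h1 h2

lemma TT_le {η : ι → ℝ} {a b c : ι} (h : TT p η a b c) (i : ι) : nuX p η a b c (p i) ≤ η i := by
  by_cases h1 : i = a
  · rw [h1, nuX_a h.1.ne']
  by_cases h2 : i = b
  · rw [h2, nuX_b h.1.ne']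
  by_cases h3 : i = c
  · rw [h3, nuX_c h.1.ne']
  exact (h.2 i h1 h2 h3).le

lemma exists_eta [Fintype ι] (p : ι → E3) : ∃ η : ι → ℝ, (∀ i, 0 < η i) ∧
    (∀ a b c i, D3 (p a) (p b) (p c) ≠ 0 → i ≠ a → i ≠ b → i ≠ c → nuX p η a b c (p i) ≠ η i) ∧
    (∀ a b c, TT p η a b c → ∀ i, nuX p (fun _ => 1) a b c (p i) ≤ 1) := by
  let Q : Finset (ι × ι × ι × ι) := Finset.univ
  let Φ : ι × ι × ι × ι → ((ι → ℝ) →ₗ[ℝ] ℝ) := fun q =>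
    nuE p q.1 q.2.1 q.2.2.1 (p q.2.2.2) - LinearMap.proj q.2.2.2
  have hΦ : ∀ q η, Φ q η = nuX p η q.1 q.2.1 q.2.2.1 (p q.2.2.2) - η q.2.2.2 := by
    intro q η
    simp only [Φ, LinearMap.sub_apply, nuE_apply, LinearMap.proj_apply]
  obtain ⟨η, h1, h2⟩ := generic_pt
    ((Q.filter (fun q => q.2.2.2 ≠ q.1 ∧ q.2.2.2 ≠ q.2.1 ∧ q.2.2.2 ≠ q.2.2.1)).image Φ)
    ((Q.filter (fun q => 0 < Φ q (fun _ => 1))).image Φ ∪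
      (Finset.univ : Finset ι).image (fun i => LinearMap.proj i)) (by
      intro f hf h0
      obtain ⟨⟨a, b, c, i⟩, hq, rfl⟩ := mem_image.1 hf
      obtain ⟨ha, hb, hc⟩ := (mem_filter.1 hq).2
      simp only at ha hb hc
      have := congrArg (fun f => f (Pi.single i 1)) h0
      simp only [hΦ, nuX, LinearMap.smul_apply, LinearMap.add_apply, LinearMap.zero_apply] at this
      simp [Pi.single_apply, ha.symm, hb.symm, hc.symm] at this)
    (fun _ => 1) (by
      intro g hg
      rcases mem_union.1 hg with hg | hg
      · obtain ⟨q, hq, rfl⟩ := mem_image.1 hg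
        exact (mem_filter.1 hq).2
      · obtain ⟨i, hi, rfl⟩ := mem_image.1 hg
        simp)
  refine ⟨η, fun i => ?_, ?_, ?_⟩
  · exact h2 _ (mem_union_right _ (mem_image_of_mem (fun i => LinearMap.proj i) (mem_univ i)))
  · intro a b c i _ ha hb hc
    have := h1 _ (mem_image_of_mem Φ (mem_filter.2 ⟨mem_univ (a, b, c, i), ha, hb, hc⟩))
    rw [hΦ] at this
    exact sub_ne_zero.1 this
  · intro a b c hT i
    by_contra hcon
    push Not at hcon
    have := h2 _ (mem_union_left _ (mem_image_of_mem Φ (mem_filter.2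
      ⟨mem_univ (a, b, c, i), by rw [hΦ]; simpa using hcon⟩)))
    rw [hΦ] at this
    have := TT_le hT i
    simp only at *
    linarith

lemma F3 {η : ι → ℝ} {a b c a' b' c' : ι} (h : TT p η a b c) (h' : TT p η a' b' c')
    {x y z x' y' z' : ℝ} (hx : 0 ≤ x) (hy : 0 ≤ y) (hz : 0 ≤ z) (hx' : 0 ≤ x') (hy' : 0 ≤ y') (hz' : 0 ≤ z')
    (e : x • p a + y • p b + z • p c = x' • p a' + y' • p b' + z' • p c') (hpos : 0 < x) :
    a = a' ∨ a = b' ∨ a = c' := by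
  by_contra hcon
  push Not at hcon
  have e1 := congrArg (nuX p η a b c) e
  have e2 := congrArg (nuX p η a' b' c') e
  simp only [map_add, map_smul, smul_eq_mul, nuX_a h.1.ne', nuX_b h.1.ne', nuX_c h.1.ne'] at e1
  simp only [map_add, map_smul, smul_eq_mul, nuX_a h'.1.ne', nuX_b h'.1.ne', nuX_c h'.1.ne'] at e2
  have i1 := mul_lt_mul_of_pos_left (h'.2 a hcon.1 hcon.2.1 hcon.2.2) hpos
  have i2 := mul_le_mul_of_nonneg_left (TT_le h' b) hy
  have i3 := mul_le_mul_of_nonneg_left (TT_le h' c) hz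
  have j1 := mul_le_mul_of_nonneg_left (TT_le h a') hx'
  have j2 := mul_le_mul_of_nonneg_left (TT_le h b') hy'
  have j3 := mul_le_mul_of_nonneg_left (TT_le h c') hz'
  linarith

end PartD1

section PartD2

lemma small_eps {ι : Type*} [Finite ι] (c e : ι → ℝ) (hc : ∀ i, 0 < c i) :
    ∃ ε : ℝ, 0 < ε ∧ ∀ i, ε * e i < c i := by
  have h : ∀ᶠ ε : ℝ in nhdsWithin 0 (Set.Ioi 0), ∀ i, ε * e i < c i := by
    rw [Filter.eventually_all]
    intro i
    have : Filter.Tendsto (fun ε : ℝ => ε * e i) (nhds 0) (nhds (0 * e i)) :=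
      (continuous_id.mul continuous_const).tendsto 0
    rw [zero_mul] at this
    exact (this.eventually (gt_mem_nhds (hc i))).filter_mono nhdsWithin_le_nhds
  obtain ⟨ε, h1, h2⟩ := (h.and self_mem_nhdsWithin).exists
  exact ⟨ε, h2, h1⟩

def dt (x y : E3) : ℝ := x 0 * y 0 + x 1 * y 1 + x 2 * y 2

def cr (x y : E3) : E3 := ![x 1 * y 2 - x 2 * y 1, x 2 * y 0 - x 0 * y 2, x 0 * y 1 - x 1 * y 0]

def dtl (v : E3) : E3 →ₗ[ℝ] ℝ where
  toFun x := dt v x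
  map_add' x y := by simp only [dt, Pi.add_apply]; ring
  map_smul' c x := by simp only [dt, Pi.smul_apply, smul_eq_mul, RingHom.id_apply]; ring

lemma dtl_apply (v x : E3) : dtl v x = dt v x := rfl

lemma dt_cr (x y z : E3) : dt (cr x y) z = D3 x y z := by
  simp [dt, cr, D3]; ring

lemma dt_comm (x y : E3) : dt x y = dt y x := by simp only [dt]; ring

lemma dt_add (x y z : E3) : dt x (y + z) = dt x y + dt x z := (dtl x).map_add y z
lemma dt_smul (x z : E3) (c : ℝ) : dt x (c • z) = c * dt x z := (dtl x).map_smul c z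

lemma dtl_ne {v : E3} (hv : v ≠ 0) : dtl v ≠ 0 := by
  intro h
  apply hv
  have h0 : ∀ x, dt v x = 0 := fun x => by rw [← dtl_apply, h]; rfl
  ext i
  have := h0 (Pi.single i 1)
  fin_cases i <;> simpa [dt] using this

variable {ι : Type*} [Fintype ι] {p : ι → E3} {η : ι → ℝ}

lemma indep_triple (I : Set ι) (h : ∀ v : E3, (∀ i ∈ I, dt v (p i) = 0) → v = 0) :
    ∃ a ∈ I, ∃ b ∈ I, ∃ c ∈ I, D3 (p a) (p b) (p c) ≠ 0 := by
  by_contra hcon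
  push Not at hcon
  have h1 : ∀ a ∈ I, ∀ b ∈ I, cr (p a) (p b) = 0 := fun a ha b hb =>
    h _ (fun c hc => by rw [dt_cr]; exact hcon a ha b hb c hc)
  have h2 : ∀ a ∈ I, p a = 0 := by
    intro a ha
    have h3 : ∀ e, cr e (p a) = 0 := by
      intro e
      refine h _ (fun i hi => ?_)
      rw [dt_cr, ← D3_rot, ← dt_cr, h1 a ha i hi]; simp [dt]
    have e1 := congrFun (h3 ![1, 0, 0])
    have e2 := congrFun (h3 ![0, 1, 0])
    have e12 := e1 1; have e13 := e1 2; have e21 := e2 2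
    ext i
    simp [cr] at e12 e13 e21
    fin_cases i <;> assumption
  have h4 := h ![1, 0, 0] (fun i hi => by rw [h2 i hi]; simp [dt])
  have := congrFun h4 0
  simp at this

lemma cover (H0 : ∀ l : E3 →ₗ[ℝ] ℝ, l ≠ 0 → ∃ i, 0 < l (p i)) (hη : ∀ i, 0 < η i)
    (hgen : ∀ a b c i, D3 (p a) (p b) (p c) ≠ 0 → i ≠ a → i ≠ b → i ≠ c → nuX p η a b c (p i) ≠ η i)
    (x : E3) : ∃ a b c, TT p η a b c ∧ ∃ s t u : ℝ, 0 ≤ s ∧ 0 ≤ t ∧ 0 ≤ u ∧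
      x = s • p a + t • p b + u • p c := by
  have hcont : ∀ y : E3, Continuous (fun v : E3 => dt v y) := by
    intro y; unfold dt; fun_prop
  let K : Set E3 := {v | ∀ i, dt v (p i) ≤ η i}
  have hKc : IsClosed K := by
    have : K = ⋂ i, {v | dt v (p i) ≤ η i} := by ext; simp [K]
    rw [this]
    exact isClosed_iInter (fun i => isClosed_le (hcont _) continuous_const)
  have hne : Nonempty ι := by
    obtain ⟨i, _⟩ := H0 (LinearMap.proj 0) (by
      intro h; have := congrArg (fun f => f ![1, 0, 0]) h; simp at this)
    exact ⟨i⟩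
  have hKb : Bornology.IsBounded K := by
    obtain ⟨v0, hv0, hmin⟩ := (isCompact_sphere (0 : E3) 1).exists_isMinOn
      (NormedSpace.sphere_nonempty.2 zero_le_one)
      (f := fun v => Finset.univ.sup' univ_nonempty (fun i => dt v (p i)))
      (Continuous.continuousOn (Continuous.finset_sup'_apply _ (fun i _ => hcont (p i))))
    set δ := Finset.univ.sup' univ_nonempty (fun i => dt v0 (p i)) with hδ
    have hδ0 : 0 < δ := by
      obtain ⟨i, hi⟩ := H0 (dtl v0) (dtl_ne (by
        intro h; rw [h] at hv0; simp at hv0))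
      exact lt_of_lt_of_le hi (Finset.le_sup' (fun i => dt v0 (p i)) (mem_univ i))
    set N := Finset.univ.sup' univ_nonempty η
    refine (Metric.isBounded_closedBall (x := (0 : E3)) (r := N / δ)).subset (fun v hv => ?_)
    rw [mem_closedBall_zero_iff, le_div_iff₀ hδ0]
    by_cases h0 : v = 0
    · rw [h0, norm_zero, zero_mul]
      exact (hη (Classical.arbitrary ι)).le.trans (Finset.le_sup' η (mem_univ _))
    have hn : 0 < ‖v‖ := norm_pos_iff.2 h0
    have h1 : δ ≤ _ := hmin (show (‖v‖⁻¹ • v) ∈ Metric.sphere (0 : E3) 1 by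
      rw [mem_sphere_zero_iff_norm, norm_smul, norm_inv, norm_norm, inv_mul_cancel₀ hn.ne'])
    obtain ⟨i, _, hi⟩ := Finset.exists_mem_eq_sup' univ_nonempty
      (fun i => dt (‖v‖⁻¹ • v) (p i))
    simp only at h1
    rw [hi, dt_comm, dt_smul] at h1
    have h2 : ‖v‖ * δ ≤ dt (p i) v := by
      calc ‖v‖ * δ ≤ ‖v‖ * (‖v‖⁻¹ * dt (p i) v) := mul_le_mul_of_nonneg_left h1 hn.le
        _ = dt (p i) v := by field_simp
    rw [dt_comm] at h2
    exact h2.trans ((hv i).trans (Finset.le_sup' η (mem_univ _)))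
  have hKK : IsCompact K := Metric.isCompact_of_isClosed_isBounded hKc hKb
  have hK0 : (0 : E3) ∈ K := fun i => by simpa [dt] using (hη i).le
  obtain ⟨v1, hv1, hmax⟩ := hKK.exists_isMaxOn ⟨0, hK0⟩ (hcont x).continuousOn
  let F : Set E3 := K ∩ {v | dt v1 x ≤ dt v x}
  have hF : IsCompact F := hKK.inter_right (isClosed_le continuous_const (hcont x))
  obtain ⟨ν, hν⟩ := hF.extremePoints_nonempty ⟨v1, hv1, le_refl (dt v1 x)⟩
  rw [mem_extremePoints] at hν
  obtain ⟨⟨hνK, hνx⟩, hext⟩ := hν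
  have hopt : ∀ v ∈ K, dt v x ≤ dt ν x := fun v hv => (hmax hv).trans hνx
  let I : Set ι := {i | dt ν (p i) = η i}
  have hmove : ∀ μ : E3, (∀ i ∈ I, dt μ (p i) ≤ 0) → ∃ ε : ℝ, 0 < ε ∧ ν + ε • μ ∈ K := by
    intro μ hμ
    obtain ⟨ε, h1, h2⟩ := small_eps (fun i => if i ∈ I then 1 else η i - dt ν (p i))
      (fun i => if i ∈ I then 0 else dt μ (p i)) (by
        intro i
        by_cases hi : i ∈ I
        · simp [hi]
        · simp only [hi, if_false, sub_pos]
          exact lt_of_le_of_ne (hνK i) hi)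
    refine ⟨ε, h1, fun i => ?_⟩
    have e : dt (ν + ε • μ) (p i) = dt ν (p i) + ε * dt μ (p i) := by
      rw [dt_comm, dt_add, dt_smul, dt_comm ν, dt_comm μ]
    rw [e]
    by_cases hi : i ∈ I
    · have := hμ i hi
      have h3 : dt ν (p i) = η i := hi
      nlinarith
    · have := h2 i
      simp only [hi, if_false] at this
      linarith
  have hlin : ∀ (ε : ℝ) μ, dt (ν + ε • μ) x = dt ν x + ε * dt μ x := by
    intro ε μ
    rw [dt_comm, dt_add, dt_smul, dt_comm x ν, dt_comm x μ]
  have hsgn : ∀ μ : E3, (∀ i ∈ I, dt μ (p i) ≤ 0) → dt μ x ≤ 0 := by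
    intro μ hμ
    obtain ⟨ε, h1, h2⟩ := hmove μ hμ
    have := hopt _ h2
    rw [hlin] at this
    by_contra hc; push Not at hc
    nlinarith [mul_pos h1 hc]
  have hneg : ∀ μ y : E3, dt (-μ) y = - dt μ y := by intro μ y; simp [dt]; ring
  obtain ⟨a, ha, b, hb, c, hc, habc⟩ := indep_triple (p := p) I (by
    intro μ hμ
    have hμ' : ∀ i ∈ I, dt (-μ) (p i) ≤ 0 := fun i hi => by rw [hneg, hμ i hi]; simp
    obtain ⟨ε, h1, h2⟩ := hmove μ (fun i hi => (hμ i hi).le)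
    obtain ⟨ε', h1', h2'⟩ := hmove (-μ) hμ'
    have h3 := hsgn μ (fun i hi => (hμ i hi).le)
    have h3' := hsgn (-μ) hμ'
    rw [hneg] at h3'
    have h4 : dt μ x = 0 := le_antisymm h3 (by linarith)
    have m1 : ν + ε • μ ∈ F := ⟨h2, by rw [Set.mem_ofPred_eq, hlin, h4]; simpa using hνx⟩
    have m2 : ν + ε' • (-μ) ∈ F := ⟨h2', by rw [Set.mem_ofPred_eq, hlin, hneg, h4]; simpa using hνx⟩
    have h5 := hext _ m1 _ m2 (by
      refine ⟨ε' / (ε + ε'), ε / (ε + ε'), by positivity, by positivity, by field_simp; ring, ?_⟩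
      ext i
      simp only [Pi.add_apply, Pi.smul_apply, Pi.neg_apply, smul_eq_mul]
      field_simp; ring)
    have h6 : ε • μ = 0 := by
      have := h5.1; simpa using this
    exact (smul_eq_zero.1 h6).resolve_left h1.ne')
  wlog hpos : 0 < D3 (p a) (p b) (p c) generalizing a b with Hw
  · refine Hw b hb a ha ?_ ?_
    · rw [D3_swap]; exact neg_ne_zero.2 habc
    · rw [D3_swap]; exact neg_pos.2 (lt_of_le_of_ne (not_lt.1 hpos) habc)
  have hνe : dtl ν = nuX p η a b c := nu_unique habc ha hb hc
  have hI : ∀ i ∈ I, i = a ∨ i = b ∨ i = c := by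
    intro i hi
    by_contra hcon
    push Not at hcon
    apply hgen a b c i habc hcon.1 hcon.2.1 hcon.2.2
    rw [← hνe]; exact hi
  refine ⟨a, b, c, ⟨hpos, fun i h1 h2 h3 => ?_⟩, (D3 (p a) (p b) (p c))⁻¹ * D3 (p b) (p c) x,
    (D3 (p a) (p b) (p c))⁻¹ * D3 (p c) (p a) x, (D3 (p a) (p b) (p c))⁻¹ * D3 (p a) (p b) x, ?_, ?_, ?_, ?_⟩
  · rw [← hνe]
    refine lt_of_le_of_ne (hνK i) (fun h => ?_)
    rcases hI i h with h | h | h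
    · exact h1 h
    · exact h2 h
    · exact h3 h
  · have := hsgn (-cr (p b) (p c)) (by
      intro i hi
      rw [hneg, dt_cr]
      rcases hI i hi with rfl | rfl | rfl
      · rw [D3_rot]; linarith
      · rw [D3_self'']; simp
      · rw [D3_self']; simp)
    rw [hneg, dt_cr] at this
    exact mul_nonneg (inv_nonneg.2 hpos.le) (by linarith)
  · have := hsgn (-cr (p c) (p a)) (by
      intro i hi
      rw [hneg, dt_cr]
      rcases hI i hi with rfl | rfl | rfl
      · rw [D3_self']; simp
      · rw [D3_rot, D3_rot]; linarith
      · rw [D3_self'']; simp)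
    rw [hneg, dt_cr] at this
    exact mul_nonneg (inv_nonneg.2 hpos.le) (by linarith)
  · have := hsgn (-cr (p a) (p b)) (by
      intro i hi
      rw [hneg, dt_cr]
      rcases hI i hi with rfl | rfl | rfl
      · rw [D3_self'']; simp
      · rw [D3_self']; simp
      · linarith)
    rw [hneg, dt_cr] at this
    exact mul_nonneg (inv_nonneg.2 hpos.le) (by linarith)
  · have := cramer (p a) (p b) (p c) x
    rw [mul_smul, mul_smul, mul_smul, ← smul_add, ← smul_add, ← this, smul_smul, inv_mul_cancel₀ habc, one_smul]

end PartD2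

section PartD3f

lemma BI {I : Type*} [Fintype I] (σ : Equiv.Perm I) (k κ l H g R : I → ℝ) (hl : ∀ o, l o ≠ 0)
    (h1 : ∀ o, κ (σ o) - κ o = - k o * l (σ o))
    (h2 : ∀ o, H (σ o) * l o - H o * l (σ o) = - g o * R o) :
    ∑ o, k o * H (σ o) = - ∑ o, κ o * g o * (R o / (l o * l (σ o))) := by
  have e1 : ∀ o, k o * H (σ o) = κ o * (H (σ o) / l (σ o)) - κ (σ o) * (H (σ o) / l (σ o)) := by
    intro o
    have := hl (σ o)
    field_simp
    linear_combination (H (σ o)) * h1 o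
  have e2 : ∀ o, κ o * g o * (R o / (l o * l (σ o))) = κ o * (H o / l o) - κ o * (H (σ o) / l (σ o)) := by
    intro o
    have := hl (σ o); have := hl o
    field_simp
    linear_combination (κ o) * h2 o
  rw [sum_congr rfl (fun o _ => e1 o), sum_congr rfl (fun o _ => e2 o),
    sum_sub_distrib, sum_sub_distrib,
    Equiv.sum_comp σ (fun o => κ o * (H o / l o))]
  ring

lemma pluck (n u r r' : E3) (f : E3 →ₗ[ℝ] ℝ) (hf : f n = 0) :
    f r' * D3 n u r - f r * D3 n u r' = - f u * D3 n r r' := by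
  have := lin_cramer n r r' u f
  rw [hf] at this
  have e1 : D3 r' n u = D3 n u r' := by simp only [D3]; ring
  have e2 : D3 n r u = - D3 n u r := by simp only [D3]; ring
  rw [e1, e2] at this
  linarith

set_option maxHeartbeats 1000000 in
lemma local_lemma {I : Type*} [Fintype I] (σ : Equiv.Perm I) (n : E3) (r w : I → E3) (k : I → ℝ)
    (ν : I → (E3 →ₗ[ℝ] ℝ)) (α : E3 →ₗ[ℝ] ℝ)
    (hw : ∀ o, w (σ o) = w o + k o • r (σ o))
    (hr : ∀ o, 0 < D3 n (r o) (r (σ o)))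
    (hn : ∀ o, ν o n = 1) (hν : ∀ o, ν o (r o) = 0) (hν' : ∀ o, ν o (r (σ o)) = 0)
    (hγ : ∀ o, ν (σ o) (r o) ≤ 0) (hαn : α n = 1) (hα : ∀ o, α (r o) < 0)
    (huniq : ∀ u o o', 0 < D3 n (r o) u → 0 < D3 n u (r (σ o)) → 0 < D3 n (r o') u →
      0 < D3 n u (r (σ o')) → o = o') :
    ∑ o, D3 n (w o) (w (σ o)) ≤ 0 ∧ (∑ o, D3 n (w o) (w (σ o)) = 0 → ∀ o, k o = 0) := by
  rcases isEmpty_or_nonempty I with hI | ⟨⟨o0⟩⟩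
  · simp
  obtain ⟨u, hu, -⟩ := generic_pt (Finset.univ.image (fun o => Dl (r o) n)) ∅ (by
    intro f hf h0
    obtain ⟨o, -, rfl⟩ := mem_image.1 hf
    have := congrArg (fun f => f (r (σ o))) h0
    simp only [Dl_apply, LinearMap.zero_apply] at this
    rw [D3_swap] at this
    have := hr o; linarith) 0 (by simp)
  let l : I → ℝ := fun o => D3 n u (r o)
  have hl : ∀ o, l o ≠ 0 := by
    intro o
    have := hu (Dl (r o) n) (mem_image.2 ⟨o, mem_univ _, rfl⟩)
    rwa [Dl_apply, D3_rot, D3_rot] at this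
  let R : I → ℝ := fun o => D3 n (r o) (r (σ o))
  let γ : I → ℝ := fun o => - (ν (σ o) (r o)) / R o
  have hR : ∀ o, 0 < R o := hr
  have hγ0 : ∀ o, 0 ≤ γ o := fun o => div_nonneg (by linarith [hγ o]) (hR o).le
  have hνj : ∀ o x, ν (σ o) x - ν o x = γ o * D3 n (r (σ o)) x := by
    intro o x
    have e := lin_cramer n (r o) (r (σ o)) x (ν (σ o) - ν o)
    simp only [LinearMap.sub_apply, hn, hν, hν'] at e
    have e1 : D3 (r (σ o)) n x = - D3 n (r (σ o)) x := D3_swap _ _ _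
    rw [e1] at e
    simp only [γ]
    have := (hR o).ne'
    simp only [R] at this ⊢
    field_simp
    linarith
  let φ : I → (E3 →ₗ[ℝ] ℝ) := fun o => Dl n (w o)
  let h : I → (E3 →ₗ[ℝ] ℝ) := fun o => ν o - α
  have hφn : ∀ o, φ o n = 0 := fun o => D3_self'' _ _
  have hhn : ∀ o, h o n = 0 := fun o => by simp [h, hn, hαn]
  have hφj : ∀ o x, φ (σ o) x = φ o x + k o * D3 n (r (σ o)) x := by
    intro o x
    simp only [φ, Dl_apply, hw, D3, Pi.add_apply, Pi.smul_apply, smul_eq_mul]; ring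
  have hhj : ∀ o x, h (σ o) x = h o x + γ o * D3 n (r (σ o)) x := by
    intro o x
    have := hνj o x
    simp only [h, LinearMap.sub_apply]; linarith
  have hru : ∀ o, D3 n (r o) u = - l o := fun o => by simp only [D3, l]; ring
  have j1 : ∀ o, φ (σ o) u - φ o u = - k o * l (σ o) := by
    intro o; rw [hφj, hru]; ring
  have j2 : ∀ o, h (σ o) u - h o u = - γ o * l (σ o) := by
    intro o; rw [hhj, hru]; ring
  have q1 : ∀ o, φ (σ o) (r (σ o)) * l o - φ o (r o) * l (σ o) = - φ o u * R o := by
    intro o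
    rw [hφj, D3_self', mul_zero, add_zero]
    exact pluck _ _ _ _ _ (hφn o)
  have q2 : ∀ o, h (σ o) (r (σ o)) * l o - h o (r o) * l (σ o) = - h o u * R o := by
    intro o
    rw [hhj, D3_self', mul_zero, add_zero]
    exact pluck _ _ _ _ _ (hhn o)
  have q3 : ∀ f : E3 →ₗ[ℝ] ℝ, f n = 0 → ∀ o, f (r (σ o)) * l o - f (r o) * l (σ o) = - f u * R o := by
    intro f hf o
    exact pluck _ _ _ _ _ hf
  let c : I → ℝ := fun o => R o / (l o * l (σ o))
  have b11 : ∑ o, k o * φ (σ o) (r (σ o)) = - ∑ o, φ o u * φ o u * c o :=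
    BI σ k (fun o => φ o u) l (fun o => φ o (r o)) (fun o => φ o u) R hl j1 q1
  have b12 : ∑ o, k o * h (σ o) (r (σ o)) = - ∑ o, φ o u * h o u * c o :=
    BI σ k (fun o => φ o u) l (fun o => h o (r o)) (fun o => h o u) R hl j1 q2
  have b22 : ∑ o, γ o * h (σ o) (r (σ o)) = - ∑ o, h o u * h o u * c o :=
    BI σ γ (fun o => h o u) l (fun o => h o (r o)) (fun o => h o u) R hl j2 q2
  let s0 : E3 →ₗ[ℝ] ℝ := Dl n (r o0)
  have hs0 : s0 n = 0 := D3_self'' _ _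
  have hs0u : s0 u ≠ 0 := by
    have : s0 u = - l o0 := hru o0
    rw [this]; exact neg_ne_zero.2 (hl o0)
  have b1s : ∑ o, k o * s0 (r (σ o)) = - ∑ o, φ o u * s0 u * c o :=
    BI σ k (fun o => φ o u) l (fun o => s0 (r o)) (fun _ => s0 u) R hl j1 (q3 s0 hs0)
  have b2s : ∑ o, γ o * s0 (r (σ o)) = - ∑ o, h o u * s0 u * c o :=
    BI σ γ (fun o => h o u) l (fun o => s0 (r o)) (fun _ => s0 u) R hl j2 (q3 s0 hs0)
  have bss : ∑ o : I, (0 : ℝ) * s0 (r (σ o)) = - ∑ o, s0 u * s0 u * c o :=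
    BI σ (fun _ => 0) (fun o => s0 u) l (fun o => s0 (r o)) (fun _ => s0 u) R hl (by simp) (q3 s0 hs0)
  have hkr : ∑ o, k o • r (σ o) = 0 := by
    have : ∀ o, k o • r (σ o) = w (σ o) - w o := fun o => by rw [hw]; simp
    rw [sum_congr rfl (fun o _ => this o), sum_sub_distrib, Equiv.sum_comp σ w, sub_self]
  have hkf : ∀ f : E3 →ₗ[ℝ] ℝ, ∑ o, k o * f (r (σ o)) = 0 := by
    intro f
    have := congrArg f hkr
    simpa only [map_sum, map_smul, smul_eq_mul, map_zero] using this
  have hh1 : ∀ o, h (σ o) (r (σ o)) = - α (r (σ o)) := by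
    intro o; simp [h, hν]
  have z1s : ∑ o, φ o u * s0 u * c o = 0 := by
    rw [hkf] at b1s; linarith
  have z12 : ∑ o, φ o u * h o u * c o = 0 := by
    have : ∑ o, k o * h (σ o) (r (σ o)) = 0 := by
      have e := hkf (-α)
      simp only [hh1]; simpa using e
    linarith
  have z2s : ∑ o, h o u * s0 u * c o = 0 := by
    have : ∑ o, γ o * s0 (r (σ o)) = 0 := by
      have e : ∀ o, γ o * s0 (r (σ o)) = h o (r o0) - h (σ o) (r o0) := by
        intro o
        rw [hhj]
        have : s0 (r (σ o)) = - D3 n (r (σ o)) (r o0) := by simp only [s0, Dl_apply, D3]; ring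
        rw [this]; ring
      rw [sum_congr rfl (fun o _ => e o), sum_sub_distrib,
        Equiv.sum_comp σ (fun o => h o (r o0)), sub_self]
    linarith
  have zss : ∑ o, s0 u * s0 u * c o = 0 := by
    simp only [zero_mul, Finset.sum_const_zero] at bss; linarith
  set Sh := ∑ o, γ o * h (σ o) (r (σ o)) with hSh
  have hSh0 : 0 ≤ Sh := sum_nonneg (fun o _ => by
    rw [hh1]; exact mul_nonneg (hγ0 o) (by linarith [hα (σ o)]))
  have hS : ∑ o, D3 n (w o) (w (σ o)) = ∑ o, k o * φ (σ o) (r (σ o)) := by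
    refine sum_congr rfl (fun o _ => ?_)
    rw [hφj, hw]
    simp only [φ, Dl_apply, D3, Pi.add_apply, Pi.smul_apply, smul_eq_mul]; ring
  rw [hS]
  set Sw := ∑ o, k o * φ (σ o) (r (σ o)) with hSw
  have hc : ∀ o, l o * l (σ o) < 0 → (l o < 0 ∧ 0 < l (σ o)) ∨ (0 < l o ∧ l (σ o) < 0) := by
    intro o ho
    rcases lt_or_gt_of_ne (hl o) with h1 | h1
    · exact Or.inl ⟨h1, by nlinarith⟩
    · exact Or.inr ⟨h1, by nlinarith⟩
  have hneg : ∀ x y : E3, D3 n (-x) y = - D3 n x y := by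
    intro x y; simp only [D3, Pi.neg_apply]; ring
  have hneg' : ∀ x y : E3, D3 n x (-y) = - D3 n x y := by
    intro x y; simp only [D3, Pi.neg_apply]; ring
  have uP : ∀ o o', l o < 0 → 0 < l (σ o) → l o' < 0 → 0 < l (σ o') → o = o' := by
    intro o o' a1 a2 a3 a4
    exact huniq u o o' (by rw [hru]; linarith) a2 (by rw [hru]; linarith) a4
  have uN : ∀ o o', 0 < l o → l (σ o) < 0 → 0 < l o' → l (σ o') < 0 → o = o' := by
    intro o o' a1 a2 a3 a4
    refine huniq (-u) o o' ?_ ?_ ?_ ?_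
    · rw [hneg', hru]; linarith
    · rw [hneg]; exact neg_pos.2 a2
    · rw [hneg', hru]; linarith
    · rw [hneg]; exact neg_pos.2 a4
  have hhu : ∀ o, R o * h o u = l (σ o) * (- α (r o)) - l o * (- α (r (σ o))) := by
    intro o
    have := q3 (h o) (hhn o) o
    have e1 : h o (r o) = - α (r o) := by simp [h, hν]
    have e2 : h o (r (σ o)) = - α (r (σ o)) := by simp [h, hν']
    rw [e1, e2] at this
    linarith
  obtain ⟨t, s, hts⟩ : ∃ t s : ℝ, ∀ o, l o * l (σ o) < 0 → φ o u + t * h o u - s * s0 u = 0 := by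
    by_cases hP : ∃ o, l o < 0 ∧ 0 < l (σ o)
    · obtain ⟨o1, p1, p2⟩ := hP
      by_cases hN : ∃ o, 0 < l o ∧ l (σ o) < 0
      · obtain ⟨o2, n1, n2⟩ := hN
        have g1 : 0 < h o1 u := by
          have := hhu o1
          have := mul_pos p2 (neg_pos.2 (hα o1))
          have := mul_pos (neg_pos.2 p1) (neg_pos.2 (hα (σ o1)))
          exact pos_of_mul_pos_right (a := R o1) (by linarith) (hR o1).le
        have g2 : h o2 u < 0 := by
          have := hhu o2
          have := mul_pos n1 (neg_pos.2 (hα (σ o2)))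
          have := mul_pos (neg_pos.2 n2) (neg_pos.2 (hα o2))
          by_contra hcon
          push Not at hcon
          have := mul_nonneg (hR o2).le hcon
          linarith
        have gd : h o1 u - h o2 u ≠ 0 := by linarith
        refine ⟨- (φ o1 u - φ o2 u) / (h o1 u - h o2 u),
          (φ o1 u + - (φ o1 u - φ o2 u) / (h o1 u - h o2 u) * h o1 u) / s0 u, fun o ho => ?_⟩
        rw [div_mul_cancel₀ _ hs0u]
        rcases hc o ho with ⟨a1, a2⟩ | ⟨a1, a2⟩
        · rw [uP o o1 a1 a2 p1 p2]; ring
        · rw [uN o o2 a1 a2 n1 n2]; field_simp; ring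
      · refine ⟨0, φ o1 u / s0 u, fun o ho => ?_⟩
        rw [div_mul_cancel₀ _ hs0u]
        rcases hc o ho with ⟨a1, a2⟩ | h2
        · rw [uP o o1 a1 a2 p1 p2]; ring
        · exact absurd ⟨o, h2⟩ hN
    · by_cases hN : ∃ o, 0 < l o ∧ l (σ o) < 0
      · obtain ⟨o2, n1, n2⟩ := hN
        refine ⟨0, φ o2 u / s0 u, fun o ho => ?_⟩
        rw [div_mul_cancel₀ _ hs0u]
        rcases hc o ho with h2 | ⟨a1, a2⟩
        · exact absurd ⟨o, h2⟩ hP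
        · rw [uN o o2 a1 a2 n1 n2]; ring
      · refine ⟨0, 0, fun o ho => ?_⟩
        rcases hc o ho with h2 | h2
        · exact absurd ⟨o, h2⟩ hP
        · exact absurd ⟨o, h2⟩ hN
  let ψ : I → ℝ := fun o => φ o u + t * h o u - s * s0 u
  have hQ : ∑ o, ψ o * ψ o * c o = - Sw - t ^ 2 * Sh := by
    have : ∀ o, ψ o * ψ o * c o = φ o u * φ o u * c o + t ^ 2 * (h o u * h o u * c o)
        + s ^ 2 * (s0 u * s0 u * c o) + 2 * t * (φ o u * h o u * c o) - 2 * s * (φ o u * s0 u * c o)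
        - 2 * s * t * (h o u * s0 u * c o) := by
      intro o; simp only [ψ]; ring
    rw [sum_congr rfl (fun o _ => this o)]
    simp only [sum_add_distrib, sum_sub_distrib, ← mul_sum]
    rw [← mul_sum] at zss
    rw [z12, z1s, z2s, zss]
    linear_combination b11 + t ^ 2 * b22
  have hll : ∀ o, l o * l (σ o) ≠ 0 := fun o => mul_ne_zero (hl o) (hl _)
  have hterm : ∀ o, 0 ≤ ψ o * ψ o * c o := by
    intro o
    rcases lt_or_gt_of_ne (hll o) with h1 | h1
    · have : ψ o = 0 := hts o h1
      rw [this]; simp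
    · exact mul_nonneg (mul_self_nonneg _) (div_pos (hR o) h1).le
  have hQ0 := sum_nonneg (fun o (_ : o ∈ Finset.univ) => hterm o)
  have ht := mul_nonneg (sq_nonneg t) hSh0
  refine ⟨by linarith, fun h0 => ?_⟩
  have hQz : ∑ o, ψ o * ψ o * c o = 0 := by linarith
  have hψ : ∀ o, ψ o = 0 := by
    intro o
    have := (sum_eq_zero_iff_of_nonneg (fun o _ => hterm o)).1 hQz o (mem_univ _)
    rcases mul_eq_zero.1 this with h1 | h1
    · exact mul_self_eq_zero.1 h1
    · exact absurd h1 (div_ne_zero (hR o).ne' (hll o))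
  have hkt : ∀ o, k o + t * γ o = 0 := by
    intro o
    have e : (k o + t * γ o) * l (σ o) = 0 := by
      have a1 := hψ o; have a2 := hψ (σ o)
      have a3 := j1 o; have a4 := j2 o
      simp only [ψ] at a1 a2
      linear_combination a1 - a2 + a3 + t * a4
    exact (mul_eq_zero.1 e).resolve_right (hl _)
  have htS : t ^ 2 * Sh = 0 := by linarith
  rcases mul_eq_zero.1 htS with h1 | h1
  · grind
  · intro o
    have h2 := (sum_eq_zero_iff_of_nonneg (fun o _ => by
      rw [hh1]; exact mul_nonneg (hγ0 o) (by linarith [hα (σ o)]))).1 h1 o (mem_univ _)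
    rw [hh1] at h2
    have h3 : γ o = 0 := (mul_eq_zero.1 h2).resolve_right (by have := hα (σ o); linarith)
    have := hkt o
    rw [h3] at this; linarith

end PartD3f

section PartD4

structure Fan {ι : Type*} (p : ι → E3) (η : ι → ℝ) : Prop where
  H0 : ∀ l : E3 →ₗ[ℝ] ℝ, l ≠ 0 → ∃ i, 0 < l (p i)
  pos : ∀ i, 0 < η i
  gen : ∀ a b c i, D3 (p a) (p b) (p c) ≠ 0 → i ≠ a → i ≠ b → i ≠ c → nuX p η a b c (p i) ≠ η i
  one : ∀ a b c, TT p η a b c → ∀ i, nuX p (fun _ => 1) a b c (p i) ≤ 1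

variable {ι : Type*} [Fintype ι] {p : ι → E3} {η : ι → ℝ}

def inC (p : ι → E3) (a b c : ι) (x : E3) : Prop :=
  0 ≤ D3 (p b) (p c) x ∧ 0 ≤ D3 (p c) (p a) x ∧ 0 ≤ D3 (p a) (p b) x

lemma coverC (F : Fan p η) (x : E3) : ∃ a b c, TT p η a b c ∧ inC p a b c x := by
  obtain ⟨a, b, c, hT, s, t, u, hs, ht, hu, rfl⟩ := cover F.H0 F.pos F.gen x
  refine ⟨a, b, c, hT, ?_, ?_, ?_⟩
  · rw [D3_add, D3_add, D3_smul, D3_smul, D3_smul, D3_self', D3_self'', D3_rot]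
    simpa using mul_nonneg hs hT.1.le
  · rw [D3_add, D3_add, D3_smul, D3_smul, D3_smul, D3_self', D3_self'', D3_rot, D3_rot]
    simpa using mul_nonneg ht hT.1.le
  · rw [D3_add, D3_add, D3_smul, D3_smul, D3_smul, D3_self', D3_self'']
    simpa using mul_nonneg hu hT.1.le

lemma inC_rot {a b c : ι} {x : E3} (h : inC p a b c x) : inC p b c a x := ⟨h.2.1, h.2.2, h.1⟩

lemma F3C {a b c a' b' c' : ι} (h : TT p η a b c) (h' : TT p η a' b' c') {x : E3}
    (hx : inC p a b c x) (hx' : inC p a' b' c' x) (hpos : 0 < D3 (p b) (p c) x) :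
    a = a' ∨ a = b' ∨ a = c' := by
  set d := D3 (p a) (p b) (p c)
  set d' := D3 (p a') (p b') (p c')
  have hd : 0 < d := h.1
  have hd' : 0 < d' := h'.1
  refine F3 (x := d' * D3 (p b) (p c) x) (y := d' * D3 (p c) (p a) x) (z := d' * D3 (p a) (p b) x)
    (x' := d * D3 (p b') (p c') x) (y' := d * D3 (p c') (p a') x) (z' := d * D3 (p a') (p b') x) h h'
    (mul_nonneg hd'.le hx.1) (mul_nonneg hd'.le hx.2.1) (mul_nonneg hd'.le hx.2.2)
    (mul_nonneg hd.le hx'.1) (mul_nonneg hd.le hx'.2.1) (mul_nonneg hd.le hx'.2.2) ?_ (mul_pos hd' hpos)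
  simp only [mul_smul, ← smul_add]
  rw [← cramer, ← cramer, smul_smul, smul_smul, mul_comm]

lemma nearC (F : Fan p η) (x y : E3) : ∃ ε : ℝ, 0 < ε ∧ ∃ a b c, TT p η a b c ∧
    inC p a b c (x + ε • y) ∧ inC p a b c x := by
  obtain ⟨ε, he, h⟩ := perturb (((Finset.univ : Finset (ι × ι)).filter
    (fun q => D3 (p q.1) (p q.2) x < 0)).image (fun q => - Dl (p q.1) (p q.2))) x y (by
      intro g hg
      obtain ⟨q, hq, rfl⟩ := mem_image.1 hg
      have := (mem_filter.1 hq).2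
      simpa [Dl_apply] using this)
  obtain ⟨a, b, c, hT, hC⟩ := coverC F (x + ε • y)
  have key : ∀ i j, 0 ≤ D3 (p i) (p j) (x + ε • y) → 0 ≤ D3 (p i) (p j) x := by
    intro i j h1
    by_contra hcon
    push Not at hcon
    have := h (- Dl (p i) (p j)) (mem_image.2 ⟨(i, j), mem_filter.2 ⟨mem_univ _, hcon⟩, rfl⟩)
    rw [LinearMap.neg_apply, Dl_apply] at this
    linarith
  exact ⟨ε, he, a, b, c, hT, hC, key _ _ hC.1, key _ _ hC.2.1, key _ _ hC.2.2⟩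

lemma TT_ne {a b c : ι} (h : TT p η a b c) : a ≠ b ∧ b ≠ c ∧ a ≠ c := by
  have := h.1
  refine ⟨?_, ?_, ?_⟩ <;> rintro rfl
  · rw [D3_self] at this; exact lt_irrefl _ this
  · rw [D3_self'] at this; exact lt_irrefl _ this
  · rw [D3_self''] at this; exact lt_irrefl _ this

lemma exists_flip (F : Fan p η) {a b c : ι} (h : TT p η a b c) : ∃ c', TT p η b a c' := by
  obtain ⟨ε, he, x, y, z, hT, h1, h2⟩ := nearC F (p a + p b) (- p c)
  have hd := h.1
  have e1 : D3 (p b) (p c) (p a + p b) = D3 (p a) (p b) (p c) := by simp only [D3, Pi.add_apply]; ring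
  have e2 : D3 (p c) (p a) (p a + p b) = D3 (p a) (p b) (p c) := by simp only [D3, Pi.add_apply]; ring
  have e3 : D3 (p a) (p b) (p a + p b) = 0 := by simp only [D3, Pi.add_apply]; ring
  have hC : inC p a b c (p a + p b) := ⟨by rw [e1]; exact hd.le, by rw [e2]; exact hd.le, by rw [e3]⟩
  have ma := F3C h hT hC h2 (by rw [e1]; exact hd)
  have mb := F3C (TT_rot h) hT (inC_rot hC) h2 (by rw [e2]; exact hd)
  have hab := (TT_ne h).1
  have bad : ∀ z', ¬ (TT p η a b z' ∧ inC p a b z' (p a + p b + ε • -p c)) := by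
    rintro z' ⟨-, -, -, h3⟩
    have : D3 (p a) (p b) (p a + p b + ε • -p c) = - (ε * D3 (p a) (p b) (p c)) := by
      simp only [D3, Pi.add_apply, Pi.smul_apply, Pi.neg_apply, smul_eq_mul]; ring
    rw [this] at h3
    have := mul_pos he hd
    linarith
  rcases ma with rfl | rfl | rfl
  · rcases mb with rfl | rfl | rfl
    · exact absurd rfl hab
    · exact absurd ⟨hT, h1⟩ (bad z)
    · exact ⟨_, TT_rot (TT_rot hT)⟩
  · rcases mb with rfl | rfl | rfl
    · exact ⟨_, hT⟩
    · exact absurd rfl hab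
    · exact absurd ⟨TT_rot hT, inC_rot h1⟩ (bad x)
  · rcases mb with rfl | rfl | rfl
    · exact absurd ⟨TT_rot (TT_rot hT), inC_rot (inC_rot h1)⟩ (bad y)
    · exact ⟨_, TT_rot hT⟩
    · exact absurd rfl hab

lemma third_unique {a b c c' : ι} (h : TT p η a b c) (h' : TT p η a b c') : c = c' := by
  have hd := h.1
  have hd' := h'.1
  obtain ⟨ε, he, h3⟩ := small_eps (fun _ : Fin 2 => D3 (p a) (p b) (p c'))
    ![- D3 (p b) (p c') (p c), - D3 (p c') (p a) (p c)] (fun _ => hd')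
  have i0 := h3 0
  have i1 := h3 1
  simp at i0 i1
  have hde := mul_pos he hd
  set x := p a + p b + ε • p c with hx
  have e1 : D3 (p b) (p c) x = D3 (p a) (p b) (p c) := by
    simp only [hx, D3, Pi.add_apply, Pi.smul_apply, smul_eq_mul]; ring
  have e2 : D3 (p c) (p a) x = D3 (p a) (p b) (p c) := by
    simp only [hx, D3, Pi.add_apply, Pi.smul_apply, smul_eq_mul]; ring
  have e3 : D3 (p a) (p b) x = ε * D3 (p a) (p b) (p c) := by
    simp only [hx, D3, Pi.add_apply, Pi.smul_apply, smul_eq_mul]; ring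
  have e1' : D3 (p b) (p c') x = D3 (p a) (p b) (p c') + ε * D3 (p b) (p c') (p c) := by
    simp only [hx, D3, Pi.add_apply, Pi.smul_apply, smul_eq_mul]; ring
  have e2' : D3 (p c') (p a) x = D3 (p a) (p b) (p c') + ε * D3 (p c') (p a) (p c) := by
    simp only [hx, D3, Pi.add_apply, Pi.smul_apply, smul_eq_mul]; ring
  have hC : inC p a b c x := ⟨by rw [e1]; exact hd.le, by rw [e2]; exact hd.le, by rw [e3]; exact hde.le⟩
  have hC' : inC p a b c' x := ⟨by rw [e1']; linarith, by rw [e2']; linarith, by rw [e3]; exact hde.le⟩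
  have := F3C (TT_rot (TT_rot h)) h' (inC_rot (inC_rot hC)) hC' (by rw [e3]; exact hde)
  have hne := TT_ne h
  rcases this with h1 | h1 | h1
  · exact absurd h1.symm hne.2.2
  · exact absurd h1.symm hne.2.1
  · exact h1

abbrev OO (p : ι → E3) (η : ι → ℝ) := {t : ι × ι × ι // TT p η t.1 t.2.1 t.2.2}

def rotF (o : OO p η) : OO p η := ⟨(o.1.2.1, o.1.2.2, o.1.1), TT_rot o.2⟩

lemma rotF3 (o : OO p η) : rotF (rotF (rotF o)) = o := rfl

def rotE : Equiv.Perm (OO p η) where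
  toFun := rotF
  invFun o := rotF (rotF o)
  left_inv o := rfl
  right_inv o := rfl

noncomputable def flipF (F : Fan p η) (o : OO p η) : OO p η :=
  ⟨(o.1.2.1, o.1.1, (exists_flip F o.2).choose), (exists_flip F o.2).choose_spec⟩

lemma OO_ext {o o' : OO p η} (h1 : o.1.1 = o'.1.1) (h2 : o.1.2.1 = o'.1.2.1) : o = o' := by
  obtain ⟨⟨a, b, c⟩, h⟩ := o
  obtain ⟨⟨a', b', c'⟩, h'⟩ := o'
  simp only at h1 h2
  subst h1 h2
  have := third_unique h h'
  subst this
  rfl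

lemma flipF2 (F : Fan p η) (o : OO p η) : flipF F (flipF F o) = o := OO_ext rfl rfl

noncomputable def flipE (F : Fan p η) : Equiv.Perm (OO p η) where
  toFun := flipF F
  invFun := flipF F
  left_inv := flipF2 F
  right_inv := flipF2 F

lemma oneval {a b c : ι} (h : TT p η a b c) : nuX p (fun _ => 1) a b c (p a) = 1 ∧
    nuX p (fun _ => 1) a b c (p b) = 1 ∧ nuX p (fun _ => 1) a b c (p c) = 1 :=
  ⟨nuX_a h.1.ne', nuX_b h.1.ne', nuX_c h.1.ne'⟩


lemma cr0 (x y : E3) : cr x y 0 = x 1 * y 2 - x 2 * y 1 := rfl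
lemma cr1 (x y : E3) : cr x y 1 = x 2 * y 0 - x 0 * y 2 := rfl
lemma cr2 (x y : E3) : cr x y 2 = x 0 * y 1 - x 1 * y 0 := rfl

lemma e3_ext {x y : E3} (h0 : x 0 = y 0) (h1 : x 1 = y 1) (h2 : x 2 = y 2) : x = y := by
  ext i; fin_cases i <;> assumption

lemma cr_ang (e f w : E3) : dt (cr e f) (cr e f) • w =
    dt (cr w e) f • cr e f + dt (cr w f) (cr e f) • e - dt (cr w e) (cr e f) • f := by
  apply e3_ext <;> simp only [dt, cr0, cr1, cr2, Pi.smul_apply, smul_eq_mul, Pi.add_apply, Pi.sub_apply] <;> ring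

lemma dt_self_pos {x : E3} (h : x ≠ 0) : 0 < dt x x := by
  have h0 : 0 ≤ dt x x := by
    have := mul_self_nonneg (x 0); have := mul_self_nonneg (x 1); have := mul_self_nonneg (x 2)
    unfold dt; linarith
  refine lt_of_le_of_ne h0 (fun hz => h ?_)
  have h1 : x 0 * x 0 + x 1 * x 1 + x 2 * x 2 = 0 := hz.symm
  have a0 : x 0 = 0 := by nlinarith [mul_self_nonneg (x 0), mul_self_nonneg (x 1), mul_self_nonneg (x 2)]
  have a1 : x 1 = 0 := by nlinarith [mul_self_nonneg (x 0), mul_self_nonneg (x 1), mul_self_nonneg (x 2)]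
  have a2 : x 2 = 0 := by nlinarith [mul_self_nonneg (x 0), mul_self_nonneg (x 1), mul_self_nonneg (x 2)]
  ext i; fin_cases i <;> assumption

lemma ang_unique {e f w w' : E3} (hN : cr e f ≠ 0) (h1 : cr w e = cr w' e) (h2 : cr w f = cr w' f) :
    w = w' := by
  have e1 := cr_ang e f w
  rw [h1, h2, ← cr_ang e f w'] at e1
  exact smul_right_injective _ (dt_self_pos hN).ne' e1

lemma ang_exists {e f x y : E3} (hN : cr e f ≠ 0) (h1 : dt x e = 0) (h2 : dt y f = 0)
    (h3 : dt (x - y) (e - f) = 0) : ∃ w, cr w e = x ∧ cr w f = y := by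
  have hp := dt_self_pos hN
  set N := dt (cr e f) (cr e f) with hNd
  have h4 : dt y e = - dt x f := by
    simp only [dt, Pi.sub_apply] at h1 h2 h3 ⊢; linarith
  refine ⟨N⁻¹ • (dt x f • cr e f + dt y (cr e f) • e - dt x (cr e f) • f), ?_, ?_⟩
  · apply smul_right_injective _ hp.ne'
    have : N • cr (N⁻¹ • (dt x f • cr e f + dt y (cr e f) • e - dt x (cr e f) • f)) e =
      cr (dt x f • cr e f + dt y (cr e f) • e - dt x (cr e f) • f) e := by
      apply e3_ext <;> simp only [cr0, cr1, cr2, Pi.smul_apply, smul_eq_mul, Pi.add_apply, Pi.sub_apply] <;> field_simp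
    simp only
    rw [this, hNd]
    have key : cr (dt x f • cr e f + dt y (cr e f) • e - dt x (cr e f) • f) e =
      dt (cr e f) (cr e f) • x - dt x e • (dt f f • e - dt e f • f) := by
      apply e3_ext <;> simp only [dt, cr0, cr1, cr2, Pi.smul_apply, smul_eq_mul, Pi.add_apply, Pi.sub_apply] <;> ring
    rw [key, h1, zero_smul, sub_zero]
  · apply smul_right_injective _ hp.ne'
    have : N • cr (N⁻¹ • (dt x f • cr e f + dt y (cr e f) • e - dt x (cr e f) • f)) f =
      cr (dt x f • cr e f + dt y (cr e f) • e - dt x (cr e f) • f) f := by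
      apply e3_ext <;> simp only [cr0, cr1, cr2, Pi.smul_apply, smul_eq_mul, Pi.add_apply, Pi.sub_apply] <;> field_simp
    simp only
    rw [this, hNd]
    have key : cr (dt x f • cr e f + dt y (cr e f) • e - dt x (cr e f) • f) f =
      dt (cr e f) (cr e f) • y - dt y f • (dt e e • f - dt e f • e)
        + (dt y e + dt x f) • (dt e f • f - dt f f • e) := by
      apply e3_ext <;> simp only [dt, cr0, cr1, cr2, Pi.smul_apply, smul_eq_mul, Pi.add_apply, Pi.sub_apply] <;> ring
    rw [key, h2, h4]; simp

lemma par_of_cr {e z : E3} (he : e ≠ 0) (h : cr z e = 0) : ∃ k : ℝ, z = k • e := by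
  have hp := dt_self_pos he
  have key : dt e e • z = dt z e • e + cr e (cr z e) := by
    apply e3_ext <;> simp only [dt, cr0, cr1, cr2, Pi.smul_apply, smul_eq_mul, Pi.add_apply, Pi.sub_apply] <;> ring
  refine ⟨(dt e e)⁻¹ * dt z e, ?_⟩
  rw [h] at key
  have : cr e 0 = 0 := by ext i; fin_cases i <;> simp [cr]
  rw [this, add_zero] at key
  rw [mul_smul, ← key, smul_smul, inv_mul_cancel₀ hp.ne', one_smul]

end PartD4

section PartD5

variable {ι : Type*} [Fintype ι] {p : ι → E3} {η : ι → ℝ}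

lemma cr_add (w x y : E3) : cr w (x + y) = cr w x + cr w y := by
  apply e3_ext <;> simp only [cr0, cr1, cr2, Pi.add_apply] <;> ring
lemma cr_sub (w x y : E3) : cr w (x - y) = cr w x - cr w y := by
  apply e3_ext <;> simp only [cr0, cr1, cr2, Pi.sub_apply] <;> ring
lemma cr_sub_left (w w' x : E3) : cr (w - w') x = cr w x - cr w' x := by
  apply e3_ext <;> simp only [cr0, cr1, cr2, Pi.sub_apply] <;> ring

lemma N_ne {a b c : E3} (h : D3 a b c ≠ 0) : cr (b - a) (c - a) ≠ 0 := by
  intro h0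
  apply h
  have : D3 a b c = dt (cr (b - a) (c - a)) a := by
    simp only [D3, dt, cr0, cr1, cr2, Pi.sub_apply]; ring
  rw [this, h0]; simp [dt]

set_option maxHeartbeats 1000000 in
lemma fan_w (F : Fan p η)
    (hexp : ∀ a, ∃ α : E3 →ₗ[ℝ] ℝ, α (p a) = 1 ∧ ∀ j, j ≠ a → α (p j) < 1)
    (m : ι → E3) (hm : ∀ i j, (∃ l : E3 →ₗ[ℝ] ℝ, l ≠ 0 ∧ ∀ k, l (p k) ≤ l (p i) ∧ l (p k) ≤ l (p j)) →
      dt (m i - m j) (p i - p j) = 0) :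
    ∃ w : OO p η → E3, (∀ o, w (rotF o) = w o) ∧ (∀ o, w (flipF F o) = w o) ∧
      ∀ o, cr (w o) (p o.1.2.1 - p o.1.1) = m o.1.2.1 - m o.1.1 := by
  have hpair : ∀ a b c, TT p η a b c → dt (m a - m b) (p a - p b) = 0 := by
    intro a b c h
    obtain ⟨h1, h2, h3⟩ := oneval h
    refine hm a b ⟨nuX p (fun _ => 1) a b c, ?_, ?_⟩
    · intro h0; rw [h0] at h1; simp at h1
    · intro k; rw [h1, h2]; exact ⟨F.one a b c h k, F.one a b c h k⟩
  have hsymm : ∀ i j, dt (m i - m j) (p i - p j) = 0 → dt (m j - m i) (p j - p i) = 0 := by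
    intro i j h
    rw [← h]; simp only [dt, Pi.sub_apply]; ring
  have hex : ∀ o : OO p η, ∃ w, cr w (p o.1.2.1 - p o.1.1) = m o.1.2.1 - m o.1.1 ∧
      cr w (p o.1.2.2 - p o.1.1) = m o.1.2.2 - m o.1.1 := by
    rintro ⟨⟨a, b, c⟩, h⟩
    simp only at h ⊢
    refine ang_exists (N_ne h.1.ne') (hsymm _ _ (hpair a b c h)) (hpair c a b (TT_rot (TT_rot h))) ?_
    have := hpair b c a (TT_rot h)
    simpa using this
  choose w hw1 hw2 using hex
  have hrot : ∀ o, w (rotF o) = w o := by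
    intro o
    have h1 := hw1 (rotF o)
    have h2 := hw2 (rotF o)
    obtain ⟨⟨a, b, c⟩, h⟩ := o
    have h3 := hw1 ⟨⟨a, b, c⟩, h⟩
    have h4 := hw2 ⟨⟨a, b, c⟩, h⟩
    simp only [rotF] at h1 h2 h3 h4 ⊢
    refine ang_unique (N_ne h.1.ne') ?_ ?_
    · rw [h3, cr_sub, ← neg_sub, ← cr_sub, h2]; simp
    · rw [h4]
      have : p c - p a = (p c - p b) - (p a - p b) := by abel
      rw [this, cr_sub, h1, h2]; abel
  have hflip : ∀ o, ∃ k : ℝ, w (flipF F o) = w o + k • (p o.1.2.1 - p o.1.1) := by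
    intro o
    have h1 := hw1 (flipF F o)
    have h2 := hw1 o
    have hne : p o.1.2.1 - p o.1.1 ≠ 0 := by
      intro h0
      have := o.2.1
      rw [sub_eq_zero] at h0
      rw [h0, D3_self] at this
      exact lt_irrefl _ this
    obtain ⟨k, hk⟩ := par_of_cr (z := w (flipF F o) - w o) hne (by
      rw [cr_sub_left, h2]
      have h3 : cr (w (flipF F o)) (p o.1.2.1 - p o.1.1) = - cr (w (flipF F o)) (p o.1.1 - p o.1.2.1) := by
        rw [cr_sub, cr_sub]; abel
      rw [h3]
      have h4 : cr (w (flipF F o)) (p o.1.1 - p o.1.2.1) = m o.1.1 - m o.1.2.1 := h1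
      rw [h4]; abel)
    exact ⟨k, by rw [← hk]; abel⟩
  choose kf hkf using hflip
  let σ : Equiv.Perm (OO p η) := (rotE.trans rotE).trans (flipE F)
  have hσ : ∀ o, σ o = flipF F (rotF (rotF o)) := fun o => rfl
  have hσA : ∀ o, (σ o).1.1 = o.1.1 := fun o => rfl
  have hσB : ∀ o, (σ o).1.2.1 = o.1.2.2 := fun o => rfl
  have hwσ : ∀ o, w (σ o) = w o + kf (rotF (rotF o)) • (p (σ o).1.2.1 - p (σ o).1.1)
      * (-1) := by
    intro o
    rw [hσ, hkf, hrot, hrot]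
    simp only [rotF, flipF]
    ext i; simp; ring
  let S : ι → ℝ := fun a => ∑ o ∈ Finset.univ.filter (fun o : OO p η => o.1.1 = a),
    D3 (p o.1.1) (w o) (w (σ o))
  have htot : ∑ a, S a = 0 := by
    have e0 : ∑ a, S a = ∑ o : OO p η, D3 (p o.1.1) (w o) (w (σ o)) :=
      Finset.sum_fiberwise Finset.univ (fun o : OO p η => o.1.1) _
    have e1 : ∑ o : OO p η, D3 (p o.1.1) (w o) (w (σ o)) =
        ∑ o : OO p η, D3 (p o.1.2.1) (w o) (w (flipF F o)) := by
      rw [← Equiv.sum_comp (rotE.trans rotE) (fun o : OO p η => D3 (p o.1.2.1) (w o) (w (flipF F o)))]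
      refine sum_congr rfl (fun o _ => ?_)
      have : ((rotE.trans rotE) o) = rotF (rotF o) := rfl
      rw [this, hrot, hrot, hσ]; rfl
    have e2 : ∑ o : OO p η, D3 (p o.1.2.1) (w o) (w (flipF F o)) =
        ∑ o : OO p η, D3 (p o.1.1) (w (flipF F o)) (w o) := by
      rw [← Equiv.sum_comp (flipE F) (fun o : OO p η => D3 (p o.1.2.1) (w o) (w (flipF F o)))]
      refine sum_congr rfl (fun o _ => ?_)
      have : (flipE F o) = flipF F o := rfl
      rw [this, flipF2]; rfl
    have e3 : ∑ o : OO p η, D3 (p o.1.2.1) (w o) (w (flipF F o)) +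
        ∑ o : OO p η, D3 (p o.1.1) (w (flipF F o)) (w o) = 0 := by
      rw [← sum_add_distrib]
      refine sum_eq_zero (fun o _ => ?_)
      rw [hkf]
      simp only [D3, Pi.add_apply, Pi.smul_apply, Pi.sub_apply, smul_eq_mul]; ring
    rw [e0, e1]; linarith
  have hloc : ∀ a, S a ≤ 0 ∧ (S a = 0 → ∀ o : OO p η, o.1.1 = a → w (σ o) = w o) := by
    intro a
    obtain ⟨α, hα1, hα2⟩ := hexp a
    let I := {o : OO p η // o.1.1 = a}
    let τ : Equiv.Perm I := σ.subtypePerm (fun o => by rw [hσA])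
    have hτ : ∀ o : I, (τ o).1 = σ o.1 := fun o => rfl
    let r : I → E3 := fun o => p o.1.1.2.1 - p a
    let k : I → ℝ := fun o => - kf (rotF (rotF o.1))
    have hrτ : ∀ o : I, r (τ o) = p o.1.1.2.2 - p a := fun o => rfl
    have hDr : ∀ o : I, D3 (p a) (r o) (r (τ o)) = D3 (p o.1.1.1) (p o.1.1.2.1) (p o.1.1.2.2) := by
      intro o
      rw [hrτ, o.2]
      simp only [r, D3, Pi.sub_apply]; ring
    have L := local_lemma τ (p a) r (fun o => w o.1) k
      (fun o => nuX p (fun _ => 1) o.1.1.1 o.1.1.2.1 o.1.1.2.2) α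
      (by
        intro o
        rw [hτ, hwσ]
        simp only [hσA, o.2, k]
        ext i; simp [r, hτ])
      (by intro o; rw [hDr]; exact o.1.2.1)
      (by intro o; have := (oneval o.1.2).1; rwa [o.2] at this ⊢)
      (by
        intro o; have h1 := (oneval o.1.2).1; have h2 := (oneval o.1.2).2.1
        rw [o.2] at h1 h2 ⊢
        simp only [r, map_sub, h2, h1, sub_self])
      (by
        intro o; have h1 := (oneval o.1.2).1; have h2 := (oneval o.1.2).2.2
        rw [hrτ]
        rw [o.2] at h1 h2 ⊢
        simp only [map_sub, h2, h1, sub_self])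
      (by
        intro o
        have h1 := (oneval (τ o).1.2).1
        have h2 := F.one _ _ _ (τ o).1.2 o.1.1.2.1
        simp only [r, map_sub]
        rw [(τ o).2] at h1 h2 ⊢
        rw [h1]; linarith)
      hα1
      (by
        intro o
        have hne := (TT_ne o.1.2).1
        simp only [r, map_sub, hα1]
        have := hα2 o.1.1.2.1 (by rw [o.2] at hne; exact hne.symm)
        linarith)
      (by
        rintro u ⟨⟨⟨a1, b, c⟩, hT⟩, ha1⟩ ⟨⟨⟨a2, b', c'⟩, hT'⟩, ha2⟩ h1 h2 h3 h4
        simp only [hrτ] at h1 h2 h3 h4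
        simp only [r] at h1 h3
        simp only at ha1 ha2 hT hT'
        subst ha1 ha2
        have g1 : 0 < D3 (p a2) (p b) u := by
          have : D3 (p a2) (p b - p a2) u = D3 (p a2) (p b) u := by simp only [D3, Pi.sub_apply]; ring
          rwa [this] at h1
        have g2 : 0 < D3 (p c) (p a2) u := by
          have : D3 (p a2) u (p c - p a2) = D3 (p c) (p a2) u := by simp only [D3, Pi.sub_apply]; ring
          rwa [this] at h2
        have g3 : 0 < D3 (p a2) (p b') u := by
          have : D3 (p a2) (p b' - p a2) u = D3 (p a2) (p b') u := by simp only [D3, Pi.sub_apply]; ring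
          rwa [this] at h3
        have g4 : 0 < D3 (p c') (p a2) u := by
          have : D3 (p a2) u (p c' - p a2) = D3 (p c') (p a2) u := by simp only [D3, Pi.sub_apply]; ring
          rwa [this] at h4
        obtain ⟨ε, he, h5⟩ := small_eps (fun i : Fin 2 => ![D3 (p a2) (p b) (p c), D3 (p a2) (p b') (p c')] i)
          ![- D3 (p b) (p c) u, - D3 (p b') (p c') u] (by
            intro i; fin_cases i
            · exact hT.1
            · exact hT'.1)
        have i0 := h5 0
        have i1 := h5 1
        simp at i0 i1
        have f1 : ∀ y z, D3 y z (p a2 + ε • u) = D3 y z (p a2) + ε * D3 y z u := by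
          intro y z; rw [D3_add, D3_smul]
        have hC : inC p a2 b c (p a2 + ε • u) := by
          refine ⟨?_, ?_, ?_⟩ <;> rw [f1]
          · rw [D3_rot]; linarith
          · rw [D3_self']; have := mul_pos he g2; linarith
          · rw [D3_self'']; have := mul_pos he g1; linarith
        have hC' : inC p a2 b' c' (p a2 + ε • u) := by
          refine ⟨?_, ?_, ?_⟩ <;> rw [f1]
          · rw [D3_rot]; linarith
          · rw [D3_self']; have := mul_pos he g4; linarith
          · rw [D3_self'']; have := mul_pos he g3; linarith
        have mb := F3C (TT_rot hT) hT' (inC_rot hC) hC' (by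
          rw [f1, D3_self']; have := mul_pos he g2; linarith)
        have mc := F3C (TT_rot (TT_rot hT)) hT' (inC_rot (inC_rot hC)) hC' (by
          rw [f1, D3_self'']; have := mul_pos he g1; linarith)
        have hne := TT_ne hT
        have hbb : b = b' := by
          rcases mb with h | h | h
          · exact absurd h.symm hne.1
          · exact h
          · rcases mc with h' | h' | h'
            · exact absurd h'.symm hne.2.2
            · subst h h'
              have := hT'.1
              have e : D3 (p a2) (p c) (p b) = - D3 (p a2) (p b) (p c) := by simp only [D3]; ring
              rw [e] at this
              have := hT.1
              linarith
            · exact absurd (h.trans h'.symm) hne.2.1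
        apply Subtype.ext
        exact OO_ext rfl hbb)
    have hS : S a = ∑ o : I, D3 (p a) (w o.1) (w (τ o).1) := by
      simp only [S]
      rw [Finset.sum_subtype (p := fun o : OO p η => o.1.1 = a) _ (by intro o; simp)]
      refine sum_congr rfl (fun o _ => ?_)
      rw [o.2, hτ]
    rw [hS]
    refine ⟨L.1, fun h0 o ho => ?_⟩
    have := L.2 h0 ⟨o, ho⟩
    simp only [k, neg_eq_zero] at this
    rw [hwσ, this]
    ext i; simp
  have hS0 : ∀ a, S a = 0 := by
    intro a
    have := (Finset.sum_eq_zero_iff_of_nonpos (fun a _ => (hloc a).1)).1 htot a (mem_univ _)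
    exact this
  refine ⟨w, hrot, fun o => ?_, hw1⟩
  have := (hloc _).2 (hS0 _) (rotF o) rfl
  rw [hσ, rotF3, hrot] at this
  exact this

end PartD5

section PartD6

variable {ι : Type*} [Fintype ι] {p : ι → E3} {η : ι → ℝ}

lemma adj_label (F : Fan p η) {T : Type*} (L : OO p η → T) (hr : ∀ o, L (rotF o) = L o)
    (hf : ∀ o, L (flipF F o) = L o) (o o' : OO p η) (x : E3)
    (hx : inC p o.1.1 o.1.2.1 o.1.2.2 x) (hx' : inC p o'.1.1 o'.1.2.1 o'.1.2.2 x)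
    (h1 : 0 < D3 (p o.1.2.1) (p o.1.2.2) x) (h2 : 0 < D3 (p o.1.2.2) (p o.1.1) x) : L o = L o' := by
  have ma := F3C o.2 o'.2 hx hx' h1
  have mb := F3C (TT_rot o.2) o'.2 (inC_rot hx) hx' h2
  have hne := (TT_ne o.2).1
  have r1 : L (rotF o') = L o' := hr o'
  have r2 : L (rotF (rotF o')) = L o' := by rw [hr, hr]
  rcases ma with a1 | a1 | a1 <;> rcases mb with b1 | b1 | b1
  · exact absurd (a1.trans b1.symm) hne
  · rw [OO_ext a1 b1]
  · rw [← hf o, ← r2]; congr 1; exact OO_ext b1 a1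
  · rw [← hf o]; congr 1; exact OO_ext b1 a1
  · exact absurd (a1.trans b1.symm) hne
  · rw [← r1]; congr 1; exact OO_ext a1 b1
  · rw [← r2]; congr 1; exact OO_ext a1 b1
  · rw [← hf o, ← r1]; congr 1; exact OO_ext b1 a1
  · exact absurd (a1.trans b1.symm) hne

lemma adj_label' (F : Fan p η) {T : Type*} (L : OO p η → T) (hr : ∀ o, L (rotF o) = L o)
    (hf : ∀ o, L (flipF F o) = L o) (o o' : OO p η) (x : E3)
    (hx : inC p o.1.1 o.1.2.1 o.1.2.2 x) (hx' : inC p o'.1.1 o'.1.2.1 o'.1.2.2 x)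
    (hray : ∀ i, ∀ s : ℝ, x ≠ s • p i) : L o = L o' := by
  have hd := o.2.1
  have hcr := cramer (p o.1.1) (p o.1.2.1) (p o.1.2.2) x
  have hno : ∀ i, ∀ s : ℝ, D3 (p o.1.1) (p o.1.2.1) (p o.1.2.2) • x ≠ s • p i := by
    intro i s h
    apply hray i ((D3 (p o.1.1) (p o.1.2.1) (p o.1.2.2))⁻¹ * s)
    rw [mul_smul, ← h, smul_smul, inv_mul_cancel₀ hd.ne', one_smul]
  rcases hx.1.lt_or_eq with h1 | h1
  · rcases hx.2.1.lt_or_eq with h2 | h2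
    · exact adj_label F L hr hf o o' x hx hx' h1 h2
    · rcases hx.2.2.lt_or_eq with h3 | h3
      · rw [← hr o, ← hr (rotF o)]
        exact adj_label F L hr hf (rotF (rotF o)) o' x (inC_rot (inC_rot hx)) hx' h3 h1
      · rw [← h2, ← h3] at hcr
        exact absurd (by simpa using hcr) (hno o.1.1 (D3 (p o.1.2.1) (p o.1.2.2) x))
  · rcases hx.2.1.lt_or_eq with h2 | h2
    · rcases hx.2.2.lt_or_eq with h3 | h3
      · rw [← hr o]
        exact adj_label F L hr hf (rotF o) o' x (inC_rot hx) hx' h2 h3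
      · rw [← h1, ← h3] at hcr
        exact absurd (by simpa using hcr) (hno o.1.2.1 (D3 (p o.1.2.2) (p o.1.1) x))
    · rw [← h1, ← h2] at hcr
      exact absurd (by simpa using hcr) (hno o.1.2.2 (D3 (p o.1.1) (p o.1.2.1) x))

lemma inC_gen {a b c : ι} (h : TT p η a b c) (Fs : Finset (E3 →ₗ[ℝ] ℝ)) (hF : ∀ f ∈ Fs, f ≠ 0) :
    ∃ x, inC p a b c x ∧ ∀ f ∈ Fs, f x ≠ 0 := by
  have hd := h.1
  obtain ⟨x, h1, h2⟩ := generic_pt Fs {Dl (p b) (p c), Dl (p c) (p a), Dl (p a) (p b)} hF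
    (p a + p b + p c) (by
      intro g hg
      simp only [mem_insert, mem_singleton] at hg
      have e1 : D3 (p b) (p c) (p a + p b + p c) = D3 (p a) (p b) (p c) := by
        simp only [D3, Pi.add_apply]; ring
      have e2 : D3 (p c) (p a) (p a + p b + p c) = D3 (p a) (p b) (p c) := by
        simp only [D3, Pi.add_apply]; ring
      have e3 : D3 (p a) (p b) (p a + p b + p c) = D3 (p a) (p b) (p c) := by
        simp only [D3, Pi.add_apply]; ring
      rcases hg with rfl | rfl | rfl
      · rw [Dl_apply, e1]; exact hd
      · rw [Dl_apply, e2]; exact hd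
      · rw [Dl_apply, e3]; exact hd)
  refine ⟨x, ⟨(h2 (Dl (p b) (p c)) (by simp)).le, (h2 (Dl (p c) (p a)) (by simp)).le,
    (h2 (Dl (p a) (p b)) (by simp)).le⟩, h1⟩

lemma label_const (F : Fan p η) (hp0 : ∀ i, p i ≠ 0) {T : Type*} (L : OO p η → T)
    (hr : ∀ o, L (rotF o) = L o) (hf : ∀ o, L (flipF F o) = L o) (o1 o2 : OO p η) : L o1 = L o2 := by
  by_contra hne
  have hz : ∀ i, ∃ y z, D3 (p i) y z ≠ 0 := by
    intro i
    by_contra hcon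
    push Not at hcon
    apply hp0 i
    have a0 := hcon ![0, 1, 0] ![0, 0, 1]
    have a1 := hcon ![0, 0, 1] ![1, 0, 0]
    have a2 := hcon ![1, 0, 0] ![0, 1, 0]
    simp [D3] at a0 a1 a2
    exact e3_ext a0 a1 a2
  choose y z hyz using hz
  obtain ⟨x1, hx1, hg1⟩ := inC_gen o1.2 (Finset.univ.image (fun i => Dl (p i) (y i))) (by
    intro f hf h0
    obtain ⟨i, -, rfl⟩ := mem_image.1 hf
    exact hyz i (congrArg (fun f => f (z i)) h0))
  obtain ⟨x2, hx2, hg2⟩ := inC_gen o2.2 (Finset.univ.image (fun i => Dl x1 (p i))) (by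
    intro f hf h0
    obtain ⟨i, -, rfl⟩ := mem_image.1 hf
    apply hg1 (Dl (p i) (y i)) (mem_image.2 ⟨i, mem_univ _, rfl⟩)
    have := congrArg (fun f => f (y i)) h0
    simp only [Dl_apply, LinearMap.zero_apply] at this ⊢
    rw [D3_rot, this])
  have hg : ∀ i, D3 x1 (p i) x2 ≠ 0 := fun i =>
    hg2 (Dl x1 (p i)) (mem_image.2 ⟨i, mem_univ _, rfl⟩)
  let γ : ℝ → E3 := fun t => x1 + t • (x2 - x1)
  have hγ : Continuous γ := by fun_prop
  have hray : ∀ t i, ∀ s : ℝ, γ t ≠ s • p i := by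
    intro t i s h
    have h3 : ∀ j, x1 j + t * (x2 j - x1 j) = s * p i j := fun j => by
      have := congrFun h j; simpa [γ] using this
    have e0 := h3 0; have e1 := h3 1; have e2 := h3 2
    have A : (1 - t) * D3 x1 (p i) x2 = 0 := by
      simp only [D3]
      linear_combination (p i 1 * x2 2 - p i 2 * x2 1) * e0 - (p i 0 * x2 2 - p i 2 * x2 0) * e1
        + (p i 0 * x2 1 - p i 1 * x2 0) * e2
    have B : t * D3 x1 (p i) x2 = 0 := by
      simp only [D3]
      linear_combination (p i 2 * x1 1 - p i 1 * x1 2) * e0 - (p i 2 * x1 0 - p i 0 * x1 2) * e1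
        + (p i 1 * x1 0 - p i 0 * x1 1) * e2
    exact hg i (by linarith)
  let C : OO p η → Set ℝ := fun o => {t | inC p o.1.1 o.1.2.1 o.1.2.2 (γ t)}
  have hcont : ∀ a b : E3, Continuous (fun t => D3 a b (γ t)) := by
    intro a b; simp only [D3, γ, Pi.add_apply, Pi.smul_apply]; fun_prop
  have hC : ∀ o, IsClosed (C o) := by
    intro o
    exact (isClosed_le continuous_const (hcont _ _)).inter
      ((isClosed_le continuous_const (hcont _ _)).inter (isClosed_le continuous_const (hcont _ _)))
  let UA : Set ℝ := ⋃ o ∈ {o | L o = L o1}, C o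
  let UB : Set ℝ := ⋃ o ∈ {o | L o ≠ L o1}, C o
  have hUA : IsClosed UA := (Set.toFinite _).isClosed_biUnion (fun o _ => hC o)
  have hUB : IsClosed UB := (Set.toFinite _).isClosed_biUnion (fun o _ => hC o)
  have hpre : IsPreconnected (Set.univ : Set ℝ) := isPreconnected_univ
  rw [isPreconnected_closed_iff] at hpre
  obtain ⟨t, -, h1, h2⟩ := hpre UA UB hUA hUB (by
      intro t _
      obtain ⟨a, b, c, hT, hx⟩ := coverC F (γ t)
      by_cases h : L ⟨(a, b, c), hT⟩ = L o1
      · exact Or.inl (Set.mem_iUnion₂.2 ⟨⟨(a, b, c), hT⟩, h, hx⟩)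
      · exact Or.inr (Set.mem_iUnion₂.2 ⟨⟨(a, b, c), hT⟩, h, hx⟩))
    ⟨0, Set.mem_univ _, Set.mem_biUnion (x := o1) rfl (by
      have : γ 0 = x1 := by simp [γ]
      simp only [C, Set.mem_ofPred_eq, this]; exact hx1)⟩
    ⟨1, Set.mem_univ _, Set.mem_biUnion (x := o2) (Ne.symm hne) (by
      have : γ 1 = x2 := by simp [γ]
      simp only [C, Set.mem_ofPred_eq, this]; exact hx2)⟩
  obtain ⟨o, ho, hot⟩ := Set.mem_iUnion₂.1 h1
  obtain ⟨o', ho', hot'⟩ := Set.mem_iUnion₂.1 h2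
  have := adj_label' F L hr hf o o' (γ t) hot hot' (hray t)
  exact ho' (this.symm.trans ho)

theorem rigid3 (p : ι → E3) (H0 : ∀ l : E3 →ₗ[ℝ] ℝ, l ≠ 0 → ∃ i, 0 < l (p i))
    (hexp : ∀ a, ∃ α : E3 →ₗ[ℝ] ℝ, ∀ j, j ≠ a → α (p j) < α (p a))
    (m : ι → E3) (hm : ∀ i j, (∃ l : E3 →ₗ[ℝ] ℝ, l ≠ 0 ∧ ∀ k, l (p k) ≤ l (p i) ∧ l (p k) ≤ l (p j)) →
      dt (m i - m j) (p i - p j) = 0) (i j : ι) : dt (m i - m j) (p i - p j) = 0 := by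
  obtain ⟨η, h1, h2, h3⟩ := exists_eta p
  have F : Fan p η := ⟨H0, h1, h2, h3⟩
  have hexp' : ∀ a, ∃ α : E3 →ₗ[ℝ] ℝ, α (p a) = 1 ∧ ∀ j, j ≠ a → α (p j) < 1 := by
    intro a
    obtain ⟨α, hα⟩ := hexp a
    have hj : ∃ j, j ≠ a := by
      have hne : (LinearMap.proj 0 : E3 →ₗ[ℝ] ℝ) ≠ 0 := by
        intro h; have := congrArg (fun f => f ![1, 0, 0]) h; simp at this
      obtain ⟨i, hi⟩ := H0 _ hne
      obtain ⟨j, hj⟩ := H0 _ (neg_ne_zero.2 hne)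
      by_contra hcon
      push Not at hcon
      rw [hcon i] at hi; rw [hcon j] at hj
      simp only [LinearMap.neg_apply, LinearMap.proj_apply] at hi hj
      linarith
    obtain ⟨j, hj⟩ := hj
    have hα0 : α ≠ 0 := by
      rintro rfl; have := hα j hj; simp at this
    obtain ⟨i, hi⟩ := H0 α hα0
    have hpos : 0 < α (p a) := by
      by_cases h : i = a
      · rwa [← h]
      · exact hi.trans (hα i h)
    refine ⟨(α (p a))⁻¹ • α, ?_, fun j hj => ?_⟩
    · rw [LinearMap.smul_apply, smul_eq_mul, inv_mul_cancel₀ hpos.ne']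
    · rw [LinearMap.smul_apply, smul_eq_mul, inv_mul_lt_iff₀ hpos, mul_one]; exact hα j hj
  have hp0 : ∀ i, p i ≠ 0 := by
    intro i h
    obtain ⟨α, h4, -⟩ := hexp' i
    rw [h, map_zero] at h4; exact zero_ne_one h4
  obtain ⟨w, hr, hf, hw⟩ := fan_w F hexp' m hm
  have hwe : ∀ o : OO p η, m o.1.2.1 - cr (w o) (p o.1.2.1) = m o.1.1 - cr (w o) (p o.1.1) := by
    intro o
    have := hw o
    rw [cr_sub, sub_eq_sub_iff_add_eq_add] at this
    rw [sub_eq_sub_iff_add_eq_add, ← this, add_comm]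
  let L : OO p η → E3 × E3 := fun o => (w o, m o.1.1 - cr (w o) (p o.1.1))
  have hLr : ∀ o, L (rotF o) = L o := by
    intro o
    have e := hwe o
    simp only [L, hr]
    exact Prod.ext rfl e
  have hLf : ∀ o, L (flipF F o) = L o := by
    intro o
    have e := hwe o
    simp only [L, hf]
    exact Prod.ext rfl e
  have hmem : ∀ i, ∃ o : OO p η, o.1.1 = i := by
    intro i
    obtain ⟨a, b, c, hT, hC⟩ := coverC F (p i)
    by_cases ha : i = a
    · exact ⟨⟨(a, b, c), hT⟩, ha.symm⟩
    by_cases hb : i = b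
    · exact ⟨⟨(b, c, a), TT_rot hT⟩, hb.symm⟩
    by_cases hc : i = c
    · exact ⟨⟨(c, a, b), TT_rot (TT_rot hT)⟩, hc.symm⟩
    exfalso
    obtain ⟨α, h4, h5⟩ := hexp' i
    have e1 := lin_cramer (p a) (p b) (p c) (p i) α
    have e2 := lin_cramer (p a) (p b) (p c) (p i) (nuX p (fun _ => 1) a b c)
    obtain ⟨g1, g2, g3⟩ := oneval hT
    rw [g1, g2, g3] at e2
    rw [h4] at e1
    have hle := F.one a b c hT i
    have hd := hT.1
    have u1 := h5 a (Ne.symm ha); have u2 := h5 b (Ne.symm hb); have u3 := h5 c (Ne.symm hc)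
    obtain ⟨c1, c2, c3⟩ := hC
    have k2 := mul_le_mul_of_nonneg_left hle hd.le
    have k3 := mul_le_mul_of_nonneg_left u1.le c1
    have k4 := mul_le_mul_of_nonneg_left u2.le c2
    have k5 := mul_le_mul_of_nonneg_left u3.le c3
    have z1 : D3 (p b) (p c) (p i) * (1 - α (p a)) = 0 := le_antisymm (by linarith) (mul_nonneg c1 (by linarith))
    have z2 : D3 (p c) (p a) (p i) * (1 - α (p b)) = 0 := le_antisymm (by linarith) (mul_nonneg c2 (by linarith))
    have z3 : D3 (p a) (p b) (p i) * (1 - α (p c)) = 0 := le_antisymm (by linarith) (mul_nonneg c3 (by linarith))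
    have y1 := (mul_eq_zero.1 z1).resolve_right (by linarith)
    have y2 := (mul_eq_zero.1 z2).resolve_right (by linarith)
    have y3 := (mul_eq_zero.1 z3).resolve_right (by linarith)
    rw [y1, y2, y3] at e1
    linarith
  obtain ⟨o, rfl⟩ := hmem i
  obtain ⟨o', rfl⟩ := hmem j
  have hL := label_const F hp0 L hLr hLf o o'
  obtain ⟨e1, e2⟩ := Prod.ext_iff.1 hL
  simp only [L] at e1 e2
  rw [← e1] at e2
  have e3 : m o.1.1 - m o'.1.1 = cr (w o) (p o.1.1 - p o'.1.1) := by
    rw [cr_sub]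
    rw [sub_eq_sub_iff_add_eq_add] at e2 ⊢
    rw [e2]; abel
  rw [e3]
  simp only [dt, cr0, cr1, cr2]; ring

end PartD6

section PartE

lemma stiemke {V : Type*} [AddCommGroup V] [Module ℝ V] (A : Finset V) (z : V) :
    (∃ w : V → ℝ, (∀ v ∈ A, 0 < w v) ∧ ∑ v ∈ A, w v • (v - z) = 0) ∨
    ∃ l : V →ₗ[ℝ] ℝ, (∀ v ∈ A, l v ≤ l z) ∧ ∃ v ∈ A, l v < l z := by
  rw [or_iff_not_imp_left]
  intro hno
  let Φ : (A → ℝ) →ₗ[ℝ] V := ∑ v : A, (LinearMap.proj v).smulRight (v.1 - z)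
  have hΦ : ∀ w, Φ w = ∑ v : A, w v • (v.1 - z) := fun w => by simp [Φ]
  let s : Set (A → ℝ) := Set.pi Set.univ (fun _ => Set.Ioi 0)
  have hs1 : Convex ℝ s := convex_pi (fun _ _ => convex_Ioi 0)
  have hs2 : IsOpen s := isOpen_set_pi Set.finite_univ (fun _ _ => isOpen_Ioi)
  have hdis : Disjoint s (LinearMap.ker Φ : Set (A → ℝ)) := by
    rw [Set.disjoint_left]
    intro w hw hk
    apply hno
    refine ⟨fun v => if h : v ∈ A then w ⟨v, h⟩ else 0, fun v hv => ?_, ?_⟩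
    · simp only [hv, dite_true]; exact hw ⟨v, hv⟩ (Set.mem_univ _)
    · rw [← Finset.sum_coe_sort A]
      have : Φ w = 0 := hk
      rw [hΦ] at this
      rw [← this]
      exact sum_congr rfl (fun v _ => by simp)
  obtain ⟨f, u, h1, h2⟩ := geometric_hahn_banach_open hs1 hs2 (LinearMap.ker Φ).convex hdis
  have hu : u ≤ 0 := by simpa using h2 0 (LinearMap.ker Φ).zero_mem
  have hf0 : ∀ b ∈ LinearMap.ker Φ, f b = 0 := by
    intro b hb
    by_contra h
    have := h2 (((u - 1) / f b) • b) ((LinearMap.ker Φ).smul_mem _ hb)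
    rw [map_smul, smul_eq_mul, div_mul_cancel₀ _ h] at this
    linarith
  have hone : f (fun _ => 1) < 0 := lt_of_lt_of_le (h1 _ (fun _ _ => by simp)) hu
  have hsing : ∀ v : A, f (Pi.single v 1) ≤ 0 := by
    intro v
    by_contra! h
    have := h1 ((-f (fun _ => 1) / f (Pi.single v 1)) • Pi.single v 1 + (fun _ => 1)) (by
      intro j _
      have h3 : 0 ≤ -f (fun _ => 1) / f (Pi.single v 1) := div_nonneg (by linarith) h.le
      have h4 : (0:ℝ) ≤ (Pi.single v 1 : A → ℝ) j := by
        by_cases hj : j = v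
        · subst hj; simp
        · simp [hj]
      simp only [Pi.add_apply, Pi.smul_apply, smul_eq_mul, Set.mem_Ioi]
      have := mul_nonneg h3 h4
      linarith)
    rw [map_add, map_smul, smul_eq_mul, div_mul_cancel₀ _ h.ne'] at this
    linarith
  have hmem : (f : (A → ℝ) →ₗ[ℝ] ℝ) ∈ LinearMap.range Φ.dualMap := by
    rw [LinearMap.range_dualMap_eq_dualAnnihilator_ker, Submodule.mem_dualAnnihilator]
    exact hf0
  obtain ⟨l, hl⟩ := hmem
  have hlv : ∀ v : A, f (Pi.single v 1) = l v.1 - l z := by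
    intro v
    have := congrArg (fun g => g (Pi.single v 1)) hl
    simp only [LinearMap.dualMap_apply] at this
    rw [hΦ] at this
    simp only [Pi.single_apply, ite_smul, one_smul, zero_smul, Finset.sum_ite_eq',
      mem_univ, if_true, map_sub] at this
    exact this.symm
  refine ⟨l, fun v hv => ?_, ?_⟩
  · have := hsing ⟨v, hv⟩; rw [hlv] at this; simpa using this
  · by_contra! hcon
    have : f (fun _ => 1) = ∑ v : A, f (Pi.single v 1) := by
      rw [← map_sum]; congr 1
      ext j; simp [Finset.sum_apply, Pi.single_apply]
    rw [this] at hone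
    refine absurd hone (not_lt.2 (sum_nonneg (fun v _ => ?_)))
    rw [hlv]; linarith [hcon v.1 v.2]

lemma exposed_of_not_mem {V : Type*} [NormedAddCommGroup V] [NormedSpace ℝ V] [FiniteDimensional ℝ V]
    (X : Finset V) (a : V) (ha : a ∉ convexHull ℝ ((X : Set V) \ {a})) :
    ∃ l : V →ₗ[ℝ] ℝ, ∀ x ∈ X, x ≠ a → l x < l a := by
  obtain ⟨f, u, h1, h2⟩ := geometric_hahn_banach_closed_point (convex_convexHull ℝ _)
    ((X.finite_toSet.subset Set.sdiff_subset).isClosed_convexHull ℝ) ha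
  exact ⟨f, fun x hx hne => (h1 x (subset_convexHull ℝ _ ⟨hx, hne⟩)).trans h2⟩

lemma exists_sub3 {V : Type*} [AddCommGroup V] [Module ℝ V] [FiniteDimensional ℝ V]
    (W U : Submodule ℝ V) (hUW : U ≤ W) (k : ℕ) (h1 : Module.finrank ℝ U ≤ k)
    (h2 : k ≤ Module.finrank ℝ W) : ∃ U', U ≤ U' ∧ U' ≤ W ∧ Module.finrank ℝ U' = k := by
  induction k, h1 using Nat.le_induction with
  | base => exact ⟨U, le_rfl, hUW, rfl⟩
  | succ k hk ih =>
    obtain ⟨U', a, b, c⟩ := ih (by omega)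
    have hne : ¬ W ≤ U' := fun h => by
      have := Submodule.finrank_mono h; omega
    obtain ⟨x, hx, hxU⟩ := SetLike.not_le_iff_exists.1 hne
    refine ⟨U' ⊔ ℝ ∙ x, a.trans le_sup_left, sup_le b ?_, ?_⟩
    · rw [Submodule.span_singleton_le_iff_mem]; exact hx
    · rw [Submodule.finrank_sup_span_singleton hxU, c]

end PartE

section PartE2

variable {V : Type*} [AddCommGroup V] [Module ℝ V]

lemma push_mem (A : Finset V) (w c : V → ℝ) (h0 : ∀ v ∈ A, 0 ≤ w v) (h : ∀ v ∈ A, w v = 0 → 0 ≤ c v)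
    (hw : ∑ v ∈ A, w v = 1) (hc : ∑ v ∈ A, c v = 0) :
    ∃ ε : ℝ, 0 < ε ∧ ∑ v ∈ A, w v • v + ε • ∑ v ∈ A, c v • v ∈ cv A := by
  obtain ⟨ε, he, h1⟩ := perturb ((A.filter (fun v => w v ≠ 0)).image
    (fun v => (LinearMap.proj v : (V → ℝ) →ₗ[ℝ] ℝ))) w c (by
      intro g hg
      obtain ⟨v, hv, rfl⟩ := mem_image.1 hg
      have hv' := mem_filter.1 hv
      exact lt_of_le_of_ne (h0 v hv'.1) (Ne.symm hv'.2))
  refine ⟨ε, he, Finset.mem_convexHull'.2 ⟨fun v => w v + ε * c v, fun v hv => ?_, ?_, ?_⟩⟩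
  · by_cases hwv : w v = 0
    · simp only [hwv, zero_add]; exact mul_nonneg he.le (h v hv hwv)
    · exact (h1 (LinearMap.proj v) (mem_image.2 ⟨v, mem_filter.2 ⟨hv, hwv⟩, rfl⟩)).le
  · rw [sum_add_distrib, ← mul_sum, hw, hc]; simp
  · simp only [add_smul, mul_smul, sum_add_distrib, smul_sum]

lemma rep_exposed {M : Type*} [AddCommGroup M] [Module ℝ M] {A : Finset V} {w : V → ℝ}
    (h0 : ∀ v ∈ A, 0 ≤ w v) (h1 : ∑ v ∈ A, w v = 1) {u : V} (hu : u ∈ A) (α : V →ₗ[ℝ] ℝ)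
    (hα : ∀ v ∈ A, v ≠ u → α v < α u) (hx : α u ≤ α (∑ v ∈ A, w v • v)) (f : V → M) :
    ∑ v ∈ A, w v • f v = f u := by
  have hz : ∀ v ∈ A, v ≠ u → w v = 0 := by
    intro v hv hne
    by_contra hw
    have := weight_top h0 h1 (fun y hy => ?_) hx v hv hw
    · exact (hα v hv hne).ne this
    · by_cases hy' : y = u
      · rw [hy']
      · exact (hα y hy hy').le
  have hwu : w u = 1 := by
    rw [← h1]; exact (sum_eq_single_of_mem u hu (fun v hv hne => hz v hv hne)).symm
  rw [sum_eq_single_of_mem u hu (fun v hv hne => by rw [hz v hv hne, zero_smul]), hwu, one_smul]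

lemma vspan_rep (A : Finset V) (y : V) (hy : y ∈ vectorSpan ℝ (A : Set V)) :
    ∃ c : V → ℝ, ∑ v ∈ A, c v = 0 ∧ ∑ v ∈ A, c v • v = y := by
  rw [vectorSpan_def] at hy
  induction hy using Submodule.span_induction with
  | mem x hx =>
    obtain ⟨a, ha, b, hb, rfl⟩ := hx
    have ha' : a ∈ A := ha
    have hb' : b ∈ A := hb
    refine ⟨fun v => (if v = a then 1 else 0) - (if v = b then 1 else 0), ?_, ?_⟩
    · simp [sum_sub_distrib, ha', hb']
    · simp [sub_smul, sum_sub_distrib, ha', hb', ite_smul]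
  | zero => exact ⟨0, by simp, by simp⟩
  | add x y _ _ hx hy =>
    obtain ⟨c, h1, h2⟩ := hx
    obtain ⟨c', h1', h2'⟩ := hy
    exact ⟨c + c', by simp [sum_add_distrib, h1, h1'],
      by simp [add_smul, sum_add_distrib, h2, h2']⟩
  | smul r x _ hx =>
    obtain ⟨c, h1, h2⟩ := hx
    exact ⟨r • c, by simp [← mul_sum, h1], by simp [mul_smul, ← smul_sum, h2]⟩

lemma pair_identity {d : ℕ} (A : Finset (Fin d → ℝ)) (a : (Fin d → ℝ) → ℝ) (ha : ∑ v ∈ A, a v = 0)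
    (m : (Fin d → ℝ) → (Fin d → ℝ))
    (h : ∀ u ∈ A, ∀ w ∈ A, a u ≠ 0 → a w ≠ 0 → (m u - m w) ⬝ᵥ (u - w) = 0) :
    (∑ v ∈ A, a v • m v) ⬝ᵥ (∑ v ∈ A, a v • v) = 0 := by
  have h1 : ∑ u ∈ A, ∑ w ∈ A, a u * a w * ((m u - m w) ⬝ᵥ (u - w)) = 0 := by
    refine sum_eq_zero fun u hu => sum_eq_zero fun w hw => ?_
    by_cases h1 : a u = 0
    · simp [h1]
    by_cases h2 : a w = 0
    · simp [h2]
    rw [h u hu w hw h1 h2, mul_zero]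
  have h2 : (∑ v ∈ A, a v • m v) ⬝ᵥ (∑ v ∈ A, a v • v) = ∑ u ∈ A, ∑ w ∈ A, a u * a w * (m u ⬝ᵥ w) := by
    rw [sum_dotProduct]
    refine sum_congr rfl fun u _ => ?_
    rw [dotProduct_sum]
    refine sum_congr rfl fun w _ => ?_
    rw [smul_dotProduct, dotProduct_smul, smul_eq_mul, smul_eq_mul, mul_assoc]
  have h3 : ∑ u ∈ A, ∑ w ∈ A, a u * a w * (m w ⬝ᵥ u) = ∑ u ∈ A, ∑ w ∈ A, a u * a w * (m u ⬝ᵥ w) := by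
    rw [sum_comm]
    exact sum_congr rfl fun u _ => sum_congr rfl fun w _ => by ring
  have h4 : ∑ u ∈ A, ∑ w ∈ A, a u * a w * (m u ⬝ᵥ u) = 0 := by
    refine sum_eq_zero fun u _ => ?_
    have : ∀ w, a u * a w * (m u ⬝ᵥ u) = (a u * (m u ⬝ᵥ u)) * a w := fun w => by ring
    simp only [this]; rw [← mul_sum, ha, mul_zero]
  have h5 : ∑ u ∈ A, ∑ w ∈ A, a u * a w * (m w ⬝ᵥ w) = 0 := by
    rw [sum_comm, ← h4]
    exact sum_congr rfl fun u _ => sum_congr rfl fun w _ => by ring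
  have h6 : ∑ u ∈ A, ∑ w ∈ A, a u * a w * ((m u - m w) ⬝ᵥ (u - w)) =
      ∑ u ∈ A, ∑ w ∈ A, a u * a w * (m u ⬝ᵥ u) - ∑ u ∈ A, ∑ w ∈ A, a u * a w * (m u ⬝ᵥ w)
      - ∑ u ∈ A, ∑ w ∈ A, a u * a w * (m w ⬝ᵥ u) + ∑ u ∈ A, ∑ w ∈ A, a u * a w * (m w ⬝ᵥ w) := by
    simp only [← sum_sub_distrib, ← sum_add_distrib]
    refine sum_congr rfl fun u _ => sum_congr rfl fun w _ => ?_
    rw [sub_dotProduct, dotProduct_sub, dotProduct_sub]; ring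
  rw [h2]
  linarith

end PartE2

section PartE3

theorem stepE {d : ℕ} (A : Finset (Fin d → ℝ)) (hrk : 4 ≤ rk A)
    (hex : ∀ u ∈ A, ∃ α : (Fin d → ℝ) →ₗ[ℝ] ℝ, ∀ v ∈ A, v ≠ u → α v < α u)
    (m : (Fin d → ℝ) → (Fin d → ℝ))
    (hm : ∀ u ∈ A, ∀ w ∈ A, ∀ D ∈ fs A, D ≠ A → u ∈ D → w ∈ D → (m u - m w) ⬝ᵥ (u - w) = 0)
    (u w : Fin d → ℝ) (hu : u ∈ A) (hw : w ∈ A) : (m u - m w) ⬝ᵥ (u - w) = 0 := by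
  have hne : A ≠ ∅ := by rintro rfl; simp at hu
  have hcard : (0:ℝ) < A.card := by exact_mod_cast Finset.card_pos.2 ⟨u, hu⟩
  set n : ℝ := (A.card : ℝ) with hn
  have hsum1 : ∑ v ∈ A, n⁻¹ = 1 := by
    rw [Finset.sum_const, nsmul_eq_mul, mul_inv_cancel₀ hcard.ne']
  let x0 : Fin d → ℝ := ∑ v ∈ A, n⁻¹ • v
  let W := vectorSpan ℝ (A : Set (Fin d → ℝ))
  have hW3 : 3 ≤ Module.finrank ℝ W := by
    have : rk A = Module.finrank ℝ W + 1 := by unfold rk; rw [if_neg hne]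
    omega
  have hxW : ∀ y ∈ A, y - x0 ∈ W := by
    intro y hy
    have : y - x0 = ∑ v ∈ A, n⁻¹ • (y - v) := by
      simp only [smul_sub, sum_sub_distrib, x0, ← Finset.sum_smul, hsum1, one_smul]
    rw [this]
    exact W.sum_mem fun v hv => W.smul_mem _ (vsub_mem_vectorSpan ℝ hy hv)
  obtain ⟨U, hU1, hU2, hU3⟩ := exists_sub3 W
    (Submodule.span ℝ (({u - x0, w - x0} : Finset (Fin d → ℝ)) : Set (Fin d → ℝ)))
    (by rw [Submodule.span_le]; intro y hy
        simp only [Finset.coe_insert, Finset.coe_singleton, Set.mem_insert_iff,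
          Set.mem_singleton_iff] at hy
        rcases hy with rfl | rfl
        · exact hxW u hu
        · exact hxW w hw) 3
    ((finrank_span_finset_le_card _).trans (Finset.card_le_two.trans (by norm_num))) hW3
  have huU : u - x0 ∈ U := hU1 (Submodule.subset_span (by simp))
  have hwU : w - x0 ∈ U := hU1 (Submodule.subset_span (by simp))
  let e : E3 ≃ₗ[ℝ] U := LinearEquiv.ofFinrankEq _ _ (by rw [hU3]; simp)
  let B : E3 →ₗ[ℝ] (Fin d → ℝ) := U.subtype ∘ₗ e.toLinearMap
  have hBinj : Function.Injective B := by
    intro s t h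
    exact e.injective (Subtype.ext h)
  have hBW : ∀ s, B s ∈ W := fun s => hU2 (e s).2
  let Q : Set E3 := {s | x0 + B s ∈ cv A}
  have hQdef : ∀ s, s ∈ Q ↔ x0 + B s ∈ cv A := fun s => Iff.rfl
  have hQconv : Convex ℝ Q :=
    ((convex_convexHull ℝ (A : Set (Fin d → ℝ))).translate_preimage_right x0).linear_preimage B
  have hQcomp : IsCompact Q := by
    have h1 : IsCompact ((Homeomorph.addLeft x0) ⁻¹' (cv A)) :=
      (Homeomorph.addLeft x0).isCompact_preimage.2 (A.finite_toSet.isCompact_convexHull ℝ)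
    exact (LinearMap.isClosedEmbedding_of_injective (LinearMap.ker_eq_bot.2 hBinj)).isCompact_preimage h1
  have hrep : ∀ s, s ∈ Q → ∃ c : (Fin d → ℝ) → ℝ, (∀ v ∈ A, 0 ≤ c v) ∧ ∑ v ∈ A, c v = 1 ∧
      ∑ v ∈ A, c v • v = x0 + B s := fun s hs => Finset.mem_convexHull'.1 ((hQdef s).1 hs)
  choose! L hL0 hL1 hL2 using hrep
  have hfin : (Q.extremePoints ℝ).Finite := by
    refine Set.Finite.of_injOn (f := fun s => A.filter (fun v => L s v ≠ 0))
      (t := (A.powerset : Set (Finset (Fin d → ℝ))))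
      (fun s _ => mem_coe.2 (Finset.mem_powerset.2 (Finset.filter_subset _ _))) ?_
      (Finset.finite_toSet _)
    intro s hs s' hs' heq
    have hsQ := hs.1
    have hsQ' := hs'.1
    have hsupp : ∀ v ∈ A, L s v = 0 → L s' v = 0 := by
      intro v hv h0
      by_contra h
      have : v ∈ A.filter (fun v => L s' v ≠ 0) := mem_filter.2 ⟨hv, h⟩
      have heq' : A.filter (fun v => L s v ≠ 0) = A.filter (fun v => L s' v ≠ 0) := heq
      rw [← heq'] at this
      exact (mem_filter.1 this).2 h0
    obtain ⟨ε, he, hmem⟩ := push_mem A (L s) (fun v => L s v - L s' v) (hL0 s hsQ)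
      (fun v hv h => by simp [h, hsupp v hv h]) (hL1 s hsQ)
      (by rw [sum_sub_distrib, hL1 s hsQ, hL1 s' hsQ', sub_self])
    simp only [sub_smul, sum_sub_distrib] at hmem
    rw [hL2 s hsQ, hL2 s' hsQ'] at hmem
    have hq : s + ε • (s - s') ∈ Q := by
      rw [hQdef, map_add, map_smul, map_sub]
      convert hmem using 1
      module
    have := (mem_extremePoints.1 hs).2 _ hq s' hsQ' (by
      have h1 : (0:ℝ) < 1 + ε := by linarith
      refine ⟨1 / (1 + ε), ε / (1 + ε), by positivity, by positivity, by field_simp, ?_⟩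
      have : (1 / (1 + ε)) • (s + ε • (s - s')) + (ε / (1 + ε)) • s' =
        ((1 + ε) / (1 + ε)) • s := by
          module
      rw [this, div_self h1.ne', one_smul])
    exact this.2.symm
  let X : Finset E3 := hfin.toFinset
  have hX : ∀ s, s ∈ X ↔ s ∈ Q.extremePoints ℝ := fun s => hfin.mem_toFinset
  have hQX : Q = cv X := by
    have h1 := closure_convexHull_extremePoints hQcomp hQconv
    have h2 : (X : Set E3) = Q.extremePoints ℝ := hfin.coe_toFinset
    rw [← h2, (X.finite_toSet.isClosed_convexHull ℝ).closure_eq] at h1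
    exact h1.symm
  have hXQ : ∀ s ∈ X, s ∈ Q := fun s hs => ((hX s).1 hs).1
  let mt : E3 → (Fin d → ℝ) := fun s => ∑ v ∈ A, L s v • m v
  let m' : E3 → E3 := fun s i => mt s ⬝ᵥ B (Pi.single i 1)
  have hm' : ∀ s t y, dt (m' s - m' t) y = (mt s - mt t) ⬝ᵥ B y := by
    intro s t y
    have : B y = y 0 • B (Pi.single 0 1) + y 1 • B (Pi.single 1 1) + y 2 • B (Pi.single 2 1) := by
      rw [← map_smul, ← map_smul, ← map_smul, ← map_add, ← map_add]
      congr 1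
      exact e3_ext (by simp) (by simp) (by simp)
    rw [this]
    simp only [dotProduct_add, dotProduct_smul, sub_dotProduct, dt, m', Pi.sub_apply, smul_eq_mul]
    ring
  have H0 : ∀ l : E3 →ₗ[ℝ] ℝ, l ≠ 0 → ∃ i : X, 0 < l i.1 := by
    intro l hl
    obtain ⟨s, hs⟩ : ∃ s, 0 < l s := by
      by_contra! hcon
      apply hl
      ext1 s
      ext
      have h1 := hcon (LinearMap.single ℝ (fun _ => ℝ) s 1)
      have h2 := hcon (-(LinearMap.single ℝ (fun _ => ℝ) s 1))
      rw [map_neg] at h2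
      simp at h1 h2 ⊢
      linarith
    obtain ⟨c, hc1, hc2⟩ := vspan_rep A (B s) (hBW s)
    obtain ⟨ε, he, hmem⟩ := push_mem A (fun _ => n⁻¹) c (fun _ _ => (inv_pos.2 hcard).le)
      (fun v _ h => absurd h (inv_pos.2 hcard).ne') hsum1 hc1
    rw [hc2] at hmem
    have hq : ε • s ∈ Q := by rw [hQdef, map_smul]; exact hmem
    by_contra! hcon
    rw [hQX] at hq
    have := cv_le (fun y hy => hcon ⟨y, hy⟩) hq
    rw [map_smul, smul_eq_mul] at this
    exact absurd this (not_le.2 (mul_pos he hs))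
  have key : ∀ i j : X, dt (m' i.1 - m' j.1) (i.1 - j.1) = 0 := by
    refine rigid3 (fun i : X => i.1) H0 ?_ (fun i => m' i.1) ?_
    · intro a
      obtain ⟨α, hα⟩ := exposed_of_not_mem X a.1 (by
        have h1 := (hQconv.mem_extremePoints_iff_mem_sdiff_convexHull_sdiff.1 ((hX _).1 a.2)).2
        intro h
        apply h1
        refine convexHull_mono ?_ h
        intro y hy
        exact ⟨hXQ y hy.1, hy.2⟩)
      exact ⟨α, fun j hj => hα j.1 j.2 (fun h => hj (Subtype.ext h))⟩
    · rintro i j ⟨l, hl, hmax⟩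
      have hiQ := hXQ _ i.2
      have hjQ := hXQ _ j.2
      have hij : l i.1 = l j.1 := le_antisymm (hmax i).2 (hmax j).1
      obtain ⟨k, hk⟩ := H0 l hl
      have hpos : 0 < l i.1 := hk.trans_le (hmax k).1
      have hQl : ∀ t ∈ Q, l t ≤ l i.1 := by
        intro t ht
        rw [hQX] at ht
        exact cv_le (fun y hy => (hmax ⟨y, hy⟩).1) ht
      let s0 : E3 := (1/2 : ℝ) • (i.1 + j.1)
      have hrepz : ∑ v ∈ A, ((1/2:ℝ) * (L i.1 v + L j.1 v)) • v = x0 + B s0 := by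
        have : ∀ v, ((1/2:ℝ) * (L i.1 v + L j.1 v)) • v = (1/2:ℝ) • (L i.1 v • v + L j.1 v • v) :=
          fun v => by module
        simp only [this, ← smul_sum, sum_add_distrib]
        rw [hL2 _ hiQ, hL2 _ hjQ, map_smul, map_add]
        module
      have hD : ∃ D ∈ fs A, D ≠ A ∧ ∀ v ∈ A, (L i.1 v ≠ 0 ∨ L j.1 v ≠ 0) → v ∈ D := by
        rcases stiemke A (x0 + B s0) with ⟨c, hc0, hc1⟩ | ⟨l', hl1, v1, hv1, hl2⟩
        · exfalso
          have hcs : 0 < ∑ v ∈ A, c v := Finset.sum_pos hc0 ⟨u, hu⟩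
          set S := ∑ v ∈ A, c v
          have hz : ∑ v ∈ A, (c v / S) • v = x0 + B s0 := by
            simp only [smul_sub, sum_sub_distrib, ← Finset.sum_smul] at hc1
            have : ∀ v, (c v / S) • v = S⁻¹ • (c v • v) := fun v => by
              rw [smul_smul, div_eq_inv_mul]
            simp only [this, ← smul_sum]
            rw [sub_eq_zero.1 hc1, smul_smul, inv_mul_cancel₀ hcs.ne', one_smul]
          have hs1 : ∑ v ∈ A, c v / S = 1 := by rw [← Finset.sum_div]; exact div_self hcs.ne'
          obtain ⟨ε, he, hmem⟩ := push_mem A (fun v => c v / S) (fun v => c v / S - n⁻¹)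
            (fun v hv => (div_pos (hc0 v hv) hcs).le)
            (fun v hv h => absurd h (div_pos (hc0 v hv) hcs).ne') hs1
            (by rw [sum_sub_distrib, hs1, hsum1, sub_self])
          simp only [sub_smul, sum_sub_distrib] at hmem
          rw [hz] at hmem
          have hq : (1 + ε) • s0 ∈ Q := by
            rw [hQdef, map_smul]
            convert hmem using 1
            change x0 + (1 + ε) • B s0 = x0 + B s0 + ε • (x0 + B s0 - x0)
            module
          have := hQl _ hq
          simp only [s0, map_smul, map_add, smul_eq_mul] at this
          rw [← hij] at this
          nlinarith
        · have hwt := weight_top (A := A) (l := l') (w := fun v => (1/2:ℝ) * (L i.1 v + L j.1 v))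
            (c := l' (x0 + B s0))
            (fun v hv => mul_nonneg (by norm_num) (add_nonneg (hL0 _ hiQ v hv) (hL0 _ hjQ v hv)))
            (by rw [← mul_sum, sum_add_distrib, hL1 _ hiQ, hL1 _ hjQ]; norm_num)
            hl1 (by rw [hrepz])
          have hwt' : ∀ v ∈ A, (L i.1 v ≠ 0 ∨ L j.1 v ≠ 0) → l' v = l' (x0 + B s0) := by
            intro v hv h
            refine hwt v hv ?_
            have a1 := hL0 _ hiQ v hv
            have a2 := hL0 _ hjQ v hv
            rcases h with h | h
            · have := lt_of_le_of_ne a1 (Ne.symm h); positivity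
            · have := lt_of_le_of_ne a2 (Ne.symm h); positivity
          refine ⟨topS A l', topS_mem_fs A l', fun h => ?_, fun v hv h => ?_⟩
          · obtain ⟨v0, hv0, hne0⟩ : ∃ v ∈ A, L i.1 v ≠ 0 := by
              apply Finset.exists_ne_zero_of_sum_ne_zero
              rw [hL1 _ hiQ]; exact one_ne_zero
            rw [← h] at hv1
            have := (mem_topS.1 hv1).2 v0 hv0
            rw [hwt' v0 hv0 (Or.inl hne0)] at this
            exact absurd this (not_le.2 hl2)
          · refine mem_topS.2 ⟨hv, fun y hy => ?_⟩
            rw [hwt' v hv h]; exact hl1 y hy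
      obtain ⟨D, hDA, hDne, hDs⟩ := hD
      rw [hm']
      have hpi := pair_identity A (fun v => L i.1 v - L j.1 v)
        (by rw [sum_sub_distrib, hL1 _ hiQ, hL1 _ hjQ, sub_self]) m (by
          have hor : ∀ x, L i.1 x - L j.1 x ≠ 0 → (L i.1 x ≠ 0 ∨ L j.1 x ≠ 0) := by
            intro x hx
            by_contra! hcon
            rw [hcon.1, hcon.2, sub_self] at hx; exact hx rfl
          intro x hx y hy h1 h2
          exact hm x hx y hy D hDA hDne (hDs x hx (hor x h1)) (hDs y hy (hor y h2)))
      simp only [sub_smul, sum_sub_distrib] at hpi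
      rw [hL2 _ hiQ, hL2 _ hjQ] at hpi
      rw [map_sub]
      have : x0 + B i.1 - (x0 + B j.1) = B i.1 - B j.1 := by abel
      rw [this] at hpi
      exact hpi
  have hpt : ∀ y ∈ A, ∀ hy : y - x0 ∈ U, e.symm ⟨y - x0, hy⟩ ∈ X ∧ mt (e.symm ⟨y - x0, hy⟩) = m y ∧
      B (e.symm ⟨y - x0, hy⟩) = y - x0 := by
    intro y hyA hy
    have hB : B (e.symm ⟨y - x0, hy⟩) = y - x0 := by simp [B]
    set s := e.symm ⟨y - x0, hy⟩
    have hΦ : x0 + B s = y := by rw [hB]; abel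
    have hsQ : s ∈ Q := by rw [hQdef, hΦ]; exact subset_convexHull ℝ _ hyA
    obtain ⟨α, hα⟩ := hex y hyA
    have hαle : ∀ x ∈ A, α x ≤ α y := by
      intro x hx
      by_cases h : x = y
      · rw [h]
      · exact (hα x hx h).le
    refine ⟨?_, ?_, hB⟩
    · rw [hX, mem_extremePoints_iff_left]
      refine ⟨hsQ, fun s1 h1 s2 h2 h => ?_⟩
      obtain ⟨a, b, ha, hb, hab, hs⟩ := h
      have e1 := cv_le hαle ((hQdef s1).1 h1)
      have e2 := cv_le hαle ((hQdef s2).1 h2)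
      have e3 : a * α (x0 + B s1) + b * α (x0 + B s2) = α y := by
        rw [← hΦ, ← hs]
        have : x0 + B (a • s1 + b • s2) = a • (x0 + B s1) + b • (x0 + B s2) := by
          rw [map_add, map_smul, map_smul]
          have : x0 = (a + b) • x0 := by rw [hab, one_smul]
          nth_rewrite 1 [this]
          module
        rw [this]; simp; ring
      have e4 : α y ≤ α (x0 + B s1) := by
        have : b = 1 - a := by linarith
        subst this
        by_contra! hlt
        have k1 := mul_lt_mul_of_pos_left hlt ha
        have k2 := mul_le_mul_of_nonneg_left e2 hb.le
        nlinarith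
      have e5 := rep_exposed (hL0 s1 h1) (hL1 s1 h1) hyA α hα (by rw [hL2 s1 h1]; exact e4) id
      simp only [id] at e5
      rw [hL2 s1 h1] at e5
      apply hBinj
      rw [hB, ← e5]; abel
    · exact rep_exposed (hL0 s hsQ) (hL1 s hsQ) hyA α hα (by rw [hL2 s hsQ, hΦ]) m
  obtain ⟨u1, u2, u3⟩ := hpt u hu huU
  obtain ⟨w1, w2, w3⟩ := hpt w hw hwU
  have := key ⟨_, u1⟩ ⟨_, w1⟩
  rw [hm', map_sub, u2, w2, u3, w3] at this
  simpa using this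

end PartE3

section PartF1
variable {V : Type*} [NormedAddCommGroup V] [NormedSpace ℝ V]

structure Pl (A : Finset V) (φ : V →ᵃ[ℝ] E3) : Prop where
  one : ∀ x, φ x 0 = 1
  inj : ∀ x ∈ affineSpan ℝ (A : Set V), ∀ y ∈ affineSpan ℝ (A : Set V), φ x = φ y → x = y

lemma Pl.exists_pl {A : Finset V} (h : rk A = 3) : ∃ φ, Pl A φ := by
  have hA : A ≠ ∅ := by rintro rfl; simp [rk_empty] at h
  have h2 : Module.finrank ℝ (vectorSpan ℝ (A : Set V)) = 2 := by
    simp only [rk, if_neg hA] at h; omega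
  have : FiniteDimensional ℝ (vectorSpan ℝ (A : Set V)) :=
    Module.finite_of_finrank_pos (by omega)
  let e : vectorSpan ℝ (A : Set V) ≃ₗ[ℝ] (Fin 2 → ℝ) :=
    LinearEquiv.ofFinrankEq _ _ (by simp [h2])
  obtain ⟨g, hg⟩ := LinearMap.exists_extend (e : vectorSpan ℝ (A : Set V) →ₗ[ℝ] (Fin 2 → ℝ))
  let L : V →ₗ[ℝ] E3 := LinearMap.pi ![0, (LinearMap.proj 0).comp g, (LinearMap.proj 1).comp g]
  refine ⟨L.toAffineMap + AffineMap.const ℝ V ![1, 0, 0], fun x => ?_, fun x hx y hy hxy => ?_⟩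
  · simp [L]
  · have hL : L x = L y := add_right_cancel (show L x + ![1, 0, 0] = L y + ![1, 0, 0] from hxy)
    have h1 := congrFun hL 1
    have h2 := congrFun hL 2
    simp [L] at h1 h2
    have hgx : g (x - y) = 0 := by
      rw [map_sub, sub_eq_zero]; ext i; fin_cases i
      · exact h1
      · exact h2
    have hm : x - y ∈ vectorSpan ℝ (A : Set V) := by
      rw [← direction_affineSpan]; exact AffineSubspace.vsub_mem_direction hx hy
    have h3 : e ⟨x - y, hm⟩ = 0 := by
      rw [← hgx]; exact (LinearMap.congr_fun hg ⟨x - y, hm⟩).symm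
    have h4 := (LinearEquiv.map_eq_zero_iff e).1 h3
    exact sub_eq_zero.1 (congrArg Subtype.val h4)

abbrev orr (φ : V →ᵃ[ℝ] E3) (u v x : V) : ℝ := D3 (φ u) (φ v) (φ x)

noncomputable def orA (φ : V →ᵃ[ℝ] E3) (u v : V) : V →ᵃ[ℝ] ℝ := (Dl (φ u) (φ v)).toAffineMap.comp φ

lemma orA_apply (φ : V →ᵃ[ℝ] E3) (u v x : V) : orA φ u v x = orr φ u v x := rfl

lemma orA_lin (φ : V →ᵃ[ℝ] E3) (u v x y : V) :
    (orA φ u v).linear x - (orA φ u v).linear y = orr φ u v x - orr φ u v y := by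
  rw [← map_sub, ← vsub_eq_sub x y, AffineMap.linearMap_vsub]; rfl

lemma aff3 {M : Type*} [AddCommGroup M] [Module ℝ M] (f : V →ᵃ[ℝ] M) (u v w : V) (a b c : ℝ)
    (h : a + b + c = 1) :
    f (a • u + b • v + c • w) = a • f u + b • f v + c • f w := by
  have hd := AffineMap.decomp f
  have : ∀ x, f x = f.linear x + f 0 := fun x => by
    conv_lhs => rw [hd]
    simp
  rw [this, this u, this v, this w]
  simp only [map_add, map_smul, smul_add]
  have : f 0 = (a + b + c) • f 0 := by rw [h, one_smul]
  nth_rw 1 [this]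
  simp only [add_smul]; abel

lemma aff2 {M : Type*} [AddCommGroup M] [Module ℝ M] (f : V →ᵃ[ℝ] M) (u v : V) (a b : ℝ)
    (h : a + b = 1) : f (a • u + b • v) = a • f u + b • f v := by
  simpa using aff3 f u v v a b 0 (by simpa using h)

lemma span3 {S : Set V} {u v w : V} (hu : u ∈ affineSpan ℝ S) (hv : v ∈ affineSpan ℝ S)
    (hw : w ∈ affineSpan ℝ S) {a b c : ℝ} (h : a + b + c = 1) :
    a • u + b • v + c • w ∈ affineSpan ℝ S := by
  have h1 : a • u + b • v + c • w = (b • (v - u) + c • (w - u)) +ᵥ u := by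
    have : a = 1 - b - c := by linarith
    subst this
    simp only [vadd_eq_add]; module
  rw [h1]
  refine AffineSubspace.vadd_mem_of_mem_direction (Submodule.add_mem _ ?_ ?_) hu
  · exact Submodule.smul_mem _ _ (AffineSubspace.vsub_mem_direction hv hu)
  · exact Submodule.smul_mem _ _ (AffineSubspace.vsub_mem_direction hw hu)

lemma cvx3 {S : Set V} {u v w : V} (hu : u ∈ S) (hv : v ∈ S) (hw : w ∈ S) {a b c : ℝ}
    (ha : 0 ≤ a) (hb : 0 ≤ b) (hc : 0 ≤ c) (h : a + b + c = 1) :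
    a • u + b • v + c • w ∈ convexHull ℝ S := by
  have hcv := convex_convexHull ℝ S
  have := hcv.sum_mem (t := Finset.univ) (w := ![a, b, c]) (z := ![u, v, w])
    (by intro i _; fin_cases i <;> simpa) (by simp [Fin.sum_univ_three, h])
    (by intro i _; fin_cases i
        · exact subset_convexHull _ _ hu
        · exact subset_convexHull _ _ hv
        · exact subset_convexHull _ _ hw)
  simpa [Fin.sum_univ_three] using this

variable {A : Finset V} {φ : V →ᵃ[ℝ] E3}

lemma Pl.sum1 (P : Pl A φ) (u v w x : V) :
    orr φ u v w = orr φ v w x + orr φ w u x + orr φ u v x := by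
  have := congrFun (cramer (φ u) (φ v) (φ w) (φ x)) 0
  simpa [P.one] using this

lemma Pl.bary (P : Pl A φ) {u v w x : V} (hu : u ∈ affineSpan ℝ (A : Set V))
    (hv : v ∈ affineSpan ℝ (A : Set V)) (hw : w ∈ affineSpan ℝ (A : Set V))
    (hx : x ∈ affineSpan ℝ (A : Set V)) (h : orr φ u v w ≠ 0) :
    x = (orr φ v w x / orr φ u v w) • u + (orr φ w u x / orr φ u v w) • v +
      (orr φ u v x / orr φ u v w) • w := by
  have hs : orr φ v w x / orr φ u v w + orr φ w u x / orr φ u v w + orr φ u v x / orr φ u v w = 1 := by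
    rw [← add_div, ← add_div, ← P.sum1 u v w x, div_self h]
  refine P.inj _ hx _ (span3 hu hv hw hs) ?_
  rw [aff3 φ _ _ _ _ _ _ hs]
  have := cramer (φ u) (φ v) (φ w) (φ x)
  have h2 := congrArg (fun z => (orr φ u v w)⁻¹ • z) this
  simp only [smul_add, smul_smul] at h2
  rw [inv_mul_cancel₀ h, one_smul] at h2
  rw [h2]; simp only [div_eq_inv_mul]

lemma Pl.mem3 (P : Pl A φ) {S : Set V} {u v w x : V} (hu : u ∈ affineSpan ℝ (A : Set V))
    (hv : v ∈ affineSpan ℝ (A : Set V)) (hw : w ∈ affineSpan ℝ (A : Set V))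
    (hx : x ∈ affineSpan ℝ (A : Set V)) (huS : u ∈ S) (hvS : v ∈ S) (hwS : w ∈ S)
    (h : 0 < orr φ u v w) (h1 : 0 ≤ orr φ v w x) (h2 : 0 ≤ orr φ w u x) (h3 : 0 ≤ orr φ u v x) :
    x ∈ convexHull ℝ S := by
  rw [P.bary hu hv hw hx h.ne']
  refine cvx3 huS hvS hwS (by positivity) (by positivity) (by positivity) ?_
  rw [← add_div, ← add_div, ← P.sum1 u v w x, div_self h.ne']

abbrev Exd (A : Finset V) : Prop := ∀ u ∈ A, ∃ α : V →ₗ[ℝ] ℝ, ∀ v ∈ A, v ≠ u → α v < α u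

structure Tri (A : Finset V) (T : Finset (Finset V)) : Prop where
  ex : Exd A
  sub : ∀ t ∈ T, t ⊆ A
  card : ∀ t ∈ T, t.card = 3
  cov : ∀ x ∈ cv A, ∃ t ∈ T, x ∈ cv t
  int : ∀ t ∈ T, ∀ t' ∈ T, ∀ x, x ∈ cv t → x ∈ cv t' → x ∈ convexHull ℝ ((t : Set V) ∩ t')

lemma hull_eq0 (f : V →ᵃ[ℝ] ℝ) {S : Set V} (h : ∀ x ∈ S, f x = 0) {x : V}
    (hx : x ∈ convexHull ℝ S) : f x = 0 :=
  convexHull_min (t := f ⁻¹' {0}) (fun y hy => h y hy)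
    ((convex_singleton (0 : ℝ)).affine_preimage f) hx

lemma hull_nonneg (f : V →ᵃ[ℝ] ℝ) {S : Set V} (h : ∀ x ∈ S, 0 ≤ f x) {x : V}
    (hx : x ∈ convexHull ℝ S) : 0 ≤ f x :=
  convexHull_min (t := f ⁻¹' Set.Ici 0) (fun y hy => h y hy)
    ((convex_Ici (0 : ℝ)).affine_preimage f) hx

lemma third {t : Finset V} (h : t.card = 3) {u v : V} (hu : u ∈ t) (hv : v ∈ t) (huv : u ≠ v) :
    ∃ w ∈ t, w ≠ u ∧ w ≠ v ∧ ∀ x ∈ t, x = u ∨ x = v ∨ x = w := by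
  have h1 : ((t.erase u).erase v).card = 1 := by
    grind
  obtain ⟨w, hw⟩ := Finset.card_eq_one.1 h1
  have hw' : w ∈ (t.erase u).erase v := by rw [hw]; simp
  simp only [mem_erase] at hw'
  refine ⟨w, hw'.2.2, hw'.2.1, hw'.1, fun x hx => ?_⟩
  by_contra hcon
  push Not at hcon
  have : x ∈ (t.erase u).erase v := by simp [hcon, hx]
  rw [hw] at this
  exact hcon.2.2 (mem_singleton.1 this)

variable {T : Finset (Finset V)}

lemma exp3 (H : Exd A) {v p q u : V} (hv : v ∈ A) (hp : p ∈ A) (hq : q ∈ A) (hu : u ∈ A)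
    (hpv : p ≠ v) (hqv : q ≠ v) (huv : u ≠ v) {a b c : ℝ} (ha : 0 ≤ a) (hb : 0 ≤ b) (hc : 0 ≤ c)
    (h : a • (p - v) + b • (q - v) + c • (u - v) = 0) : a = 0 ∧ b = 0 ∧ c = 0 := by
  obtain ⟨α, hα⟩ := H v hv
  have h1 := hα p hp hpv
  have h2 := hα q hq hqv
  have h3 := hα u hu huv
  have := congrArg α h
  simp only [map_add, map_smul, map_sub, smul_eq_mul, map_zero] at this
  have e1 := mul_nonneg ha (sub_nonneg.2 h1.le)
  have e2 := mul_nonneg hb (sub_nonneg.2 h2.le)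
  have e3 := mul_nonneg hc (sub_nonneg.2 h3.le)
  refine ⟨?_, ?_, ?_⟩
  · have : a * (α v - α p) = 0 := by linarith
    exact (mul_eq_zero.1 this).resolve_right (by linarith)
  · have : b * (α v - α q) = 0 := by linarith
    exact (mul_eq_zero.1 this).resolve_right (by linarith)
  · have : c * (α v - α u) = 0 := by linarith
    exact (mul_eq_zero.1 this).resolve_right (by linarith)

lemma noncol (H : Exd A) {u v w : V} (hu : u ∈ A) (hv : v ∈ A) (hw : w ∈ A)
    (huv : u ≠ v) (huw : u ≠ w) (hvw : v ≠ w) {s : ℝ} (hs : w = (1 - s) • u + s • v) : False := by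
  rcases lt_or_ge s 0 with h | h
  · have := exp3 H hu hv hw hw huv.symm huw.symm huw.symm (a := -s) (b := 1) (c := 0) (by linarith)
      (by simp) le_rfl (by rw [hs]; module)
    norm_num at this
  · rcases le_or_gt s 1 with h' | h'
    · have := exp3 H hw hu hv hv huw hvw hvw (a := 1 - s) (b := s) (c := 0) (by linarith) h le_rfl
        (by rw [hs]; module)
      linarith [this.1, this.2.1]
    · have := exp3 H hv hu hw hw huv hvw.symm hvw.symm (a := s - 1) (b := 1) (c := 0) (by linarith)
        (by simp) le_rfl (by rw [hs]; module)
      norm_num at this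

lemma mem_aS {x : V} (hx : x ∈ A) : x ∈ affineSpan ℝ (A : Set V) := subset_affineSpan ℝ _ hx

lemma Tri.S0 (H : Tri A T) (P : Pl A φ) {u v w : V} (hu : u ∈ A) (hv : v ∈ A) (hw : w ∈ A)
    (huv : u ≠ v) (huw : u ≠ w) (hvw : v ≠ w) : orr φ u v w ≠ 0 := by
  intro h0
  obtain ⟨s, hs⟩ : ∃ s : ℝ, w = (1 - s) • u + s • v := by
    have hne : φ u ≠ φ v := fun h => huv (P.inj _ (mem_aS hu) _ (mem_aS hv) h)
    have hu0 := P.one u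
    have hv0 := P.one v
    have hw0 := P.one w
    have key : ∃ s : ℝ, φ w = (1 - s) • φ u + s • φ v := by
      have h0' : (φ v 1 - φ u 1) * (φ w 2 - φ u 2) - (φ v 2 - φ u 2) * (φ w 1 - φ u 1) = 0 := by
        rw [← h0]; simp only [orr, D3, hu0, hv0, hw0]; ring
      by_cases h1 : φ v 1 - φ u 1 = 0
      · have h2 : φ v 2 - φ u 2 ≠ 0 := by
          intro h2; apply hne; ext i; fin_cases i
          · simp [hu0, hv0]
          · simpa using (sub_eq_zero.1 h1).symm
          · simpa using (sub_eq_zero.1 h2).symm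
        refine ⟨(φ w 2 - φ u 2) / (φ v 2 - φ u 2), ?_⟩
        rw [h1, zero_mul, zero_sub, neg_eq_zero, mul_eq_zero] at h0'
        have h3 := h0'.resolve_left h2
        ext i; fin_cases i
        · simp [hu0, hv0, hw0]
        · simp; rw [show φ v 1 = φ u 1 by linarith, show φ w 1 = φ u 1 by linarith]; ring
        · simp; field_simp; ring
      · refine ⟨(φ w 1 - φ u 1) / (φ v 1 - φ u 1), ?_⟩
        ext i; fin_cases i
        · simp [hu0, hv0, hw0]
        · simp; field_simp; ring
        · simp; field_simp; linear_combination h0'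
    obtain ⟨s, hs⟩ := key
    refine ⟨s, P.inj _ (mem_aS hw) _ ?_ ?_⟩
    · have := span3 (mem_aS hu) (mem_aS hv) (mem_aS hv) (a := 1 - s) (b := s) (c := 0) (by ring)
      simpa using this
    · rw [hs, aff2 φ u v _ _ (by ring)]
  exact noncol H.ex hu hv hw huv huw hvw hs

end PartF1

section PartF2
variable {V : Type*} [NormedAddCommGroup V] [NormedSpace ℝ V]
variable {A : Finset V} {φ : V →ᵃ[ℝ] E3} {T : Finset (Finset V)}

lemma Tri.U1 (H : Tri A T) (P : Pl A φ) {t : Finset V} (ht : t ∈ T) {s : Set V} {u v : V}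
    (hu : u ∈ t) (hv : v ∈ t) (huv : u ≠ v) {a b : ℝ} (ha : 0 < a) (hab : a + b = 1)
    (hz : a • u + b • v ∈ convexHull ℝ ((t : Set V) ∩ s)) : u ∈ s := by
  by_contra hus
  obtain ⟨w, hw, hwu, hwv, h3⟩ := third (H.card t ht) hu hv huv
  have h0 := hull_eq0 (orA φ v w) (S := (t : Set V) ∩ s) (fun x hx => by
    rcases h3 x hx.1 with rfl | rfl | rfl
    · exact absurd hx.2 hus
    · exact D3_self'' _ _
    · exact D3_self' _ _) hz
  rw [aff2 _ _ _ _ _ hab] at h0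
  simp only [orA_apply, orr, D3_self'', smul_eq_mul, mul_zero, add_zero] at h0
  have hS := H.sub t ht
  exact H.S0 P (hS hv) (hS hw) (hS hu) hwv.symm huv.symm hwu ((mul_eq_zero.1 h0).resolve_left ha.ne')

lemma seg_mem {S : Set V} {u v : V} (hu : u ∈ S) (hv : v ∈ S) {a b : ℝ} (ha : 0 ≤ a) (hb : 0 ≤ b)
    (hab : a + b = 1) : a • u + b • v ∈ convexHull ℝ S :=
  convex_convexHull ℝ S (subset_convexHull _ _ hu) (subset_convexHull _ _ hv) ha hb hab

lemma Tri.U2 (H : Tri A T) (P : Pl A φ) {t s : Finset V} (ht : t ∈ T) (hs : s ∈ T) {u v : V}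
    (hu : u ∈ t) (hv : v ∈ t) (huv : u ≠ v) {a b : ℝ} (ha : 0 < a) (hb : 0 < b) (hab : a + b = 1)
    (hz : a • u + b • v ∈ cv s) : u ∈ s ∧ v ∈ s := by
  have h := H.int t ht s hs _ (seg_mem hu hv ha.le hb.le hab) hz
  refine ⟨H.U1 P ht hu hv huv ha hab h, H.U1 P ht hv hu huv.symm hb (by linarith) (?_ :
    b • v + a • u ∈ _)⟩
  rwa [add_comm]

lemma Tri.T1 (H : Tri A T) (P : Pl A φ) {t s : Finset V} (ht : t ∈ T) (hs : s ∈ T) {u v p q : V}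
    (hu : u ∈ t) (hv : v ∈ t) (huv : u ≠ v) (hp : p ∈ s) (hq : q ∈ s) (h1 : 0 < orr φ u v p)
    (h2 : orr φ u v q < 0) : False := by
  have huA := H.sub t ht hu
  have hvA := H.sub t ht hv
  have hpA := H.sub s hs hp
  have hqA := H.sub s hs hq
  have hpu : p ≠ u := by rintro rfl; simp [orr, D3_self''] at h1
  have hpv : p ≠ v := by rintro rfl; simp [orr, D3_self'] at h1
  have hqu : q ≠ u := by rintro rfl; simp [orr, D3_self''] at h2
  have hqv : q ≠ v := by rintro rfl; simp [orr, D3_self'] at h2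
  have hpq : p ≠ q := by rintro rfl; linarith
  have hb := P.bary (mem_aS huA) (mem_aS hvA) (mem_aS hpA) (mem_aS hqA) h1.ne'
  have hsum := P.sum1 u v p q
  set Q := orr φ u v q
  set R := orr φ u v p
  set β := orr φ v p q
  set γ := orr φ p u q
  have hb' : R • q = β • u + γ • v + Q • p := by
    conv_lhs => rw [hb]
    simp only [smul_add, smul_smul, mul_div_cancel₀ _ h1.ne']
  rcases le_or_gt β 0 with hβ | hβ
  · have := exp3 H.ex hvA hqA hpA huA hqv hpv huv (a := R) (b := -Q) (c := -β) h1.le (by linarith)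
      (by linarith) (by
        have : γ = R - Q - β := by linarith
        rw [this] at hb'
        simp only [smul_sub]; rw [hb']; module)
    linarith [this.1]
  rcases le_or_gt γ 0 with hγ | hγ
  · have := exp3 H.ex huA hqA hpA hvA hqu hpu huv.symm (a := R) (b := -Q) (c := -γ) h1.le (by linarith)
      (by linarith) (by
        have : β = R - Q - γ := by linarith
        rw [this] at hb'
        simp only [smul_sub]; rw [hb']; module)
    linarith [this.1]
  have hpos : 0 < β + γ := by linarith
  have hz : (β / (β + γ)) • u + (γ / (β + γ)) • v ∈ cv s := by
    have : (β / (β + γ)) • u + (γ / (β + γ)) • v = (R / (β + γ)) • q + (-Q / (β + γ)) • p := by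
      simp only [div_eq_inv_mul, mul_smul, ← smul_add]
      rw [hb']; module
    rw [this]
    refine seg_mem hq hp (by positivity) (div_nonneg (by linarith) hpos.le) ?_
    rw [← add_div, div_eq_one_iff_eq hpos.ne']; linarith
  have hus := H.U2 P ht hs hu hv huv (by positivity) (by positivity)
    (by rw [← add_div, div_self hpos.ne']) hz
  obtain ⟨w, -, -, -, h3⟩ := third (H.card s hs) hus.1 hus.2 huv
  have e1 := ((h3 p hp).resolve_left hpu).resolve_left hpv
  have e2 := ((h3 q hq).resolve_left hqu).resolve_left hqv
  exact hpq (e1.trans e2.symm)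

open Topology in
lemma eps2 {a b : ℝ} (ha : 0 < a) (hb : 0 < b) (a' b' : ℝ) :
    ∃ ε : ℝ, 0 < ε ∧ ε < 1 ∧ 0 < a + ε * a' ∧ 0 < b + ε * b' := by
  have h1 : ∀ᶠ ε : ℝ in 𝓝 0, 0 < a + ε * a' :=
    (Continuous.tendsto (by fun_prop) 0).eventually_const_lt (by simpa using ha)
  have h2 : ∀ᶠ ε : ℝ in 𝓝 0, 0 < b + ε * b' :=
    (Continuous.tendsto (by fun_prop) 0).eventually_const_lt (by simpa using hb)
  have h3 : ∀ᶠ ε : ℝ in 𝓝 0, ε < 1 := eventually_lt_nhds one_pos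
  obtain ⟨ε, ⟨h, h'⟩, h4⟩ := (((h1.and h2).and h3).filter_mono
    (nhdsWithin_le_nhds (s := Set.Ioi 0))).and self_mem_nhdsWithin |>.exists
  exact ⟨ε, h4, h', h.1, h.2⟩

lemma Tri.S3 (H : Tri A T) (P : Pl A φ) {t s : Finset V} (ht : t ∈ T) (hs : s ∈ T) {u v x y : V}
    (hu : u ∈ t) (hv : v ∈ t) (hu' : u ∈ s) (hv' : v ∈ s) (hx : x ∈ t) (hy : y ∈ s)
    (h1 : 0 < orr φ u v x) (h2 : 0 < orr φ u v y) : x = y := by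
  have hxu : x ≠ u := by rintro rfl; simp [orr, D3_self''] at h1
  have hxv : x ≠ v := by rintro rfl; simp [orr, D3_self'] at h1
  have hyu : y ≠ u := by rintro rfl; simp [orr, D3_self''] at h2
  have hyv : y ≠ v := by rintro rfl; simp [orr, D3_self'] at h2
  have huv : u ≠ v := by rintro rfl; simp [orr, D3_self] at h1
  have huA := H.sub t ht hu
  have hvA := H.sub t ht hv
  have hxA := H.sub t ht hx
  have hyA := H.sub s hs hy
  obtain ⟨ε, he, he1, e1, e2⟩ := eps2 (a := orr φ u v y / 2) (b := orr φ u v y / 2) (by linarith)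
    (by linarith) (orr φ v y x - orr φ u v y / 2) (orr φ y u x - orr φ u v y / 2)
  have hsum : (1 - ε) / 2 + (1 - ε) / 2 + ε = 1 := by ring
  set z := ((1 - ε) / 2) • u + ((1 - ε) / 2) • v + ε • x with hz
  have hor : ∀ p q, orr φ p q z = (1 - ε) / 2 * orr φ p q u + (1 - ε) / 2 * orr φ p q v +
      ε * orr φ p q x := fun p q => by
    rw [← orA_apply, hz, aff3 _ _ _ _ _ _ _ hsum]; rfl
  have hzt : z ∈ cv t := cvx3 hu hv hx (by linarith) (by linarith) he.le hsum
  have hzuv : 0 < orr φ u v z := by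
    rw [hor]; simp only [orr, D3_self', D3_self'', mul_zero, zero_add]; positivity
  have hzs : z ∈ cv s := by
    refine P.mem3 (mem_aS huA) (mem_aS hvA) (mem_aS hyA)
      (span3 (mem_aS huA) (mem_aS hvA) (mem_aS hxA) hsum) hu' hv' hy h2 ?_ ?_ hzuv.le
    · rw [hor]
      have : orr φ v y u = orr φ u v y := D3_rot _ _ _
      rw [this, show orr φ v y v = 0 from D3_self'' _ _]; nlinarith
    · rw [hor]
      have : orr φ y u v = orr φ u v y := by rw [orr, D3_rot]; exact D3_rot _ _ _
      rw [this, show orr φ y u u = 0 from D3_self' _ _]; nlinarith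
  have hxs : x ∈ s := by
    by_contra hxs
    obtain ⟨w, -, -, -, h3⟩ := third (H.card t ht) hu hv huv
    have hxw := ((h3 x hx).resolve_left hxu).resolve_left hxv
    have h0 := hull_eq0 (orA φ u v) (fun p hp => by
      rcases h3 p hp.1 with rfl | rfl | rfl
      · exact D3_self'' _ _
      · exact D3_self' _ _
      · exact absurd hp.2 (hxw ▸ hxs)) (H.int t ht s hs z hzt hzs)
    exact hzuv.ne' h0
  obtain ⟨w, -, -, -, h3⟩ := third (H.card s hs) hu' hv' huv
  exact (((h3 x hxs).resolve_left hxu).resolve_left hxv).trans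
    (((h3 y hy).resolve_left hyu).resolve_left hyv).symm

lemma Tri.side (H : Tri A T) (P : Pl A φ) {u v : V} (hu : u ∈ A) (hv : v ∈ A) (huv : u ≠ v)
    (hf : ({u, v} : Finset V) ∉ fs A) : ∃ q ∈ A, orr φ u v q < 0 := by
  by_contra! hcon
  apply hf
  have hu0 : orr φ u v u = 0 := D3_self'' _ _
  have hv0 : orr φ u v v = 0 := D3_self' _ _
  have : ({u, v} : Finset V) = topS A (-(orA φ u v).linear) := by
    ext x
    simp only [mem_insert, mem_singleton, mem_topS, LinearMap.neg_apply]
    constructor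
    · rintro (rfl | rfl)
      · exact ⟨hu, fun y hy => by linarith [orA_lin φ x v x y, hcon y hy]⟩
      · exact ⟨hv, fun y hy => by linarith [orA_lin φ u x x y, hcon y hy]⟩
    · rintro ⟨hx, h⟩
      by_contra! hne
      have := H.S0 P hu hv hx huv hne.1.symm hne.2.symm
      have h1 := h u hu
      have h2 := orA_lin φ u v u x
      exact this (le_antisymm (by linarith) (hcon x hx))
  rw [this]; exact topS_mem_fs _ _

lemma Tri.side' (H : Tri A T) (P : Pl A φ) {u v x y : V} (hu : u ∈ A) (hv : v ∈ A) (hx : x ∈ A)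
    (hy : y ∈ A) (h1 : 0 < orr φ u v x) (h2 : orr φ u v y < 0) : ({u, v} : Finset V) ∉ fs A := by
  intro hf
  obtain h | ⟨l, hl⟩ := (mem_fs.1 hf).2
  · simp at h
  have hmem : ∀ z, z ∈ topS A l ↔ z = u ∨ z = v := fun z => by rw [← hl]; simp
  have hlu := (mem_topS.1 ((hmem u).2 (Or.inl rfl))).2
  have hlv := (mem_topS.1 ((hmem v).2 (Or.inr rfl))).2
  have huv : l u = l v := le_antisymm (hlv u hu) (hlu v hv)
  have key : ∀ z ∈ A, z ≠ u → z ≠ v → l z < l u := fun z hz h3 h4 =>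
    lt_of_le_of_ne (hlu z hz) fun h => by
      have : z ∈ topS A l := mem_topS.2 ⟨hz, fun p hp => h ▸ hlu p hp⟩
      rcases (hmem z).1 this with h | h
      · exact h3 h
      · exact h4 h
  have hxu : x ≠ u := by rintro rfl; simp [orr, D3_self''] at h1
  have hxv : x ≠ v := by rintro rfl; simp [orr, D3_self'] at h1
  have hyu : y ≠ u := by rintro rfl; simp [orr, D3_self''] at h2
  have hyv : y ≠ v := by rintro rfl; simp [orr, D3_self'] at h2
  have hb := P.bary (mem_aS hu) (mem_aS hv) (mem_aS hx) (mem_aS hy) h1.ne'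
  have hs := P.sum1 u v x y
  have h3 := congrArg l hb
  simp only [map_add, map_smul, smul_eq_mul, ← huv] at h3
  have k1 := key x hx hxu hxv
  have k2 := key y hy hyu hyv
  have : orr φ u v x * l y = (orr φ u v x - orr φ u v y) * l u + orr φ u v y * l x := by
    grind
  nlinarith

variable [FiniteDimensional ℝ V]

lemma cv_closed (t : Finset V) : IsClosed (cv t) :=
  (Set.Finite.isCompact_convexHull (𝕜 := ℝ) t.finite_toSet).isClosed

open Topology in
lemma Tri.S1 (H : Tri A T) (P : Pl A φ) {t : Finset V} (ht : t ∈ T) {u v q : V}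
    (hu : u ∈ t) (hv : v ∈ t) (huv : u ≠ v) (hq : q ∈ A) (h : orr φ u v q < 0) :
    ∃ s ∈ T, u ∈ s ∧ v ∈ s ∧ ∃ y ∈ s, orr φ u v y < 0 := by
  have huA := H.sub t ht hu
  have hvA := H.sub t ht hv
  let z : ℝ → V := fun ε => ((1 - ε) / 2) • u + ((1 - ε) / 2) • v + ε • q
  have hzc : Continuous z := by fun_prop
  have hz0 : z 0 = (1 / 2 : ℝ) • u + (1 / 2 : ℝ) • v := by simp [z]
  have h1 : ∀ᶠ ε in 𝓝 (0 : ℝ), ∀ s ∈ T, z 0 ∉ cv s → z ε ∉ cv s := by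
    rw [Filter.eventually_all_finset]
    intro s hs
    by_cases hc : z 0 ∈ cv s
    · exact Filter.Eventually.of_forall fun ε h => absurd hc h
    · filter_upwards [hzc.tendsto 0 ((cv_closed s).isOpen_compl.mem_nhds hc)] with ε hε _
      exact hε
  have h3 : ∀ᶠ ε : ℝ in 𝓝 0, ε < 1 := eventually_lt_nhds one_pos
  obtain ⟨ε, ⟨h4, h5⟩, h6⟩ := ((h1.and h3).filter_mono
    (nhdsWithin_le_nhds (s := Set.Ioi 0))).and self_mem_nhdsWithin |>.exists
  have h6 : 0 < ε := h6
  have hsum : (1 - ε) / 2 + (1 - ε) / 2 + ε = 1 := by ring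
  obtain ⟨s, hs, hzs⟩ := H.cov (z ε)
    (cvx3 huA hvA hq (by linarith) (by linarith) h6.le hsum)
  have hz0s : z 0 ∈ cv s := by by_contra hc; exact h4 s hs hc hzs
  rw [hz0] at hz0s
  obtain ⟨hus, hvs⟩ := H.U2 P ht hs hu hv huv (by norm_num) (by norm_num) (by norm_num) hz0s
  refine ⟨s, hs, hus, hvs, ?_⟩
  by_contra! hcon
  have := hull_nonneg (orA φ u v) (fun x hx => hcon x hx) hzs
  rw [aff3 _ _ _ _ _ _ _ hsum] at this
  simp only [orA_apply, orr, D3_self', D3_self'', smul_eq_mul, mul_zero, zero_add] at this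
  have h7 : 0 < ε * -D3 (φ u) (φ v) (φ q) := mul_pos h6 (by simpa using h)
  linarith

lemma Tri.conn (H : Tri A T) {β : Type*} (L : Finset V → β)
    (hL : ∀ t ∈ T, ∀ t' ∈ T, ∀ u v, u ≠ v → u ∈ t → v ∈ t → u ∈ t' → v ∈ t' → L t = L t') :
    ∀ t ∈ T, ∀ t' ∈ T, L t = L t' := by
  intro t0 ht0 t1 ht1
  by_contra hne
  choose! α hα using H.ex
  let K : Set V := cv A ∩ ⋂ u ∈ A, {x | α u x < α u u}
  have hK : Convex ℝ K := (convex_convexHull ℝ _).inter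
    (convex_iInter₂ fun u _ => convex_halfSpace_lt (α u).isLinear _)
  have hKA : ∀ x ∈ K, x ∉ A := fun x hx hxA => by
    have : α x x < α x x := Set.mem_iInter₂.1 hx.2 x hxA
    exact lt_irrefl _ this
  have hKT : ∀ t ∈ T, ∃ x ∈ cv t, x ∈ K := by
    intro t ht
    obtain ⟨u, v, huv, hu, hv⟩ : ∃ u v, u ≠ v ∧ u ∈ t ∧ v ∈ t := by
      obtain ⟨u, hu, v, hv, h⟩ := one_lt_card.1 (by rw [H.card t ht]; norm_num : 1 < t.card)
      exact ⟨u, v, h, hu, hv⟩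
    have hh : (0:ℝ) ≤ 1/2 := by norm_num
    refine ⟨(1/2 : ℝ) • u + (1/2 : ℝ) • v, seg_mem hu hv hh hh (by norm_num),
      seg_mem (H.sub t ht hu) (H.sub t ht hv) hh hh (by norm_num), ?_⟩
    refine Set.mem_iInter₂.2 fun w hw => ?_
    show α w _ < α w w
    simp only [map_add, map_smul, smul_eq_mul]
    by_cases huw : u = w
    · subst huw; linarith [hα u hw v (H.sub t ht hv) huv.symm]
    · have h1 := hα w hw u (H.sub t ht hu) huw
      by_cases hvw : v = w
      · subst hvw; linarith
      · linarith [hα w hw v (H.sub t ht hv) hvw]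
  let C : (Finset V → Prop) → Set V := fun p => ⋃ t ∈ T.filter p, cv t
  have hC : ∀ p, IsClosed (C p) := fun p =>
    isClosed_biUnion_finset fun t _ => cv_closed t
  have hmem : ∀ p x, x ∈ C p ↔ ∃ t ∈ T, p t ∧ x ∈ cv t := fun p x => by
    simp [C, and_assoc]
  have hpc := isPreconnected_closed_iff.1 hK.isPreconnected (C fun t => L t = L t0)
    (C fun t => L t ≠ L t0) (hC _) (hC _) (fun x hx => by
      obtain ⟨t, ht, hxt⟩ := H.cov x hx.1
      by_cases h : L t = L t0
      · exact Or.inl ((hmem _ _).2 ⟨t, ht, h, hxt⟩)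
      · exact Or.inr ((hmem _ _).2 ⟨t, ht, h, hxt⟩))
    (by obtain ⟨x, h1, h2⟩ := hKT t0 ht0
        exact ⟨x, h2, (hmem _ _).2 ⟨t0, ht0, rfl, h1⟩⟩)
    (by obtain ⟨x, h1, h2⟩ := hKT t1 ht1
        exact ⟨x, h2, (hmem _ _).2 ⟨t1, ht1, fun h => hne h.symm, h1⟩⟩)
  obtain ⟨x, hxK, hx1, hx2⟩ := hpc
  obtain ⟨t, ht, h1, hxt⟩ := (hmem _ _).1 hx1
  obtain ⟨s, hs, h2, hxs⟩ := (hmem _ _).1 hx2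
  have hx := H.int t ht s hs x hxt hxs
  have hsub : ((t : Set V) ∩ s).Subsingleton := by
    intro u hu v hv
    by_contra huv
    exact h2 ((hL s hs t ht u v huv hu.2 hv.2 hu.1 hv.1).trans h1)
  rw [hsub.convex.convexHull_eq] at hx
  exact hKA x hxK (H.sub t ht hx.1)

end PartF2

section PartF3
variable {V : Type*} [NormedAddCommGroup V] [NormedSpace ℝ V] [FiniteDimensional ℝ V]
variable {A : Finset V} {φ : V →ᵃ[ℝ] E3} {T : Finset (Finset V)}

lemma or_swap (u v x : V) : orr φ v u x = - orr φ u v x := D3_swap _ _ _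

lemma Tri.ker (H : Tri A T) (P : Pl A φ) (hA : A.Nonempty) (f : V → ℝ)
    (hf : ∀ t ∈ T, ∀ t' ∈ T, ∀ u v w w', u ∈ t → v ∈ t → u ∈ t' → v ∈ t' → w ∈ t → w' ∈ t' →
      0 < orr φ u v w → orr φ u v w' < 0 →
      orr φ u v w * f w' = orr φ v w w' * f u + orr φ w u w' * f v + orr φ u v w' * f w) :
    ∃ l : E3 →ₗ[ℝ] ℝ, ∀ x ∈ A, l (φ x) = f x := by
  have hex : ∀ t ∈ T, ∃ l : E3 →ₗ[ℝ] ℝ, ∀ x ∈ t, l (φ x) = f x := by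
    intro t ht
    obtain ⟨u, hu, v, hv, huv⟩ := one_lt_card.1 (by rw [H.card t ht]; norm_num : 1 < t.card)
    obtain ⟨w, hw, hwu, hwv, h3⟩ := third (H.card t ht) hu hv huv
    have hS := H.sub t ht
    have h0 := H.S0 P (hS hu) (hS hv) (hS hw) huv hwu.symm hwv.symm
    refine ⟨nuX φ f u v w, fun x hx => ?_⟩
    rcases h3 x hx with rfl | rfl | rfl
    · exact nuX_a h0
    · exact nuX_b h0
    · exact nuX_c h0
  choose! L hL using hex
  have hc := H.conn L (fun t ht t' ht' u v huv hu hv hu' hv' => by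
    obtain ⟨w, hw, hwu, hwv, -⟩ := third (H.card t ht) hu hv huv
    obtain ⟨w', hw', hwu', hwv', -⟩ := third (H.card t' ht') hu' hv' huv
    have hS := H.sub t ht
    have h0 := H.S0 P (hS hu) (hS hv) (hS hw) huv hwu.symm hwv.symm
    have h0' := H.S0 P (hS hu) (hS hv) (H.sub t' ht' hw') huv hwu'.symm hwv'.symm
    suffices h : L t (φ w') = f w' from
      (nu_unique h0' (hL t ht u hu) (hL t ht v hv) h).trans
        (nu_unique h0' (hL t' ht' u hu') (hL t' ht' v hv') (hL t' ht' w' hw')).symm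
    have hcr := lin_cramer (φ u) (φ v) (φ w) (φ w') (L t)
    rw [hL t ht u hu, hL t ht v hv, hL t ht w hw] at hcr
    have key : w = w' ∨ orr φ u v w * f w' =
        orr φ v w w' * f u + orr φ w u w' * f v + orr φ u v w' * f w := by
      rcases lt_or_gt_of_ne h0 with h1 | h1 <;> rcases lt_or_gt_of_ne h0' with h2 | h2
      · exact Or.inl (H.S3 P ht ht' hv hu hv' hu' hw hw' (by rw [or_swap]; linarith)
          (by rw [or_swap]; linarith))
      · right
        have := hf t ht t' ht' v u w w' hv hu hv' hu' hw hw' (by rw [or_swap]; linarith)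
          (by rw [or_swap]; linarith)
        have e1 : orr φ u w w' = - orr φ w u w' := or_swap _ _ _
        have e2 : orr φ w v w' = - orr φ v w w' := or_swap _ _ _
        rw [or_swap, or_swap u v w', e1, e2] at this
        linarith
      · exact Or.inr (hf t ht t' ht' u v w w' hu hv hu' hv' hw hw' h1 h2)
      · exact Or.inl (H.S3 P ht ht' hu hv hu' hv' hw hw' h1 h2)
    rcases key with rfl | key
    · exact hL t ht w hw
    · exact mul_left_cancel₀ h0 (hcr.trans key.symm))
  obtain ⟨x0, hx0⟩ := hA
  obtain ⟨t0, ht0, -⟩ := H.cov x0 (subset_convexHull _ _ hx0)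
  refine ⟨L t0, fun x hx => ?_⟩
  obtain ⟨t, ht, hxt⟩ := H.cov x (subset_convexHull _ _ hx)
  have hxt' : x ∈ t := by
    by_contra hcon
    obtain ⟨α, hα⟩ := H.ex x hx
    have : α x < α x := convexHull_min (s := (t : Set V)) (t := {y | α y < α x})
      (fun y hy => hα y (H.sub t ht hy) (fun h => hcon (h ▸ hy)))
      (convex_halfSpace_lt α.isLinear _) hxt
    exact lt_irrefl _ this
  rw [hc t0 ht0 t ht]
  exact hL t ht x hxt'

noncomputable def Dg (A : Finset V) (T : Finset (Finset V)) : Finset (Finset V) :=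
  (A.powersetCard 2).filter (fun e => e ∉ fs A ∧ ∃ t ∈ T, e ⊆ t)

lemma Tri.dg_data (H : Tri A T) (P : Pl A φ) {e : Finset V} (he : e ∈ Dg A T) :
    ∃ u v w w' : A, e = {u.1, v.1} ∧ (u : V) ≠ v ∧ ∃ s ∈ T, ∃ s' ∈ T, u.1 ∈ s ∧ v.1 ∈ s ∧ w.1 ∈ s ∧
      u.1 ∈ s' ∧ v.1 ∈ s' ∧ w'.1 ∈ s' ∧ 0 < orr φ u v w ∧ orr φ u v w' < 0 := by
  simp only [Dg, mem_filter, mem_powersetCard] at he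
  obtain ⟨⟨h1, h2⟩, h3, t, ht, h4⟩ := he
  obtain ⟨u, v, huv, rfl⟩ := card_eq_two.1 h2
  have hu : u ∈ t := h4 (by simp)
  have hv : v ∈ t := h4 (by simp)
  have huA := H.sub t ht hu
  have hvA := H.sub t ht hv
  obtain ⟨q, hq, hq'⟩ := H.side P huA hvA huv h3
  obtain ⟨r, hr, hr'⟩ := H.side P hvA huA huv.symm (by rwa [Finset.pair_comm])
  obtain ⟨s', hs', a1, a2, y', a3, a4⟩ := H.S1 P ht hu hv huv hq hq'
  obtain ⟨s, hs, b1, b2, y, b3, b4⟩ := H.S1 P ht hv hu huv.symm hr hr'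
  rw [or_swap] at b4
  exact ⟨⟨u, huA⟩, ⟨v, hvA⟩, ⟨y, H.sub s hs b3⟩, ⟨y', H.sub s' hs' a3⟩, rfl, huv, s, hs, s', hs', b2, b1,
    b3, a1, a2, a3, by simpa using b4, a4⟩

lemma Tri.diag_card (H : Tri A T) (P : Pl A φ) (hA : A.Nonempty) : (Dg A T).card + 3 = A.card := by
  choose u v w w' he huv s hs s' hs' hus hvs hws hus' hvs' hws' h1 h2 using
    fun e : Dg A T => H.dg_data P e.2
  let J : (A → ℝ) →ₗ[ℝ] (Dg A T → ℝ) := LinearMap.pi fun e =>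
    orr φ (u e) (v e) (w e) • LinearMap.proj (w' e) -
      (orr φ (v e) (w e) (w' e) • LinearMap.proj (u e) + orr φ (w e) (u e) (w' e) • LinearMap.proj (v e)
        + orr φ (u e) (v e) (w' e) • LinearMap.proj (w e))
  have hJ : ∀ f e, J f e = orr φ (u e) (v e) (w e) * f (w' e) -
      (orr φ (v e) (w e) (w' e) * f (u e) + orr φ (w e) (u e) (w' e) * f (v e)
        + orr φ (u e) (v e) (w' e) * f (w e)) := fun f e => rfl
  let R : (E3 →ₗ[ℝ] ℝ) →ₗ[ℝ] (A → ℝ) :=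
    { toFun := fun l x => l (φ x), map_add' := fun _ _ => rfl, map_smul' := fun _ _ => rfl }
  have hJR : ∀ l e, J (R l) e = 0 := fun l e => by
    rw [hJ, sub_eq_zero]; exact lin_cramer _ _ _ _ l
  have hRinj : Function.Injective R := by
    obtain ⟨x0, hx0⟩ := hA
    obtain ⟨t, ht, -⟩ := H.cov x0 (subset_convexHull _ _ hx0)
    obtain ⟨a, ha, b, hb, hab⟩ := one_lt_card.1 (by rw [H.card t ht]; norm_num : 1 < t.card)
    obtain ⟨c, hc, hca, hcb, h3⟩ := third (H.card t ht) ha hb hab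
    have hS := H.sub t ht
    have h0 := H.S0 P (hS ha) (hS hb) (hS hc) hab hca.symm hcb.symm
    intro l l' hl
    have hl' : ∀ x ∈ A, l (φ x) = l' (φ x) := fun x hx => congrFun hl ⟨x, hx⟩
    exact (nu_unique (η := fun x => l' (φ x)) h0 (hl' a (hS ha)) (hl' b (hS hb)) (hl' c (hS hc))).trans
      (nu_unique (η := fun x => l' (φ x)) h0 rfl rfl rfl).symm
  have hker : LinearMap.ker J = LinearMap.range R := by
    ext f
    rw [LinearMap.mem_ker, LinearMap.mem_range]
    constructor
    · intro hf
      let f' : V → ℝ := fun x => if h : x ∈ A then f ⟨x, h⟩ else 0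
      have hf' : ∀ x : A, f' x = f x := fun x => by simp [f']
      obtain ⟨l, hl⟩ := H.ker P hA f' (by
        intro t ht t' ht' a b c c' ha hb ha' hb' hc hc' k1 k2
        have hab : a ≠ b := by rintro rfl; simp [orr, D3_self] at k1
        have hS := H.sub t ht
        have hD : ({a, b} : Finset V) ∈ Dg A T := by
          simp only [Dg, mem_filter, mem_powersetCard]
          refine ⟨⟨?_, card_pair hab⟩,
            H.side' P (hS ha) (hS hb) (hS hc) (H.sub t' ht' hc') k1 k2, t, ht, ?_⟩
          · intro x hx; rcases mem_insert.1 hx with rfl | hx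
            · exact hS ha
            · rw [mem_singleton.1 hx]; exact hS hb
          · intro x hx; rcases mem_insert.1 hx with rfl | hx
            · exact ha
            · rw [mem_singleton.1 hx]; exact hb
        obtain ⟨e, hee0⟩ : ∃ e : Dg A T, e.1 = {a, b} := ⟨⟨_, hD⟩, rfl⟩
        have hJe : J f e = 0 := by rw [hf]; rfl
        rw [hJ, ← hf', ← hf', ← hf', ← hf'] at hJe
        have hee : ({a, b} : Finset V) = {(u e).1, (v e).1} := hee0 ▸ he e
        have hcase : (a = u e ∧ b = v e) ∨ (a = v e ∧ b = u e) := by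
          have ha1 : a ∈ ({(u e).1, (v e).1} : Finset V) := by rw [← hee]; simp
          have hb1 : b ∈ ({(u e).1, (v e).1} : Finset V) := by rw [← hee]; simp
          simp only [mem_insert, mem_singleton] at ha1 hb1
          rcases ha1 with h | h <;> rcases hb1 with h' | h'
          · exact absurd (h.trans h'.symm) hab
          · exact Or.inl ⟨h, h'⟩
          · exact Or.inr ⟨h, h'⟩
          · exact absurd (h.trans h'.symm) hab
        rcases hcase with ⟨rfl, rfl⟩ | ⟨rfl, rfl⟩
        · have e1 := H.S3 P ht (hs e) ha hb (hus e) (hvs e) hc (hws e) k1 (h1 e)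
          have e2 := H.S3 P ht' (hs' e) hb' ha' (hvs' e) (hus' e) hc' (hws' e)
            (by rw [or_swap]; linarith) (by rw [or_swap]; linarith [h2 e])
          rw [e1, e2]; linarith
        · have e1 := H.S3 P ht (hs' e) ha hb (hvs' e) (hus' e) hc (hws' e) k1
            (by rw [or_swap]; linarith [h2 e])
          have e2 := H.S3 P ht' (hs e) hb' ha' (hus e) (hvs e) hc' (hws e)
            (by rw [or_swap]; linarith) (h1 e)
          rw [e1, e2]
          rw [or_swap (φ := φ) (u e).1 (v e).1, or_swap (φ := φ) (u e).1 (v e).1]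
          have e3 : orr φ (u e) (w' e) (w e) = orr φ (w e) (u e) (w' e) := D3_rot _ _ _
          have e4 : orr φ (w' e) (v e) (w e) = orr φ (v e) (w e) (w' e) := by
            rw [orr, ← D3_rot]
          rw [e3, e4]; linarith)
      exact ⟨l, funext fun x => (hl x x.2).trans (hf' x)⟩
    · rintro ⟨l, rfl⟩
      exact funext (hJR l)
  have hsurj : LinearMap.range J = ⊤ := by
    let g : Dg A T → A → ℝ := fun e x => max (orr φ (u e) (v e) x) 0
    have hg1 : ∀ e, J (g e) e ≠ 0 := fun e => by
      rw [hJ]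
      have a1 : g e (u e) = 0 := by simp [g, orr, D3_self'']
      have a2 : g e (v e) = 0 := by simp [g, orr, D3_self']
      have a3 : g e (w e) = orr φ (u e) (v e) (w e) := max_eq_left (h1 e).le
      have a4 : g e (w' e) = 0 := max_eq_right (h2 e).le
      rw [a1, a2, a3, a4]
      have := mul_neg_of_neg_of_pos (h2 e) (h1 e)
      intro h; linarith
    have hg2 : ∀ e e', e' ≠ e → J (g e) e' = 0 := by
      intro e e' hne
      have htri : ∀ t ∈ T, (∀ x : A, x.1 ∈ t → 0 ≤ orr φ (u e) (v e) x) ∨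
          (∀ x : A, x.1 ∈ t → orr φ (u e) (v e) x ≤ 0) := by
        intro t ht
        by_contra! hcon
        obtain ⟨⟨x, hx, hx'⟩, y, hy, hy'⟩ := hcon
        exact H.T1 P (hs e) ht (hus e) (hvs e) (huv e) hy hx hy' hx'
      have hzero : ∀ x : A, orr φ (u e) (v e) x = 0 → x.1 ∈ e.1 := by
        intro x hx
        rw [he e]
        by_contra hcon
        simp only [mem_insert, mem_singleton, not_or] at hcon
        exact H.S0 P (u e).2 (v e).2 x.2 (huv e) (Ne.symm hcon.1) (Ne.symm hcon.2) hx
      have hno : orr φ (u e) (v e) (u e') = 0 → orr φ (u e) (v e) (v e') = 0 → False := by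
        intro k1 k2
        apply hne
        apply Subtype.ext
        refine eq_of_subset_of_card_le ?_ ?_
        · rw [he e']; intro x hx
          rcases mem_insert.1 hx with rfl | hx
          · exact hzero _ k1
          · rw [mem_singleton.1 hx]; exact hzero _ k2
        · have := (mem_powersetCard.1 (mem_filter.1 e.2).1).2
          have := (mem_powersetCard.1 (mem_filter.1 e'.2).1).2
          omega
      have hpos : ∀ x : A, 0 ≤ orr φ (u e) (v e) x → g e x = orr φ (u e) (v e) x :=
        fun x hx => max_eq_left hx
      have hneg : ∀ x : A, orr φ (u e) (v e) x ≤ 0 → g e x = 0 := fun x hx => max_eq_right hx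
      rcases htri _ (hs e') with k | k <;> rcases htri _ (hs' e') with k' | k'
      · rw [hJ, hpos _ (k' _ (hws' e')), hpos _ (k _ (hus e')), hpos _ (k _ (hvs e')),
          hpos _ (k _ (hws e'))]
        exact hJR (Dl (φ (u e)) (φ (v e))) e'
      · exact (hno (le_antisymm (k' _ (hus' e')) (k _ (hus e')))
          (le_antisymm (k' _ (hvs' e')) (k _ (hvs e')))).elim
      · exact (hno (le_antisymm (k _ (hus e')) (k' _ (hus' e')))
          (le_antisymm (k _ (hvs e')) (k' _ (hvs' e')))).elim
      · rw [hJ, hneg _ (k' _ (hws' e')), hneg _ (k _ (hus e')), hneg _ (k _ (hvs e')),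
          hneg _ (k _ (hws e'))]; ring
    rw [LinearMap.range_eq_top]
    intro y
    refine ⟨∑ e, (y e / J (g e) e) • g e, funext fun e' => ?_⟩
    rw [map_sum, Finset.sum_apply, Finset.sum_eq_single e']
    · rw [map_smul, Pi.smul_apply, smul_eq_mul, div_mul_cancel₀ _ (hg1 e')]
    · intro e _ hne
      rw [map_smul, Pi.smul_apply, hg2 e e' hne.symm, smul_zero]
    · simp
  have hfin := LinearMap.finrank_range_add_finrank_ker J
  rw [hker, hsurj, LinearMap.finrank_range_of_inj hRinj, finrank_top] at hfin
  simpa [Module.finrank_linearMap] using hfin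

lemma tri3 {d : ℕ} {u v w m n k : Fin d → ℝ} {a b c : ℝ} (h : a + b + c = 0)
    (h1 : (m - n) ⬝ᵥ (u - v) = 0) (h2 : (m - k) ⬝ᵥ (u - w) = 0) (h3 : (n - k) ⬝ᵥ (v - w) = 0) :
    (a • m + b • n + c • k) ⬝ᵥ (a • u + b • v + c • w) = 0 := by
  have hc : c = -a - b := by linarith
  subst hc
  simp only [add_dotProduct, dotProduct_add, smul_dotProduct, dotProduct_smul, sub_dotProduct,
    dotProduct_sub, smul_eq_mul] at h1 h2 h3 ⊢
  linear_combination (-(a * b)) * h1 - (a * (-a - b)) * h2 - (b * (-a - b)) * h3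

lemma Tri.rigid {d : ℕ} {A : Finset (Fin d → ℝ)} {T : Finset (Finset (Fin d → ℝ))}
    {φ : (Fin d → ℝ) →ᵃ[ℝ] E3} (H : Tri A T) (P : Pl A φ) (m : (Fin d → ℝ) → (Fin d → ℝ))
    (hm : ∀ t ∈ T, ∀ u ∈ t, ∀ v ∈ t, (m u - m v) ⬝ᵥ (u - v) = 0) :
    ∀ p ∈ A, ∀ q ∈ A, (m p - m q) ⬝ᵥ (p - q) = 0 := by
  intro p hp q hq
  have key : ∃ l : E3 →ₗ[ℝ] ℝ, ∀ x ∈ A, l (φ x) = m x ⬝ᵥ (p - q) := by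
    refine H.ker P ⟨p, hp⟩ (fun x => m x ⬝ᵥ (p - q)) ?_
    intro t ht t' ht' u v w w' hu hv hu' hv' hw hw' h1 h2
    have hS := H.sub t ht
    have hwA := H.sub t' ht' hw'
    have hb := P.bary (mem_aS (hS hu)) (mem_aS (hS hv)) (mem_aS (hS hw)) (mem_aS hwA) h1.ne'
    have hsum : orr φ v w w' / orr φ u v w + orr φ w u w' / orr φ u v w +
        orr φ u v w' / orr φ u v w = 1 := by
      rw [← add_div, ← add_div, ← P.sum1, div_self h1.ne']
    suffices hN : (m w' - ((orr φ v w w' / orr φ u v w) • m u + (orr φ w u w' / orr φ u v w) • m v +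
        (orr φ u v w' / orr φ u v w) • m w)) ⬝ᵥ (p - q) = 0 by
      rw [sub_dotProduct, add_dotProduct, add_dotProduct, smul_dotProduct, smul_dotProduct,
        smul_dotProduct, sub_eq_zero] at hN
      rw [hN]; simp only [smul_eq_mul]; field_simp
    set a := orr φ v w w' / orr φ u v w
    set b := orr φ w u w' / orr φ u v w
    set c := orr φ u v w' / orr φ u v w
    set N := m w' - (a • m u + b • m v + c • m w)
    have hNu : N ⬝ᵥ (u - w') = 0 := by
      have e1 := tri3 (a := a - 1) (b := b) (c := c) (by linarith) (hm t ht u hu v hv)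
        (hm t ht u hu w hw) (hm t ht v hv w hw)
      have e2 := hm t' ht' w' hw' u hu'
      have e3 : (a - 1) • u + b • v + c • w = w' - u := by
        conv_rhs => rw [hb]
        module
      have e4 : N = (m w' - m u) - ((a - 1) • m u + b • m v + c • m w) := by simp only [N]; module
      rw [e3] at e1
      rw [← neg_sub w' u, dotProduct_neg, e4, sub_dotProduct, e1, e2]; simp
    have hNv : N ⬝ᵥ (v - w') = 0 := by
      have e1 := tri3 (a := a) (b := b - 1) (c := c) (by linarith) (hm t ht u hu v hv)
        (hm t ht u hu w hw) (hm t ht v hv w hw)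
      have e2 := hm t' ht' w' hw' v hv'
      have e3 : a • u + (b - 1) • v + c • w = w' - v := by
        conv_rhs => rw [hb]
        module
      have e4 : N = (m w' - m v) - (a • m u + (b - 1) • m v + c • m w) := by simp only [N]; module
      rw [e3] at e1
      rw [← neg_sub w' v, dotProduct_neg, e4, sub_dotProduct, e1, e2]; simp
    have hx : ∀ x ∈ A, N ⬝ᵥ (x - w') = 0 := by
      intro x hx
      have hb' := P.bary (mem_aS (hS hu)) (mem_aS (hS hv)) (mem_aS hwA) (mem_aS hx) h2.ne
      have hsum' : orr φ v w' x / orr φ u v w' + orr φ w' u x / orr φ u v w' +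
          orr φ u v x / orr φ u v w' = 1 := by
        rw [← add_div, ← add_div, ← P.sum1, div_self h2.ne]
      have e3 : x - w' = (orr φ v w' x / orr φ u v w') • (u - w') +
          (orr φ w' u x / orr φ u v w') • (v - w') := by
        conv_lhs => rw [hb', show orr φ u v x / orr φ u v w' = 1 - orr φ v w' x / orr φ u v w' -
          orr φ w' u x / orr φ u v w' by linarith]
        module
      rw [e3, dotProduct_add, dotProduct_smul, dotProduct_smul, hNu, hNv]; simp
    rw [← sub_sub_sub_cancel_right p q w', dotProduct_sub, hx p hp, hx q hq, sub_zero]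
  obtain ⟨l, hl⟩ := key
  obtain ⟨t, ht, -⟩ := H.cov p (subset_convexHull _ _ hp)
  obtain ⟨u, hu, v, hv, huv⟩ := one_lt_card.1 (by rw [H.card t ht]; norm_num : 1 < t.card)
  obtain ⟨w, hw, hwu, hwv, -⟩ := third (H.card t ht) hu hv huv
  have hS := H.sub t ht
  have h0 := H.S0 P (hS hu) (hS hv) (hS hw) huv hwu.symm hwv.symm
  have hrep : ∀ x ∈ A, ∃ a b c : ℝ, a + b + c = 1 ∧ x = a • u + b • v + c • w ∧
      m x ⬝ᵥ (p - q) = (a • m u + b • m v + c • m w) ⬝ᵥ (p - q) := by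
    intro x hx
    have hsum : orr φ v w x / orr φ u v w + orr φ w u x / orr φ u v w +
        orr φ u v x / orr φ u v w = 1 := by
      rw [← add_div, ← add_div, ← P.sum1, div_self h0]
    have hb := P.bary (mem_aS (hS hu)) (mem_aS (hS hv)) (mem_aS (hS hw)) (mem_aS hx) h0
    refine ⟨_, _, _, hsum, hb, ?_⟩
    have := congrArg (fun z => l (φ z)) hb
    simp only [aff3 φ _ _ _ _ _ _ hsum, map_add, map_smul] at this
    rw [hl x hx, hl u (hS hu), hl v (hS hv), hl w (hS hw)] at this
    rw [this]; simp only [add_dotProduct, smul_dotProduct]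
  obtain ⟨a, b, c, k1, k2, k3⟩ := hrep p hp
  obtain ⟨a', b', c', k1', k2', k3'⟩ := hrep q hq
  have e1 := tri3 (a := a - a') (b := b - b') (c := c - c') (by linarith) (hm t ht u hu v hv)
    (hm t ht u hu w hw) (hm t ht v hv w hw)
  have e2 : (a - a') • u + (b - b') • v + (c - c') • w = p - q := by rw [k2, k2']; module
  rw [e2] at e1
  rw [sub_dotProduct, k3, k3', ← sub_dotProduct, ← e1]
  congr 1; module

end PartF3

section PartG1
variable {V : Type*} [NormedAddCommGroup V] [NormedSpace ℝ V] [FiniteDimensional ℝ V]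

lemma Exd.mono {A B : Finset V} (h : Exd A) (hB : B ⊆ A) : Exd B := fun u hu => by
  obtain ⟨α, hα⟩ := h u (hB hu)
  exact ⟨α, fun v hv => hα v (hB hv)⟩

lemma exists_min (P : Set V) (hP : IsPolytope P) : ∃ S : Finset V, P = cv S ∧ Exd S := by
  obtain ⟨S0, h0⟩ := hP
  have hex : ∃ n, ∃ S : Finset V, P = cv S ∧ S.card = n := ⟨_, S0, h0, rfl⟩
  obtain ⟨S, hS, hc⟩ := Nat.find_spec hex
  refine ⟨S, hS, fun u hu => exposed_of_not_mem S u fun hmem => ?_⟩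
  refine Nat.find_min hex (m := (S.erase u).card) ?_ ⟨S.erase u, ?_, rfl⟩
  · rw [← hc]; exact Finset.card_erase_lt_of_mem hu
  · rw [hS]
    refine Set.Subset.antisymm (convexHull_min ?_ (convex_convexHull ℝ _))
      (convexHull_mono (coe_subset.2 (Finset.erase_subset _ _)))
    intro x hx
    show x ∈ convexHull ℝ ((S.erase u : Finset V) : Set V)
    rw [Finset.coe_erase]
    by_cases h : x = u
    · rw [h]; exact hmem
    · exact subset_convexHull _ _ ⟨hx, h⟩

lemma sing_fs {S : Finset V} (h : Exd S) {v : V} (hv : v ∈ S) : {v} ∈ fs S := by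
  obtain ⟨α, hα⟩ := h v hv
  have : ({v} : Finset V) = topS S α := by
    ext x
    rw [mem_singleton, mem_topS]
    constructor
    · grind
    · grind
  rw [this]; exact topS_mem_fs _ _

lemma vert_iff {S : Finset V} (h : Exd S) (v : V) : IsFace (cv S) {v} ↔ v ∈ S := by
  rw [isFace_iff]
  constructor
  · rintro ⟨B, hB, he⟩
    have hBn : B ≠ ∅ := by rintro rfl; simp [cv] at he
    obtain ⟨b, hb⟩ := nonempty_iff_ne_empty.2 hBn
    have : b ∈ ({v} : Set V) := he ▸ subset_convexHull ℝ _ hb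
    rw [← Set.mem_singleton_iff.1 this]
    exact (mem_fs.1 hB).1 hb
  · intro hv
    exact ⟨{v}, sing_fs h hv, by simp [cv]⟩

lemma exd_cv_inj {A B : Finset V} (hA : Exd A) (hB : Exd B) (h : cv A = cv B) : A = B := by
  ext v; rw [← vert_iff hA, h, vert_iff hB]

lemma exd_pair [DecidableEq V] (u v : V) : Exd ({u, v} : Finset V) := by
  have key : ∀ u v : V, ∃ α : V →ₗ[ℝ] ℝ, v ≠ u → α v < α u := fun u v => by
    by_cases h : v = u
    · exact ⟨0, fun h' => absurd h h'⟩
    obtain ⟨α, hα⟩ := exposed_of_not_mem {u, v} u (fun hm => by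
      have hsub : ((({u, v} : Finset V) : Set V) \ {u}) ⊆ {v} := by
        grind
      have := convexHull_mono hsub hm
      rw [convexHull_singleton] at this
      exact h (Set.mem_singleton_iff.1 this).symm)
    exact ⟨α, fun _ => hα v (by simp) h⟩
  intro x hx
  rcases mem_insert.1 hx with rfl | hx
  · obtain ⟨α, h⟩ := key x v
    refine ⟨α, fun y hy hne => ?_⟩
    rcases mem_insert.1 hy with rfl | hy
    · exact absurd rfl hne
    · rw [mem_singleton.1 hy] at hne ⊢; exact h hne
  · rw [mem_singleton.1 hx]
    obtain ⟨α, h⟩ := key v u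
    refine ⟨α, fun y hy hne => ?_⟩
    rcases mem_insert.1 hy with rfl | hy
    · exact h hne
    · exact absurd (mem_singleton.1 hy) hne

lemma edge_iff [DecidableEq V] {S : Finset V} (h : Exd S) (u v : V) :
    IsFace (cv S) (segment ℝ u v) ↔ ({u, v} : Finset V) ∈ fs S := by
  have hs : segment ℝ u v = cv ({u, v} : Finset V) := by
    rw [cv, Finset.coe_pair, convexHull_pair]
  rw [isFace_iff, hs]
  constructor
  · rintro ⟨B, hB, he⟩
    rw [exd_cv_inj (exd_pair u v) (h.mono (mem_fs.1 hB).1) he]; exact hB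
  · exact fun hB => ⟨_, hB, rfl⟩

lemma rk_le_one {B : Finset V} (h : rk B = 1) : ∃ v, B = {v} := by
  have hB : B ≠ ∅ := by rintro rfl; simp [rk_empty] at h
  obtain ⟨v, hv⟩ := nonempty_iff_ne_empty.2 hB
  refine ⟨v, Finset.eq_singleton_iff_unique_mem.2 ⟨hv, fun x hx => ?_⟩⟩
  have h0 : Module.finrank ℝ (vectorSpan ℝ (B : Set V)) = 0 := by
    simp only [rk, if_neg hB] at h; omega
  have hm := vsub_mem_vectorSpan ℝ (mem_coe.2 hx) (mem_coe.2 hv)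
  rw [Submodule.finrank_eq_zero.1 h0, Submodule.mem_bot] at hm
  exact sub_eq_zero.1 hm

lemma rk_sing (v : V) : rk ({v} : Finset V) = 1 := by
  simp [rk]

lemma fr_one {S : Finset V} (h : Exd S) : (fr 1 S).card = S.card := by
  have : fr 1 S = S.image (fun v => ({v} : Finset V)) := by
    ext B
    simp only [fr, mem_filter, mem_image]
    constructor
    · rintro ⟨h1, h2⟩
      obtain ⟨v, rfl⟩ := rk_le_one h2
      exact ⟨v, (mem_fs.1 h1).1 (by simp), rfl⟩
    · rintro ⟨v, hv, rfl⟩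
      exact ⟨sing_fs h hv, rk_sing v⟩
  rw [this, Finset.card_image_of_injective _ Finset.singleton_injective]

lemma rk_pair [DecidableEq V] {u v : V} (h : u ≠ v) : rk ({u, v} : Finset V) = 2 := by
  have h1 : ({u, v} : Finset V) ≠ ∅ := by simp
  rw [rk, if_neg h1, Finset.coe_pair, vectorSpan_pair, finrank_span_singleton]
  rw [vsub_eq_sub]; exact sub_ne_zero.2 h

lemma rk_two {B : Finset V} (hex : Exd B) (h : rk B = 2) : B.card = 2 := by
  have hB : B ≠ ∅ := by rintro rfl; simp [rk_empty] at h
  have h1 : Module.finrank ℝ (vectorSpan ℝ (B : Set V)) = 1 := by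
    simp only [rk, if_neg hB] at h; omega
  have h2 : 1 < B.card := by
    by_contra hc
    have : B.card = 1 := by have := Finset.card_pos.2 (nonempty_iff_ne_empty.2 hB); omega
    obtain ⟨v, rfl⟩ := Finset.card_eq_one.1 this
    rw [rk_sing] at h; omega
  by_contra h3
  obtain ⟨u, v, w, hu, hv, hw, huv, huw, hvw⟩ := Finset.two_lt_card_iff.1 (by omega : 2 < B.card)
  have hvu := vsub_mem_vectorSpan ℝ (mem_coe.2 hv) (mem_coe.2 hu)
  have hwu := vsub_mem_vectorSpan ℝ (mem_coe.2 hw) (mem_coe.2 hu)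
  obtain ⟨s, hs⟩ := (finrank_eq_one_iff_of_nonzero' (⟨_, hvu⟩ : vectorSpan ℝ (B : Set V)) (by
    intro h0; exact huv (sub_eq_zero.1 (congrArg Subtype.val h0)).symm)).1 h1 ⟨_, hwu⟩
  have hs' : s • (v - u) = w - u := congrArg Subtype.val hs
  exact noncol hex hu hv hw huv huw hvw (s := s) (by rw [← sub_add_cancel w u, ← hs']; module)

end PartG1

section PartG2
variable {d : ℕ}

noncomputable def Ed (S : Finset (Fin d → ℝ)) (T : Set (Fin d → ℝ) → Finset (Finset (Fin d → ℝ))) :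
    Finset (Finset (Fin d → ℝ)) := fr 2 S ∪ (fr 3 S).biUnion (fun B => Dg B (T (cv B)))

variable {S : Finset (Fin d → ℝ)} {T : Set (Fin d → ℝ) → Finset (Finset (Fin d → ℝ))}

abbrev HT (S : Finset (Fin d → ℝ)) (T : Set (Fin d → ℝ) → Finset (Finset (Fin d → ℝ))) : Prop :=
  ∀ G : Set (Fin d → ℝ), IsFace (cv S) G → pdim G = 2 → IsTriangulation G (T G)

lemma mem_fr {k : ℕ} {A B : Finset (Fin d → ℝ)} : B ∈ fr k A ↔ B ∈ fs A ∧ rk B = k := by simp [fr]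

lemma tri_of (hS : Exd S) (hT : HT S T) {B : Finset (Fin d → ℝ)} (hB : B ∈ fr 3 S) :
    Tri B (T (cv B)) := by
  obtain ⟨h1, h2⟩ := mem_fr.1 hB
  have hex : Exd B := hS.mono (mem_fs.1 h1).1
  obtain ⟨a, b, c⟩ := hT (cv B) (isFace_iff.2 ⟨B, h1, rfl⟩) (by rw [pdim_cv, h2]; norm_num)
  refine ⟨hex, fun t ht v hv => (vert_iff hex v).1 ((a t ht).2.1 v hv), fun t ht => (a t ht).1,
    fun x hx => ?_, fun t ht t' ht' x hx hx' => ?_⟩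
  · rw [← b] at hx
    simpa using hx
  · have := c t ht t' ht'
    rw [Finset.coe_inter] at this
    rw [← this]; exact ⟨hx, hx'⟩

lemma frame_iff (hS : Exd S) (hT : HT S T) (u v : Fin d → ℝ) :
    FrameEdge (cv S) T u v ↔ u ≠ v ∧ ({u, v} : Finset (Fin d → ℝ)) ∈ Ed S T := by
  simp only [FrameEdge, Ed, mem_union, mem_biUnion]
  refine and_congr_right fun huv => ?_
  rw [edge_iff hS]
  constructor
  · rintro (h | ⟨G, hG, hd, t, ht, hu, hv⟩)
    · exact Or.inl (mem_fr.2 ⟨h, rk_pair huv⟩)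
    · obtain ⟨B, hB, rfl⟩ := isFace_iff.1 hG
      rw [pdim_cv] at hd
      have hB3 : B ∈ fr 3 S := mem_fr.2 ⟨hB, by omega⟩
      have H := tri_of hS hT hB3
      by_cases hf : ({u, v} : Finset (Fin d → ℝ)) ∈ fs B
      · exact Or.inl (mem_fr.2 ⟨((fs_trans hB).1 hf).1, rk_pair huv⟩)
      · refine Or.inr ⟨B, hB3, ?_⟩
        have hsub : ({u, v} : Finset (Fin d → ℝ)) ⊆ t := by
          grind
        simp only [Dg, mem_filter, mem_powersetCard]
        exact ⟨⟨hsub.trans (H.sub t ht), card_pair huv⟩, hf, t, ht, hsub⟩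
  · rintro (h | ⟨B, hB, h⟩)
    · exact Or.inl (mem_fr.1 h).1
    · simp only [Dg, mem_filter, mem_powersetCard] at h
      obtain ⟨-, -, t, ht, hsub⟩ := h
      exact Or.inr ⟨cv B, isFace_iff.2 ⟨B, (mem_fr.1 hB).1, rfl⟩, by
        rw [pdim_cv, (mem_fr.1 hB).2]; norm_num, t, ht, hsub (by simp), hsub (by simp)⟩

lemma Ed_card2 (hS : Exd S) {e : Finset (Fin d → ℝ)} (he : e ∈ Ed S T) : e ⊆ S ∧ e.card = 2 := by
  simp only [Ed, mem_union, mem_biUnion] at he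
  rcases he with h | ⟨B, hB, h⟩
  · have h1 := mem_fr.1 h
    have h2 := (mem_fs.1 h1.1).1
    exact ⟨h2, rk_two (hS.mono h2) h1.2⟩
  · simp only [Dg, mem_filter, mem_powersetCard] at h
    exact ⟨h.1.1.trans (mem_fs.1 (mem_fr.1 hB).1).1, h.1.2⟩

lemma inter_face {B B' e : Finset (Fin d → ℝ)} (hB : B ∈ fs S) (hB' : B' ∈ fs S) (he : e.Nonempty)
    (h : e ⊆ B) (h' : e ⊆ B') : ∃ C ∈ fs S, C ⊆ B ∧ C ⊆ B' ∧ e ⊆ C := by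
  obtain ⟨x, hx⟩ := he
  obtain h1 | ⟨l, rfl⟩ := (mem_fs.1 hB).2
  · rw [h1] at h; simpa using h hx
  obtain h1 | ⟨l', rfl⟩ := (mem_fs.1 hB').2
  · rw [h1] at h'; simpa using h' hx
  have k := mem_topS.1 (h hx)
  have k' := mem_topS.1 (h' hx)
  refine ⟨topS S (l + l'), topS_mem_fs _ _, fun y hy => ?_, fun y hy => ?_, fun y hy => ?_⟩
  · have hy := mem_topS.1 hy
    have h1 := hy.2 x k.1
    simp only [LinearMap.add_apply] at h1
    exact mem_topS.2 ⟨hy.1, fun z hz => by linarith [k.2 z hz, k'.2 y hy.1]⟩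
  · have hy := mem_topS.1 hy
    have h1 := hy.2 x k.1
    simp only [LinearMap.add_apply] at h1
    exact mem_topS.2 ⟨hy.1, fun z hz => by linarith [k'.2 z hz, k.2 y hy.1]⟩
  · have h1 := mem_topS.1 (h hy)
    have h2 := mem_topS.1 (h' hy)
    exact mem_topS.2 ⟨h1.1, fun z hz => by
      simp only [LinearMap.add_apply]; linarith [h1.2 z hz, h2.2 z hz]⟩

lemma Ed_card (hS : Exd S) (hT : HT S T) :
    ((Ed S T).card : ℚ) = (fr 2 S).card + ∑ B ∈ fr 3 S, (((fr 1 B).card : ℚ) - 3) := by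
  have hDg : ∀ {B e : Finset (Fin d → ℝ)}, e ∈ Dg B (T (cv B)) → e ⊆ B ∧ e.card = 2 ∧ e ∉ fs B := by
    intro B e h
    simp only [Dg, mem_filter, mem_powersetCard] at h
    exact ⟨h.1.1, h.1.2, h.2.1⟩
  have hdis : Disjoint (fr 2 S) ((fr 3 S).biUnion (fun B => Dg B (T (cv B)))) := by
    rw [Finset.disjoint_left]
    intro e he he'
    obtain ⟨B, hB, h⟩ := mem_biUnion.1 he'
    obtain ⟨h1, -, h3⟩ := hDg h
    exact h3 ((fs_trans (mem_fr.1 hB).1).2 ⟨(mem_fr.1 he).1, h1⟩)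
  rw [Ed, Finset.card_union_of_disjoint hdis, Finset.card_biUnion]
  · push_cast
    congr 1
    refine sum_congr rfl fun B hB => ?_
    have hB' := mem_fr.1 hB
    obtain ⟨φ, P⟩ := Pl.exists_pl hB'.2
    have := (tri_of hS hT hB).diag_card P (nonempty_iff_ne_empty.2 (by
      rintro rfl; have := hB'.2; rw [rk_empty] at this; omega))
    rw [fr_one (hS.mono (mem_fs.1 hB'.1).1), ← this]; push_cast; ring
  · intro B hB B' hB' hne
    rw [Function.onFun, Finset.disjoint_left]
    intro e he he'
    obtain ⟨h1, h2, h3⟩ := hDg he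
    obtain ⟨h1', -, -⟩ := hDg he'
    have hB := mem_fr.1 hB
    have hB' := mem_fr.1 hB'
    obtain ⟨C, hC, c1, c2, c3⟩ := inter_face hB.1 hB'.1 (Finset.card_pos.1 (by omega)) h1 h1'
    have hCB : C ∈ fs B := (fs_trans hB.1).2 ⟨hC, c1⟩
    have hCB' : C ∈ fs B' := (fs_trans hB'.1).2 ⟨hC, c2⟩
    have hlt : rk C < 3 := by
      by_cases hc : C = B
      · have := rk_lt hCB' (fun h => hne (hc.symm.trans h)); omega
      · have := rk_lt hCB hc; omega
    have hcc := Finset.card_le_card c3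
    have hC2 : C.card = 2 := by
      have : rk C = 0 ∨ rk C = 1 ∨ rk C = 2 := by omega
      rcases this with h | h | h
      · have h0 : C.card = 0 := by rw [rk_eq_zero.1 h]; rfl
        omega
      · obtain ⟨v, hv⟩ := rk_le_one h
        have h0 : C.card = 1 := by rw [hv]; rfl
        omega
      · exact rk_two (hS.mono (mem_fs.1 hC).1) h
    rw [eq_of_subset_of_card_le c3 (by omega)] at h3
    exact h3 hCB

lemma all_pairs (hS : Exd S) (hT : HT S T) (m : (Fin d → ℝ) → (Fin d → ℝ))
    (hm : ∀ u v, ({u, v} : Finset (Fin d → ℝ)) ∈ Ed S T → (m u - m v) ⬝ᵥ (u - v) = 0) :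
    ∀ u ∈ S, ∀ v ∈ S, (m u - m v) ⬝ᵥ (u - v) = 0 := by
  suffices h : ∀ k, ∀ B ∈ fs S, rk B = k → ∀ u ∈ B, ∀ v ∈ B, (m u - m v) ⬝ᵥ (u - v) = 0 from
    h _ S (self_mem_fs S) rfl
  intro k
  induction k using Nat.strong_induction_on with
  | _ k ih =>
  intro B hB hk u hu v hv
  by_cases huv : u = v
  · simp [huv]
  have hex := hS.mono (mem_fs.1 hB).1
  have h4 : k = 0 ∨ k = 1 ∨ k = 2 ∨ k = 3 ∨ 4 ≤ k := by omega
  rcases h4 with h | h | h | h | h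
  · rw [rk_eq_zero.1 (hk.trans h)] at hu; simp at hu
  · obtain ⟨x, rfl⟩ := rk_le_one (hk.trans h)
    exact absurd ((mem_singleton.1 hu).trans (mem_singleton.1 hv).symm) huv
  · have hc := rk_two hex (hk.trans h)
    have : ({u, v} : Finset (Fin d → ℝ)) = B := eq_of_subset_of_card_le (by
      intro x hx; rcases mem_insert.1 hx with rfl | hx
      · exact hu
      · rw [mem_singleton.1 hx]; exact hv) (by rw [hc, card_pair huv])
    refine hm u v (mem_union_left _ (mem_fr.2 ⟨?_, rk_pair huv⟩))
    rw [this]; exact hB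
  · obtain ⟨φ, P⟩ := Pl.exists_pl (hk.trans h)
    have hB3 := mem_fr.2 ⟨hB, hk.trans h⟩
    refine (tri_of hS hT hB3).rigid P m (fun t ht a ha b hb => ?_) u hu v hv
    by_cases hab : a = b
    · simp [hab]
    refine hm a b ((frame_iff hS hT a b).1 ⟨hab, Or.inr ⟨cv B, isFace_iff.2 ⟨B, hB, rfl⟩, ?_, t, ht,
      ha, hb⟩⟩).2
    rw [pdim_cv, hk, h]; norm_num
  · refine stepE B (by omega) hex m (fun a ha b hb D hD hne haD hbD => ?_) u v hu hv
    exact ih (rk D) (hk ▸ rk_lt hD hne) D ((fs_trans hB).1 hD).1 rfl a haD b hbD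

end PartG2

section PartG3
variable {d : ℕ}

noncomputable def skM (c : Sym2 (Fin d) → ℝ) : Matrix (Fin d) (Fin d) ℝ :=
  Matrix.of fun i j => if i < j then c s(i, j) else if j < i then - c s(i, j) else 0

lemma skM_skew (c : Sym2 (Fin d) → ℝ) (i j : Fin d) : skM c i j = - skM c j i := by
  simp only [skM, Matrix.of_apply, Sym2.eq_swap (a := j) (b := i)]
  rcases lt_trichotomy i j with h | h | h
  · simp [h, h.not_gt]
  · simp [h]
  · simp [h, h.not_gt]

lemma skew_dot (A : Matrix (Fin d) (Fin d) ℝ) (h : ∀ i j, A i j = - A j i) (y : Fin d → ℝ) :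
    A.mulVec y ⬝ᵥ y = 0 := by
  have h1 : A.mulVec y ⬝ᵥ y = - (A.mulVec y ⬝ᵥ y) := by
    simp only [dotProduct, Matrix.mulVec, sum_mul]
    conv_rhs => rw [sum_comm]
    simp only [← sum_neg_distrib]
    refine sum_congr rfl fun i _ => sum_congr rfl fun j _ => ?_
    rw [h i j]; ring
  linarith

noncomputable def trivM (S : Finset (Fin d → ℝ)) :
    (Sym2 (Fin d) → ℝ) →ₗ[ℝ] ((S × Fin d) → ℝ) where
  toFun c := fun p => (skM c).mulVec p.1.1 p.2 + c s(p.2, p.2)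
  map_add' c c' := by
    have : skM (c + c') = skM c + skM c' := by
      ext i j; simp only [skM, Matrix.of_apply, Matrix.add_apply, Pi.add_apply]
      split_ifs <;> ring
    ext p; simp only [this, Matrix.add_mulVec, Pi.add_apply]; ring
  map_smul' a c := by
    have : skM (a • c) = a • skM c := by
      ext i j; simp only [skM, Matrix.of_apply, Matrix.smul_apply, Pi.smul_apply, smul_eq_mul]
      split_ifs <;> ring
    ext p; simp only [this, Matrix.smul_mulVec, Pi.smul_apply, smul_eq_mul, RingHom.id_apply]; ring

lemma trivM_inj (S : Finset (Fin d → ℝ)) (hne : S.Nonempty)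
    (hS : vectorSpan ℝ (S : Set (Fin d → ℝ)) = ⊤) : Function.Injective (trivM S) := by
  rw [injective_iff_map_eq_zero]
  intro c hc
  have h0 : ∀ x ∈ S, ∀ i, (skM c).mulVec x i + c s(i, i) = 0 := fun x hx i =>
    congrFun hc (⟨x, hx⟩, i)
  have hM : ∀ y, (skM c).mulVec y = 0 := by
    have : vectorSpan ℝ (S : Set (Fin d → ℝ)) ≤ LinearMap.ker (Matrix.mulVecLin (skM c)) := by
      rw [vectorSpan, Submodule.span_le]
      rintro _ ⟨x, hx, y, hy, rfl⟩
      show (skM c).mulVec (x - y) = 0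
      ext i
      rw [Matrix.mulVec_sub]
      have h1 := h0 x hx i
      have h2 := h0 y hy i
      simp only [Pi.sub_apply, Pi.zero_apply]; linarith
    intro y
    exact this (hS ▸ Submodule.mem_top)
  have hM0 : skM c = 0 := by
    ext i j
    have := congrFun (hM (Pi.single j 1)) i
    simpa using this
  obtain ⟨x, hx⟩ := hne
  have hoff : ∀ i j, i < j → c s(i, j) = 0 := fun i j hij => by
    have := congrFun (congrFun hM0 i) j
    simpa [skM, hij] using this
  ext z
  induction z using Sym2.ind with
  | _ i j =>
  rcases lt_trichotomy i j with h | h | h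
  · exact hoff i j h
  · subst h; have := h0 x hx i; rw [hM x] at this; simpa using this
  · rw [Sym2.eq_swap]; exact hoff j i h

lemma trivM_surj (S : Finset (Fin d → ℝ)) (hne : S.Nonempty)
    (hS : vectorSpan ℝ (S : Set (Fin d → ℝ)) = ⊤) (m : (Fin d → ℝ) → (Fin d → ℝ))
    (hm : ∀ u ∈ S, ∀ v ∈ S, (m u - m v) ⬝ᵥ (u - v) = 0) :
    ∃ c, ∀ p : S × Fin d, trivM S c p = m p.1 p.2 := by
  obtain ⟨x0, hx0⟩ := hne
  let Y : (S → ℝ) →ₗ[ℝ] (Fin d → ℝ) := Fintype.linearCombination ℝ (fun x : S => x.1 - x0)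
  let N : (S → ℝ) →ₗ[ℝ] (Fin d → ℝ) := Fintype.linearCombination ℝ (fun x : S => m x - m x0)
  have hpair : ∀ x z : S, (m x - m x0) ⬝ᵥ (z.1 - x0) + (x.1 - x0) ⬝ᵥ (m z - m x0) = 0 := by
    intro x z
    have h1 := hm x x.2 x0 hx0
    have h2 := hm z z.2 x0 hx0
    have h3 := hm x x.2 z z.2
    have e1 : m x - m z = (m x - m x0) - (m z - m x0) := by abel
    have e2 : x.1 - z.1 = (x.1 - x0) - (z.1 - x0) := by abel
    rw [dotProduct_comm (x.1 - x0)]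
    rw [e1, e2, sub_dotProduct, dotProduct_sub _ (x.1 - x0) (z.1 - x0),
      dotProduct_sub _ (x.1 - x0) (z.1 - x0), h1, h2] at h3
    linarith
  have hskew : ∀ a b : S → ℝ, N a ⬝ᵥ Y b + Y a ⬝ᵥ N b = 0 := by
    intro a b
    simp only [N, Y, Fintype.linearCombination_apply, sum_dotProduct, dotProduct_sum,
      smul_dotProduct, dotProduct_smul, ← sum_add_distrib]
    refine sum_eq_zero fun z _ => ?_
    rw [← smul_add, ← sum_add_distrib, sum_eq_zero, smul_zero]
    intro x _
    rw [← smul_add, hpair x z, smul_zero]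
  have hYr : LinearMap.range Y = ⊤ := by
    rw [Fintype.range_linearCombination, ← hS, vectorSpan_eq_span_vsub_set_right ℝ (mem_coe.2 hx0)]
    congr 1
    ext y; constructor
    · rintro ⟨x, rfl⟩; exact ⟨x.1, x.2, rfl⟩
    · rintro ⟨x, hx, rfl⟩; exact ⟨⟨x, hx⟩, rfl⟩
  obtain ⟨g, hg⟩ := Y.exists_rightInverse_of_surjective hYr
  have hYs : Function.Surjective Y := LinearMap.range_eq_top.1 hYr
  have hker : ∀ a, Y a = 0 → N a = 0 := by
    intro a ha
    refine dotProduct_eq_zero _ fun w => ?_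
    obtain ⟨b, rfl⟩ := hYs w
    have := hskew a b
    rw [ha, zero_dotProduct, add_zero] at this
    exact this
  let M : (Fin d → ℝ) →ₗ[ℝ] (Fin d → ℝ) := N ∘ₗ g
  have hMY : ∀ a, M (Y a) = N a := by
    intro a
    have h1 : Y (g (Y a) - a) = 0 := by
      rw [map_sub, sub_eq_zero]; exact LinearMap.congr_fun hg (Y a)
    have h2 := hker _ h1
    rw [map_sub, sub_eq_zero] at h2
    exact h2
  have hMsk : ∀ v w, M v ⬝ᵥ w + v ⬝ᵥ M w = 0 := by
    intro v w
    obtain ⟨a, rfl⟩ := hYs v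
    obtain ⟨b, rfl⟩ := hYs w
    rw [hMY, hMY]; exact hskew a b
  have hMx : ∀ x : S, M (x.1 - x0) = m x - m x0 := by
    intro x
    have h1 : Y (Pi.single x 1) = x.1 - x0 := by
      simp [Y, Fintype.linearCombination_apply_single]
    have h2 : N (Pi.single x 1) = m x - m x0 := by
      simp [N, Fintype.linearCombination_apply_single]
    rw [← h1, hMY, h2]
  have hA : ∀ i j, M (Pi.single j 1) i = - M (Pi.single i 1) j := by
    intro i j
    have := hMsk (Pi.single j 1) (Pi.single i 1)
    simp only [dotProduct_single_one, single_one_dotProduct] at this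
    linarith
  let c : Sym2 (Fin d) → ℝ := Sym2.lift ⟨fun i j => if i = j then m x0 i - M x0 i else
    if i < j then M (Pi.single j 1) i else M (Pi.single i 1) j, by
      intro i j
      rcases lt_trichotomy i j with h | h | h
      · simp [h, h.ne, h.ne', h.not_gt]
      · simp [h]
      · simp [h, h.ne, h.ne', h.not_gt]⟩
  have hc : skM c = LinearMap.toMatrix' M := by
    ext i j
    have ht : LinearMap.toMatrix' M i j = M (Pi.single j 1) i := by
      rw [LinearMap.toMatrix'_apply]
    rw [ht]
    simp only [skM, Matrix.of_apply, c, Sym2.lift_mk]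
    rcases lt_trichotomy i j with h | h | h
    · simp [h, h.ne]
    · subst h; have := hA i i; simp; linarith
    · simp [h, h.ne', h.not_gt]; linarith [hA i j]
  refine ⟨c, fun p => ?_⟩
  show (skM c).mulVec p.1.1 p.2 + c s(p.2, p.2) = _
  rw [hc, LinearMap.toMatrix'_mulVec]
  have h1 := congrFun (hMx p.1) p.2
  rw [map_sub] at h1
  simp only [Pi.sub_apply] at h1
  simp only [c, Sym2.lift_mk, if_true]
  linarith

lemma trivM_motion (S : Finset (Fin d → ℝ)) (c : Sym2 (Fin d) → ℝ) (u v : S) :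
    ((fun i => trivM S c (u, i)) - fun i => trivM S c (v, i)) ⬝ᵥ (u.1 - v.1) = 0 := by
  have : ((fun i => trivM S c (u, i)) - fun i => trivM S c (v, i)) = (skM c).mulVec (u.1 - v.1) := by
    ext i
    rw [Matrix.mulVec_sub]
    simp [trivM]
  rw [this]
  exact skew_dot _ (skM_skew c) _

end PartG3

section PartG4
variable {d : ℕ}

noncomputable def RM (E : Finset (Finset (Fin d → ℝ))) (S : Finset (Fin d → ℝ)) :
    Matrix E (S × Fin d) ℝ :=
  Matrix.of fun e p => if p.1.1 ∈ e.1 then (∑ y ∈ e.1, (p.1.1 - y)) p.2 else 0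

noncomputable def exM (S : Finset (Fin d → ℝ)) (m : S × Fin d → ℝ) : (Fin d → ℝ) → (Fin d → ℝ) :=
  fun x i => if h : x ∈ S then m (⟨x, h⟩, i) else 0

variable {E : Finset (Finset (Fin d → ℝ))} {S : Finset (Fin d → ℝ)}

lemma RM_mulVec (m : S × Fin d → ℝ) (e : E) (u v : Fin d → ℝ)
    (huv : u ≠ v) (he : e.1 = {u, v}) (heS : e.1 ⊆ S) :
    (RM E S).mulVec m e = (exM S m u - exM S m v) ⬝ᵥ (u - v) := by
  have h1 : (RM E S).mulVec m e =
      ∑ x ∈ S, if x ∈ e.1 then (∑ y ∈ e.1, (x - y)) ⬝ᵥ exM S m x else 0 := by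
    rw [Matrix.mulVec, dotProduct, Fintype.sum_prod_type,
      ← Finset.sum_coe_sort S (fun x => if x ∈ e.1 then (∑ y ∈ e.1, (x - y)) ⬝ᵥ exM S m x else 0)]
    refine sum_congr rfl fun x _ => ?_
    by_cases hx : x.1 ∈ e.1
    · simp only [RM, Matrix.of_apply, if_pos hx, dotProduct]
      refine sum_congr rfl fun i _ => ?_
      simp [exM]
    · simp only [RM, Matrix.of_apply, if_neg hx, zero_mul, Finset.sum_const_zero]
  rw [h1, ← sum_filter]
  have h2 : S.filter (fun x => x ∈ e.1) = {u, v} := by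
    grind
  rw [h2, sum_pair huv, he, sum_pair huv, sum_pair huv, sub_self, sub_self,
    zero_add, add_zero, dotProduct_comm _ (exM S m u), dotProduct_comm _ (exM S m v),
    ← neg_sub u v, dotProduct_neg, sub_dotProduct]
  ring

noncomputable def strM (E : Finset (Finset (Fin d → ℝ))) :
    (E → ℝ) →ₗ[ℝ] ((Fin d → ℝ) → (Fin d → ℝ) → ℝ) where
  toFun w := fun u v => if u = v then 0 else ∑ e : E, if u ∈ e.1 ∧ v ∈ e.1 then w e else 0
  map_add' w w' := by
    ext u v
    simp only [Pi.add_apply]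
    split_ifs
    · simp
    · rw [← sum_add_distrib]
      refine sum_congr rfl fun e _ => ?_
      split_ifs <;> simp
  map_smul' a w := by
    ext u v
    simp only [Pi.smul_apply, smul_eq_mul, RingHom.id_apply]
    split_ifs
    · simp
    · rw [mul_sum]
      refine sum_congr rfl fun e _ => ?_
      split_ifs <;> simp

lemma pair_of {e : Finset (Fin d → ℝ)} (h : e.card = 2) {u v : Fin d → ℝ} (huv : u ≠ v)
    (hu : u ∈ e) (hv : v ∈ e) : e = {u, v} := by
  refine (eq_of_subset_of_card_le (fun x hx => ?_) (by rw [h, card_pair huv])).symm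
  rcases mem_insert.1 hx with rfl | hx
  · exact hu
  · rw [mem_singleton.1 hx]; exact hv

lemma stM_symm (w : E → ℝ) (u v : Fin d → ℝ) : strM E w u v = strM E w v u := by
  simp only [strM, LinearMap.coe_mk, AddHom.coe_mk, eq_comm (a := u), and_comm (a := u ∈ _)]

lemma stM_mem (hE : ∀ e ∈ E, e.card = 2) (w : E → ℝ) (u v : Fin d → ℝ) (h : strM E w u v ≠ 0) :
    u ≠ v ∧ ({u, v} : Finset (Fin d → ℝ)) ∈ E := by
  simp only [strM, LinearMap.coe_mk, AddHom.coe_mk] at h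
  by_cases huv : u = v
  · simp [huv] at h
  rw [if_neg huv] at h
  obtain ⟨e, -, he⟩ := Finset.exists_ne_zero_of_sum_ne_zero h
  have hh : u ∈ e.1 ∧ v ∈ e.1 := by
    by_contra hc; exact he (if_neg hc)
  refine ⟨huv, ?_⟩
  rw [← pair_of (hE e e.2) huv hh.1 hh.2]; exact e.2

lemma stM_val (hE : ∀ e ∈ E, e.card = 2) (w : E → ℝ) (u v : Fin d → ℝ) (huv : u ≠ v) (e : E)
    (he : e.1 = {u, v}) : strM E w u v = w e := by
  simp only [strM, LinearMap.coe_mk, AddHom.coe_mk]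
  rw [if_neg huv, Finset.sum_eq_single e]
  · rw [if_pos]; rw [he]; simp
  · intro f _ hf
    rw [if_neg]
    rintro ⟨h1, h2⟩
    exact hf (Subtype.ext ((pair_of (hE f f.2) huv h1 h2).trans he.symm))
  · intro h; exact absurd (mem_univ _) h

lemma stM_inj (hE : ∀ e ∈ E, e.card = 2) : Function.Injective (strM E) := by
  intro w w' h
  ext e
  obtain ⟨u, v, huv, he⟩ := card_eq_two.1 (hE e e.2)
  rw [← stM_val hE w u v huv e he, h, stM_val hE w' u v huv e he]

lemma stM_bal (hE : ∀ e ∈ E, e ⊆ S ∧ e.card = 2) (w : E → ℝ) (v : S) (i : Fin d) :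
    (∑ᶠ u : Fin d → ℝ, strM E w u v • (v.1 - u)) i = (RM E S).transpose.mulVec w (v, i) := by
  have hs : (Function.support fun u : Fin d → ℝ => strM E w u v • (v.1 - u)) ⊆ (S : Set _) := by
    intro u hu
    have h1 : strM E w u v ≠ 0 := fun h => hu (by simp [h])
    exact (hE _ (stM_mem (fun e he => (hE e he).2) w u v h1).2).1 (by simp)
  rw [finsum_eq_sum_of_support_subset _ hs, Finset.sum_apply]
  have h2 : (RM E S).transpose.mulVec w (v, i) =
      ∑ e : E, ∑ u ∈ S, (if u ∈ e.1 ∧ v.1 ∈ e.1 then w e else 0) * (v.1 - u) i := by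
    rw [Matrix.mulVec, dotProduct]
    refine sum_congr rfl fun e _ => ?_
    simp only [RM, Matrix.transpose_apply, Matrix.of_apply]
    by_cases hv : v.1 ∈ e.1
    · simp only [hv, and_true, if_true, ite_mul, zero_mul]
      rw [← sum_filter]
      have : S.filter (fun x => x ∈ e.1) = e.1 := by
        grind
      rw [this, Finset.sum_apply, sum_mul]
      exact sum_congr rfl fun _ _ => mul_comm _ _
    · simp [hv]
  rw [h2, sum_comm]
  refine sum_congr rfl fun u _ => ?_
  rw [← sum_mul, Pi.smul_apply, smul_eq_mul]
  by_cases huv : u = v.1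
  · simp [huv]
  · simp only [strM, LinearMap.coe_mk, AddHom.coe_mk, if_neg huv]

end PartG4

section PartG5
variable {d : ℕ} {S : Finset (Fin d → ℝ)} {T : Set (Fin d → ℝ) → Finset (Finset (Fin d → ℝ))}

lemma ker_RM (hS : Exd S) (hT : HT S T) (hne : S.Nonempty)
    (hsp : vectorSpan ℝ (S : Set (Fin d → ℝ)) = ⊤) :
    Module.finrank ℝ (LinearMap.ker (RM (Ed S T) S).mulVecLin) = (d + 1).choose 2 := by
  have : LinearMap.ker (RM (Ed S T) S).mulVecLin = LinearMap.range (trivM S) := by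
    ext m
    rw [LinearMap.mem_ker, LinearMap.mem_range, Matrix.mulVecLin_apply]
    constructor
    · intro h
      obtain ⟨c, hc⟩ := trivM_surj S hne hsp (exM S m) (all_pairs hS hT (exM S m) (by
        intro u v he
        by_cases huv : u = v
        · simp [huv]
        have := RM_mulVec m ⟨_, he⟩ u v huv rfl (Ed_card2 hS he).1
        rw [← this, h]; rfl))
      refine ⟨c, ?_⟩
      ext p
      rw [hc p]
      simp [exM]
    · rintro ⟨c, rfl⟩
      ext e
      have h2 := Ed_card2 hS e.2
      obtain ⟨u, v, huv, he⟩ := card_eq_two.1 h2.2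
      rw [RM_mulVec _ e u v huv he h2.1]
      have hu : u ∈ S := h2.1 (by rw [he]; simp)
      have hv : v ∈ S := h2.1 (by rw [he]; simp)
      have := trivM_motion S c ⟨u, hu⟩ ⟨v, hv⟩
      have eu : exM S (trivM S c) u = fun i => trivM S c (⟨u, hu⟩, i) := by ext i; simp [exM, hu]
      have ev : exM S (trivM S c) v = fun i => trivM S c (⟨v, hv⟩, i) := by ext i; simp [exM, hv]
      rw [eu, ev]; exact this
  rw [this, LinearMap.finrank_range_of_inj (trivM_inj S hne hsp), Module.finrank_fintype_fun_eq_card,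
    Sym2.card, Fintype.card_fin]

lemma ker_RMt (hS : Exd S) (hT : HT S T) (hne : S.Nonempty)
    (hsp : vectorSpan ℝ (S : Set (Fin d → ℝ)) = ⊤) :
    (Module.finrank ℝ (LinearMap.ker (RM (Ed S T) S).transpose.mulVecLin) : ℚ) =
      (d + 1).choose 2 - d * S.card + (Ed S T).card := by
  have h1 := LinearMap.finrank_range_add_finrank_ker (RM (Ed S T) S).mulVecLin
  have h2 := LinearMap.finrank_range_add_finrank_ker (RM (Ed S T) S).transpose.mulVecLin
  have h3 := Matrix.rank_transpose (RM (Ed S T) S)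
  rw [Matrix.rank, Matrix.rank] at h3
  rw [ker_RM hS hT hne hsp, Module.finrank_fintype_fun_eq_card] at h1
  rw [h3, Module.finrank_fintype_fun_eq_card] at h2
  simp only [Fintype.card_prod, Fintype.card_coe, Fintype.card_fin] at h1 h2
  have h1' := congrArg (Nat.cast : ℕ → ℚ) h1
  have h2' := congrArg (Nat.cast : ℕ → ℚ) h2
  push_cast at h1' h2'
  linarith

lemma stress_iff (hS : Exd S) (hT : HT S T) (ω : (Fin d → ℝ) → (Fin d → ℝ) → ℝ) :
    IsStress (cv S) T ω ↔
      ∃ w ∈ LinearMap.ker (RM (Ed S T) S).transpose.mulVecLin, strM (Ed S T) w = ω := by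
  have hE : ∀ e ∈ Ed S T, e ⊆ S ∧ e.card = 2 := fun e he => Ed_card2 hS he
  have hE2 : ∀ e ∈ Ed S T, e.card = 2 := fun e he => (hE e he).2
  constructor
  · rintro ⟨h1, h2, h3⟩
    choose a b hab he using fun e : Ed S T => card_eq_two.1 (hE2 e e.2)
    have key : strM (Ed S T) (fun e => ω (a e) (b e)) = ω := by
      ext u v
      by_cases h : u ≠ v ∧ ({u, v} : Finset (Fin d → ℝ)) ∈ Ed S T
      · have hv := stM_val hE2 (fun e => ω (a e) (b e)) u v h.1 ⟨_, h.2⟩ rfl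
        rw [hv]
        have hp := he ⟨_, h.2⟩
        have hne := hab ⟨_, h.2⟩
        generalize a ⟨_, h.2⟩ = a' at *
        generalize b ⟨_, h.2⟩ = b' at *
        simp only at hp
        have ha : a' ∈ ({u, v} : Finset (Fin d → ℝ)) := by rw [hp]; simp
        have hb : b' ∈ ({u, v} : Finset (Fin d → ℝ)) := by rw [hp]; simp
        simp only [mem_insert, mem_singleton] at ha hb
        rcases ha with rfl | rfl <;> rcases hb with rfl | rfl
        · exact absurd rfl hne
        · rfl
        · exact h1 _ _
        · exact absurd rfl hne
      · have e1 : strM (Ed S T) (fun e => ω (a e) (b e)) u v = 0 := by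
          by_contra hc; exact h (stM_mem hE2 _ u v hc)
        have e2 : ω u v = 0 := by
          by_contra hc; exact h ((frame_iff hS hT u v).1 (h2 u v hc))
        rw [e1, e2]
    refine ⟨_, ?_, key⟩
    rw [LinearMap.mem_ker, Matrix.mulVecLin_apply]
    ext p
    have := stM_bal hE (fun e => ω (a e) (b e)) p.1 p.2
    rw [key, h3 p.1 ((vert_iff hS _).2 p.1.2)] at this
    exact this.symm
  · rintro ⟨w, hw, rfl⟩
    rw [LinearMap.mem_ker, Matrix.mulVecLin_apply] at hw
    refine ⟨stM_symm w, fun u v h => (frame_iff hS hT u v).2 (stM_mem hE2 w u v h), fun v hv => ?_⟩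
    ext i
    have := stM_bal hE w ⟨v, (vert_iff hS v).1 hv⟩ i
    rw [hw] at this
    exact this

end PartG5

end Aux

theorem stress_space_dimension (d : ℕ) (hd : 3 ≤ d) (P : Set (Fin d → ℝ))
    (hP : IsPolytope P) (hdim : pdim P = (d : ℤ))
    (T : Set (Fin d → ℝ) → Finset (Finset (Fin d → ℝ)))
    (hT : ∀ G : Set (Fin d → ℝ), IsFace P G → pdim G = 2 → IsTriangulation G (T G)) :
    ∃ (m : ℕ) (b : Fin m → ((Fin d → ℝ) → (Fin d → ℝ) → ℝ)),
      (m : ℚ) = (toricG P).coeff 2 ∧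
      (∀ i, IsStress P T (b i)) ∧
      LinearIndependent ℝ b ∧
      (∀ ω : (Fin d → ℝ) → (Fin d → ℝ) → ℝ, IsStress P T ω →
        ∃ c : Fin m → ℝ, ω = ∑ i, c i • b i) := by
  obtain ⟨S, rfl, hS⟩ := exists_min P hP
  have hrk : rk S = d + 1 := by rw [pdim_cv] at hdim; omega
  have hne : S ≠ ∅ := by rintro rfl; rw [rk_empty] at hrk; omega
  have hne' := Finset.nonempty_iff_ne_empty.2 hne
  have hsp : vectorSpan ℝ (S : Set (Fin d → ℝ)) = ⊤ := by
    apply Submodule.eq_top_of_finrank_eq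
    simp only [rk, if_neg hne] at hrk
    rw [Module.finrank_fintype_fun_eq_card, Fintype.card_fin]; omega
  have hcard := ker_RMt hS hT hne' hsp
  have hE2 : ∀ e ∈ Ed S T, e.card = 2 := fun e he => (Ed_card2 hS he).2
  set K := LinearMap.ker (RM (Ed S T) S).transpose.mulVecLin with hK
  let B := Module.finBasis ℝ K
  refine ⟨Module.finrank ℝ K, fun i => strM (Ed S T) (B i).1, ?_, fun i => ?_, ?_, fun ω hω => ?_⟩
  · rw [hcard, g2_formula hd hrk, Ed_card hS hT, fr_one hS]; ring
  · exact (stress_iff hS hT _).2 ⟨_, (B i).2, rfl⟩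
  · refine B.linearIndependent.map' ((strM (Ed S T)).comp K.subtype) ?_
    rw [LinearMap.ker_eq_bot, LinearMap.coe_comp]
    exact (stM_inj hE2).comp K.injective_subtype
  · obtain ⟨w, hw, rfl⟩ := (stress_iff hS hT ω).1 hω
    refine ⟨B.repr ⟨w, hw⟩, ?_⟩
    have h1 := congrArg ((strM (Ed S T)).comp K.subtype) (B.sum_repr ⟨w, hw⟩)
    rw [map_sum] at h1
    simp only [map_smul] at h1
    exact h1.symm
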